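/- Suppose (M, M', β) ∈ ℳ and that there exists a connected graph lift G₀ of M on at most r vertices with λ₂(A_{G₀}) ≤ λ₁(M'). Then there exists an infinite sequence of positive integers r = n₀ < n₁ < n₂ < ⋯ with n_{i+1} ≤ 4·n_i⁹ for all i, such that for each i ≥ 1 there exists a graph on n_i vertices whose adjacency matrix has largest eigenvalue λ₁(M) and second largest eigenvalue exactly λ₁(M') with eigenvalue multiplicity at least i (so the multiplicity is Ω(log log n_i)). Furthermore, if the all-ones vector is an eigenvector of M, then these graphs can be chosen to be regular. -/

import Mathlib

/-- The adjacency matrix of a finite simple graph, with real entries. -/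
noncomputable def adjMat {V : Type*} [Fintype V] (G : SimpleGraph V) : Matrix V V ℝ :=
  letI := Classical.decRel G.Adj
  G.adjMatrix ℝ

noncomputable def deg {V : Type*} [Fintype V] (G : SimpleGraph V) (v : V) : ℕ :=
  letI := Classical.decRel G.Adj
  G.degree v

/-- `G` is `d`-regular. -/
def IsRegularGraph {V : Type*} [Fintype V] (G : SimpleGraph V) (d : ℕ) : Prop :=
  ∀ v, deg G v = d

/-- The eigenvalues of a real (symmetric) matrix, i.e. the real roots of its characteristic
polynomial with multiplicity, listed in decreasing order. -/
noncomputable def eigList {V : Type*} [Fintype V] [DecidableEq V] (A : Matrix V V ℝ) : List ℝ :=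
  (A.charpoly.roots.sort (· ≤ ·)).reverse

/-- `lam A i` is `λ_i(A)`, the `i`-th largest eigenvalue (counted with multiplicity, 1-indexed)
of a real symmetric matrix `A`. -/
noncomputable def lam {V : Type*} [Fintype V] [DecidableEq V] (A : Matrix V V ℝ) (i : ℕ) : ℝ :=
  (eigList A).getD (i - 1) 0

/-- The multiplicity of `μ` as an eigenvalue of `A`: the dimension of the `μ`-eigenspace. -/
noncomputable def eigMult {V : Type*} [Fintype V] [DecidableEq V] (A : Matrix V V ℝ) (μ : ℝ) : ℕ :=
  Module.finrank ℝ (Module.End.eigenspace (Matrix.mulVecLin A) μ)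

/-- A nonnegative square matrix is irreducible iff the associated (multi)graph is connected:
between any two distinct indices there is a walk. -/
def Irred {k : ℕ} (M : Matrix (Fin k) (Fin k) ℕ) : Prop :=
  ∀ i j, i ≠ j → ∃ n : ℕ, 0 < (M ^ n) i j

/-- A graph lift of a symmetric nonnegative integer matrix `M` with zero diagonal: a
`k`-partite graph `G`, with parts `V_i = P⁻¹(i)`, such that for `i ≠ j` the bipartite graph
between `V_i` and `V_j` is `M i j`-regular. -/
structure IsGraphLift {V : Type*} [Fintype V] {k : ℕ} (M : Matrix (Fin k) (Fin k) ℕ)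
    (G : SimpleGraph V) (P : V → Fin k) : Prop where
  parts_cover : Function.Surjective P
  not_adj_within : ∀ v w, G.Adj v w → P v ≠ P w
  between_regular : ∀ (v : V) (j : Fin k), j ≠ P v →
    {w : V | G.Adj v w ∧ P w = j}.ncard = M (P v) j

/-- `M'` is a sign matrix of `M`: a symmetric integer matrix with `M' i j ≡ M i j (mod 2)`
and `|M' i j| ≤ M i j` for all `i, j`. -/
def IsSignMatrix {k : ℕ} (M : Matrix (Fin k) (Fin k) ℕ) (M' : Matrix (Fin k) (Fin k) ℤ) :
    Prop :=
  M'.IsSymm ∧ ∀ i j, (2 : ℤ) ∣ (M' i j - (M i j : ℤ)) ∧ |M' i j| ≤ (M i j : ℤ)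

/-- A natural number matrix viewed as a real matrix. -/
def natToReal {k : ℕ} (M : Matrix (Fin k) (Fin k) ℕ) : Matrix (Fin k) (Fin k) ℝ :=
  Matrix.of fun i j => (M i j : ℝ)

/-- An integer matrix viewed as a real matrix. -/
def intToReal {k : ℕ} (M' : Matrix (Fin k) (Fin k) ℤ) : Matrix (Fin k) (Fin k) ℝ :=
  Matrix.of fun i j => (M' i j : ℝ)

/-- The matrix `D = (M - M')/2`. -/
noncomputable def DMat {k : ℕ} (M : Matrix (Fin k) (Fin k) ℕ)
    (M' : Matrix (Fin k) (Fin k) ℤ) : Matrix (Fin k) (Fin k) ℝ :=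
  (1 / 2 : ℝ) • (natToReal M - intToReal M')

/-- Entrywise absolute value of a real matrix. -/
def absMat {k : ℕ} (A : Matrix (Fin k) (Fin k) ℝ) : Matrix (Fin k) (Fin k) ℝ :=
  Matrix.of fun i j => |A i j|

/-- `σ = Σ_{i,j} √(M_{ij})`. -/
noncomputable def sigmaM {k : ℕ} (M : Matrix (Fin k) (Fin k) ℕ) : ℝ :=
  ∑ i, ∑ j, Real.sqrt (M i j)

/-- The set `ℳ` of triples `(M, M', β)`: `M` is an irreducible symmetric nonnegative integer
matrix with zero diagonal, `M'` is a sign matrix of `M`, `β ∈ (0, 1/2)`, and (with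
`D = (M - M')/2`, `γ = λ₁(|D - βM|)`, `σ = Σ_{i,j} √(M_{ij})`) the matrix
`[[(1-2β)λ₁(M') + 2γ + 7σ, 2λ₁(D)], [2λ₁(D), 2λ₁(D) + σ]]` has top eigenvalue at most
`λ₁(M')`. -/
structure MemM {k : ℕ} (M : Matrix (Fin k) (Fin k) ℕ) (M' : Matrix (Fin k) (Fin k) ℤ)
    (β : ℝ) : Prop where
  symm : M.IsSymm
  diag : ∀ i, M i i = 0
  irr : Irred M
  signMatrix : IsSignMatrix M M'
  beta_mem : β ∈ Set.Ioo (0 : ℝ) (1 / 2)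
  eig_cond :
    lam !![(1 - 2 * β) * lam (intToReal M') 1 +
             2 * lam (absMat (DMat M M' - β • natToReal M)) 1 + 7 * sigmaM M,
           2 * lam (DMat M M') 1;
           2 * lam (DMat M M') 1,
           2 * lam (DMat M M') 1 + sigmaM M] 1 ≤ lam (intToReal M') 1

section partP1

set_option linter.unusedSimpArgs false
set_option linter.unusedSectionVars false
open Finset Matrix

noncomputable def qf {V : Type*} [Fintype V] (A : V → V → ℝ) (x y : V → ℝ) : ℝ :=
  ∑ a, ∑ b, A a b * x a * y b

theorem qf_eq {V : Type*} [Fintype V] (A : Matrix V V ℝ) (x y : V → ℝ) : qf A x y = x ⬝ᵥ (A *ᵥ y) := by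
  unfold qf
  simp only [dotProduct, mulVec, Finset.mul_sum]
  refine Finset.sum_congr rfl fun a _ => Finset.sum_congr rfl fun b _ => by ring

section lamapi
variable {V : Type*} [Fintype V] [DecidableEq V]

theorem lam_eq (A : Matrix V V ℝ) (hA : A.IsHermitian) (i : Fin (Fintype.card V)) :
    lam A (i+1) = hA.eigenvalues₀ i := by
  have h : eigList A = List.ofFn hA.eigenvalues₀ := by
    unfold eigList
    rw [hA.roots_charpoly_eq_eigenvalues₀]
    have h1 : (List.ofFn hA.eigenvalues₀).reverse = Multiset.sort (Multiset.map (RCLike.ofReal ∘ hA.eigenvalues₀) Finset.univ.val) (· ≤ ·) := by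
      apply List.Perm.eq_of_pairwise' (r := (· ≤ ·))
      · rw [List.pairwise_reverse]
        have := (hA.eigenvalues₀_antitone).sortedGE_ofFn
        exact this.pairwise
      · exact Multiset.pairwise_sort _ _
      · rw [← Multiset.coe_eq_coe, Multiset.sort_eq]
        simp [Fin.univ_val_map]
    rw [← h1, List.reverse_reverse]
  unfold lam
  rw [h]
  simp [List.getD_eq_getElem?_getD]

theorem spec (A : Matrix V V ℝ) (hA : A.IsSymm) :
    ∃ (μ : Fin (Fintype.card V) → ℝ) (v : Fin (Fintype.card V) → V → ℝ), Antitone μ ∧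
      (∀ i : Fin (Fintype.card V), lam A (i.val+1) = μ i) ∧ (∀ i, A *ᵥ v i = μ i • v i) ∧
      (∀ i j, v i ⬝ᵥ v j = if i = j then 1 else 0) ∧ ∀ x, x = ∑ i, (v i ⬝ᵥ x) • v i := by
  have hH : A.IsHermitian := by
    rw [Matrix.IsHermitian, Matrix.conjTranspose_eq_transpose_of_trivial]; exact hA
  let e := (Fintype.equivOfCardEq (Fintype.card_fin (Fintype.card V)) : Fin (Fintype.card V) ≃ V)
  refine ⟨hH.eigenvalues₀, fun i => ⇑(hH.eigenvectorBasis (e i)), hH.eigenvalues₀_antitone,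
    lam_eq A hH, ?_, ?_, ?_⟩
  · intro i
    have := hH.mulVec_eigenvectorBasis (e i)
    rw [this]
    congr 1
    simp [Matrix.IsHermitian.eigenvalues, e]
  · intro i j
    have := orthonormal_iff_ite.1 hH.eigenvectorBasis.orthonormal (e j) (e i)
    rw [EuclideanSpace.inner_eq_star_dotProduct] at this
    simp at this
    convert this using 2
    exact eq_comm
  · intro x
    have := hH.eigenvectorBasis.sum_repr' (WithLp.toLp 2 x)
    rw [← e.sum_comp] at this
    have h2 := congrArg (fun z => z.ofLp) this
    simp only [WithLp.ofLp_sum, WithLp.ofLp_smul] at h2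
    conv_lhs => rw [← h2]
    refine Finset.sum_congr rfl fun i _ => ?_
    rw [EuclideanSpace.inner_eq_star_dotProduct]
    simp [dotProduct_comm]

theorem spec2 (A : Matrix V V ℝ) (hA : A.IsSymm) :
    ∃ (μ : Fin (Fintype.card V) → ℝ) (v : Fin (Fintype.card V) → V → ℝ), Antitone μ ∧
      (∀ i : Fin (Fintype.card V), lam A (i.val+1) = μ i) ∧ (∀ i, A *ᵥ v i = μ i • v i) ∧
      (∀ i j, v i ⬝ᵥ v j = if i = j then 1 else 0) ∧ (∀ x, x = ∑ i, (v i ⬝ᵥ x) • v i) ∧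
      (∀ x, ∑ a, x a ^ 2 = ∑ i, (v i ⬝ᵥ x) ^ 2) ∧
      (∀ x, qf A x x = ∑ i, μ i * (v i ⬝ᵥ x) ^ 2) ∧
      (∀ x c, A *ᵥ x = c • x → ∀ i, μ i * (v i ⬝ᵥ x) = c * (v i ⬝ᵥ x)) := by
  obtain ⟨μ, v, h1, h2, h3, h4, h5⟩ := spec A hA
  have key : ∀ x y : V → ℝ, x ⬝ᵥ y = ∑ i, (v i ⬝ᵥ x) * (v i ⬝ᵥ y) := by
    intro x y
    conv_lhs => rw [h5 x]
    rw [sum_dotProduct]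
    simp [smul_dotProduct]
  have hc : ∀ x i, v i ⬝ᵥ (A *ᵥ x) = μ i * (v i ⬝ᵥ x) := by
    intro x i
    rw [dotProduct_mulVec, ← mulVec_transpose, hA.eq, h3, smul_dotProduct, smul_eq_mul]
  refine ⟨μ, v, h1, h2, h3, h4, h5, ?_, ?_, ?_⟩
  · intro x
    have := key x x
    simp only [← pow_two] at this
    rw [← this]; simp [dotProduct, pow_two]
  · intro x
    rw [qf_eq, key]
    refine Finset.sum_congr rfl fun i _ => by rw [hc]; ring
  · intro x c hx i
    rw [← hc, hx, dotProduct_smul, smul_eq_mul]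

theorem L1 (A : Matrix V V ℝ) (hA : A.IsSymm) (x : V → ℝ) :
    qf A x x ≤ lam A 1 * ∑ a, x a ^ 2 := by
  obtain ⟨μ, v, h1, h2, h3, h4, h5, h6, h7, h8⟩ := spec2 A hA
  rw [h7, h6, Finset.mul_sum]
  refine Finset.sum_le_sum fun i _ => mul_le_mul_of_nonneg_right ?_ (sq_nonneg _)
  have hpos : 0 < Fintype.card V := by have := i.2; omega
  have := h2 ⟨0, hpos⟩
  simp at this
  rw [this]
  exact h1 (Fin.mk_le_of_le_val (Nat.zero_le _))

theorem L1_ex [Nonempty V] (A : Matrix V V ℝ) (hA : A.IsSymm) :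
    ∃ v : V → ℝ, v ≠ 0 ∧ A *ᵥ v = lam A 1 • v := by
  obtain ⟨μ, v, h1, h2, h3, h4, h5, h6, h7, h8⟩ := spec2 A hA
  have hpos : 0 < Fintype.card V := Fintype.card_pos
  have := h2 ⟨0, hpos⟩
  simp at this
  refine ⟨v ⟨0, hpos⟩, ?_, by rw [this]; exact h3 _⟩
  intro h0
  have := h4 ⟨0, hpos⟩ ⟨0, hpos⟩
  rw [h0] at this
  simp at this

theorem L2 (A : Matrix V V ℝ) (hA : A.IsSymm) (u f : V → ℝ) (hu : u ≠ 0)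
    (hAu : A *ᵥ u = lam A 1 • u) (huf : u ⬝ᵥ f = 0) :
    qf A f f ≤ lam A 2 * ∑ a, f a ^ 2 := by
  obtain ⟨μ, v, h1, h2, h3, h4, h5, h6, h7, h8⟩ := spec2 A hA
  have hne : Nonempty V := by
    by_contra h
    rw [not_nonempty_iff] at h
    exact hu (Subsingleton.elim _ _)
  have hpos : 0 < Fintype.card V := Fintype.card_pos
  have e0 : lam A 1 = μ ⟨0, hpos⟩ := by have := h2 ⟨0, hpos⟩; simpa using this
  have e1 : ∀ i : Fin (Fintype.card V), i ≠ ⟨0, hpos⟩ → μ i ≤ lam A 2 := by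
    intro i hi
    have hi' : 1 ≤ i.val := by
      rcases Nat.eq_zero_or_pos i.val with h | h
      · exact absurd (Fin.ext h) hi
      · exact h
    have hlt : 1 < Fintype.card V := lt_of_le_of_lt hi' i.2
    have := h2 ⟨1, hlt⟩
    simp at this
    rw [this]
    exact h1 (Fin.mk_le_of_le_val hi')
  by_cases hle : lam A 1 ≤ lam A 2
  · exact (L1 A hA f).trans (mul_le_mul_of_nonneg_right hle (Finset.sum_nonneg fun _ _ => sq_nonneg _))
  push Not at hle
  have hc : ∀ i, i ≠ ⟨0, hpos⟩ → v i ⬝ᵥ u = 0 := by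
    intro i hi
    have a := h8 u _ hAu i
    have b := e1 i hi
    by_contra hne
    have := mul_right_cancel₀ hne a
    linarith
  have hu0 : u = (v ⟨0, hpos⟩ ⬝ᵥ u) • v ⟨0, hpos⟩ := by
    conv_lhs => rw [h5 u]
    rw [Finset.sum_eq_single ⟨0, hpos⟩]
    · intro b _ hb; rw [hc b hb, zero_smul]
    · simp
  have hne0 : v ⟨0, hpos⟩ ⬝ᵥ u ≠ 0 := by
    intro h; rw [h, zero_smul] at hu0; exact hu hu0
  have hf0 : v ⟨0, hpos⟩ ⬝ᵥ f = 0 := by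
    rw [hu0, smul_dotProduct, smul_eq_mul] at huf
    exact (mul_eq_zero.1 huf).resolve_left hne0
  rw [h7, h6, Finset.mul_sum]
  refine Finset.sum_le_sum fun i _ => ?_
  by_cases hi : i = ⟨0, hpos⟩
  · subst hi; rw [hf0]; simp
  · exact mul_le_mul_of_nonneg_right (e1 i hi) (sq_nonneg _)

theorem L3 (A : Matrix V V ℝ) (hA : A.IsSymm) (u f : V → ℝ) (μ' : ℝ) (hu : u ≠ 0)
    (hAu : A *ᵥ u = lam A 1 • u) (huf : u ⬝ᵥ f = 0) (hf : f ≠ 0) (hAf : A *ᵥ f = μ' • f)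
    (hg : ∀ g : V → ℝ, u ⬝ᵥ g = 0 → qf A g g ≤ μ' * ∑ a, g a ^ 2) : lam A 2 = μ' := by
  have hfpos : 0 < ∑ a, f a ^ 2 := by
    obtain ⟨a, ha⟩ := Function.ne_iff.1 hf
    exact Finset.sum_pos' (fun _ _ => sq_nonneg _) ⟨a, mem_univ _, (sq_pos_of_ne_zero ha)⟩
  apply le_antisymm
  · obtain ⟨μ, v, h1, h2, h3, h4, h5, h6, h7, h8⟩ := spec2 A hA
    by_cases hlt : 1 < Fintype.card V
    · have e0 : lam A 1 = μ ⟨0, by omega⟩ := by have := h2 ⟨0, by omega⟩; simpa using this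
      have e1 : lam A 2 = μ ⟨1, hlt⟩ := by have := h2 ⟨1, hlt⟩; simpa using this
      have e01 : μ ⟨1, hlt⟩ ≤ μ ⟨0, by omega⟩ := h1 (by simp)
      set v0 := v ⟨0, by omega⟩ with hv0
      set v1 := v ⟨1, hlt⟩ with hv1
      have key : ∀ s t : ℝ, (s ≠ 0 ∨ t ≠ 0) → s * (u ⬝ᵥ v0) + t * (u ⬝ᵥ v1) = 0 → lam A 2 ≤ μ' := by
        intro s t hst h0
        have o00 : v0 ⬝ᵥ v0 = 1 := by rw [hv0, h4]; simp
        have o11 : v1 ⬝ᵥ v1 = 1 := by rw [hv1, h4]; simp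
        have o01 : v0 ⬝ᵥ v1 = 0 := by rw [hv0, hv1, h4]; simp
        have o10 : v1 ⬝ᵥ v0 = 0 := by rw [hv0, hv1, h4]; simp
        have hh := hg (s • v0 + t • v1) (by simp [dotProduct_add, dotProduct_smul, h0])
        have hsum : ∑ a, (s • v0 + t • v1) a ^ 2 = s^2 + t^2 := by
          have : ∑ a, (s • v0 + t • v1) a ^ 2 = (s • v0 + t • v1) ⬝ᵥ (s • v0 + t • v1) := by
            simp [dotProduct, pow_two]
          rw [this]
          simp [dotProduct_add, dotProduct_smul, add_dotProduct, smul_dotProduct, o00, o01, o10, o11]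
          ring
        rw [hsum, qf_eq, mulVec_add, mulVec_smul, mulVec_smul, hv0, hv1, h3, h3, ← hv0, ← hv1] at hh
        simp [dotProduct_add, dotProduct_smul, add_dotProduct, smul_dotProduct, o00, o01, o10, o11] at hh
        have hp : 0 < s^2 + t^2 := by rcases hst with h | h <;> positivity
        rw [e1]
        nlinarith [mul_nonneg (sq_nonneg s) (sub_nonneg.2 e01)]
      by_cases h : u ⬝ᵥ v0 = 0
      · exact key 1 0 (by simp) (by simp [h])
      · exact key (u ⬝ᵥ v1) (-(u ⬝ᵥ v0)) (Or.inr (neg_ne_zero.2 h)) (by ring)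
    · exfalso
      have hs : Subsingleton V := Fintype.card_le_one_iff_subsingleton.1 (by omega)
      obtain ⟨a, ha⟩ := Function.ne_iff.1 hf
      obtain ⟨b, hb⟩ := Function.ne_iff.1 hu
      obtain rfl := Subsingleton.elim a b
      have : u ⬝ᵥ f = u a * f a := by
        rw [dotProduct, Finset.sum_eq_single a]
        · intro b _ hb; exact absurd (Subsingleton.elim b a) hb
        · simp
      rw [this] at huf
      rcases mul_eq_zero.1 huf with h | h
      · exact hb h
      · exact ha h
  · have := L2 A hA u f hu hAu huf
    rw [qf_eq, hAf, dotProduct_smul, smul_eq_mul] at this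
    have e : f ⬝ᵥ f = ∑ a, f a ^ 2 := by simp [dotProduct, pow_two]
    rw [e] at this
    exact le_of_mul_le_mul_right this hfpos

end lamapi

end partP1

section partP2

open Finset Matrix

set_option linter.unusedSimpArgs false
set_option linter.unusedSectionVars false
section mss
variable {V : Type*} [Fintype V] [DecidableEq V] {R : Type*} [CommRing R]

def EE (R : Type*) [CommRing R] (u v : V) : Matrix V V R := Matrix.single u v 1 + Matrix.single v u 1

def BS (S : Finset V) (Q : Matrix V V R) : Matrix V V R :=
  fun i => if i ∈ S then Pi.single i 1 else Q i

def DS (S : Finset V) (Q : Matrix V V R) : R := (BS S Q).det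

def FS (S : Finset V) : List (V × V) → Matrix V V R → R
  | [], Q => DS S Q
  | e :: L, Q => FS S L (Q + EE R e.1 e.2) + FS S L (Q - EE R e.1 e.2)

theorem Phi_swap (B : Matrix V V R) (u v : V) (huv : u ≠ v) (a b : V → R) :
    (Matrix.updateRow (Matrix.updateRow B u a) v b).det
      = -(Matrix.updateRow (Matrix.updateRow B u b) v a).det := by
  have hz : ∀ c : V → R, (Matrix.updateRow (Matrix.updateRow B u c) v c).det = 0 := by
    intro c
    apply Matrix.det_zero_of_row_eq huv
    ext j; simp [Matrix.updateRow_apply, huv]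
  have h := hz (a + b)
  rw [Matrix.det_updateRow_add] at h
  rw [Matrix.updateRow_comm _ huv, Matrix.updateRow_comm _ huv] at h
  rw [Matrix.det_updateRow_add, Matrix.det_updateRow_add] at h
  rw [Matrix.updateRow_comm _ huv.symm, Matrix.updateRow_comm _ huv.symm,
    Matrix.updateRow_comm _ huv.symm, Matrix.updateRow_comm _ huv.symm, hz, hz] at h
  linear_combination h

theorem DS_upd (S : Finset V) (u v : V) (huv : u ≠ v) (hu : u ∉ S) (hv : v ∉ S) (Q : Matrix V V R) :
    ∃ d0 d1 d2 d3 d4 : R, ∀ x y p q : R,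
      DS S (Q + x • Matrix.single u u 1 + y • Matrix.single v v 1
        + p • Matrix.single u v 1 + q • Matrix.single v u 1)
      = d0 + x * d1 + y * d2 + p * d3 + q * d4 + (x * y - p * q) * DS (insert u (insert v S)) Q := by
  set B := BS S Q with hB
  let Φ : (V → R) → (V → R) → R := fun a b => (Matrix.updateRow (Matrix.updateRow B u a) v b).det
  have hz : ∀ c : V → R, Φ c c = 0 := by
    intro c
    apply Matrix.det_zero_of_row_eq huv
    ext j; simp [Matrix.updateRow_apply, huv]
  have hsw : ∀ a b, Φ a b = - Φ b a := fun a b => Phi_swap B u v huv a b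
  have hadd : ∀ a b c, Φ a (b + c) = Φ a b + Φ a c := fun a b c => Matrix.det_updateRow_add _ _ _ _
  have hsmul : ∀ a b (t : R), Φ a (t • b) = t * Φ a b := fun a b t => Matrix.det_updateRow_smul _ _ _ _
  have hadd' : ∀ a b c, Φ (a + b) c = Φ a c + Φ b c := by
    intro a b c; rw [hsw, hadd, hsw a, hsw b]; ring
  have hsmul' : ∀ a b (t : R), Φ (t • a) b = t * Φ a b := by
    intro a b t; rw [hsw, hsmul, hsw a]; ring
  have hm : DS (insert u (insert v S)) Q = Φ (Pi.single u 1) (Pi.single v 1) := by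
    unfold DS
    congr 1
    ext i j
    by_cases h1 : i = v
    · subst h1; simp [BS, Matrix.updateRow_apply]
    · by_cases h2 : i = u
      · subst h2; simp [BS, Matrix.updateRow_apply, h1]
      · simp [BS, Matrix.updateRow_apply, h1, h2, hB]
  refine ⟨Φ (Q u) (Q v), Φ (Pi.single u 1) (Q v), Φ (Q u) (Pi.single v 1), Φ (Pi.single v 1) (Q v),
    Φ (Q u) (Pi.single u 1), ?_⟩
  intro x y p q
  have : DS S (Q + x • Matrix.single u u 1 + y • Matrix.single v v 1
        + p • Matrix.single u v 1 + q • Matrix.single v u 1)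
      = Φ (Q u + x • Pi.single u 1 + p • Pi.single v 1) (Q v + y • Pi.single v 1 + q • Pi.single u 1) := by
    unfold DS
    congr 1
    ext i j
    by_cases h1 : i = v
    · subst h1; simp [BS, Matrix.updateRow_apply, hv, Matrix.single_apply, Pi.single_apply, huv, eq_comm]
    · by_cases h2 : i = u
      · subst h2; simp [BS, Matrix.updateRow_apply, h1, hu, Matrix.single_apply, Pi.single_apply, huv.symm, eq_comm]
      · simp [BS, Matrix.updateRow_apply, h1, h2, hB, Matrix.single_apply, Ne.symm h1, Ne.symm h2]
        split_ifs <;> simp [Ne.symm h1, Ne.symm h2]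
  rw [this, hm]
  simp only [hadd, hadd', hsmul, hsmul', hz, hsw (Pi.single v 1) (Pi.single u 1)]
  ring

theorem FS_upd (S : Finset V) (u v : V) (huv : u ≠ v) (hu : u ∉ S) (hv : v ∉ S) (L : List (V × V)) :
    ∀ (Q : Matrix V V R), ∃ d0 d1 d2 d3 d4 : R, ∀ x y p q : R,
      FS S L (Q + x • Matrix.single u u 1 + y • Matrix.single v v 1
        + p • Matrix.single u v 1 + q • Matrix.single v u 1)
      = d0 + x * d1 + y * d2 + p * d3 + q * d4 + (x * y - p * q) * FS (insert u (insert v S)) L Q := by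
  induction L with
  | nil => exact fun Q => DS_upd S u v huv hu hv Q
  | cons e L ih =>
    intro Q
    obtain ⟨a0, a1, a2, a3, a4, ha⟩ := ih (Q + EE R e.1 e.2)
    obtain ⟨b0, b1, b2, b3, b4, hb⟩ := ih (Q - EE R e.1 e.2)
    refine ⟨a0 + b0, a1 + b1, a2 + b2, a3 + b3, a4 + b4, ?_⟩
    intro x y p q
    simp only [FS]
    have e1 := ha x y p q
    have e2 := hb x y p q
    rw [show Q + x • Matrix.single u u 1 + y • Matrix.single v v 1
        + p • Matrix.single u v 1 + q • Matrix.single v u 1 + EE R e.1 e.2 = Q + EE R e.1 e.2 + x • Matrix.single u u 1 + y • Matrix.single v v 1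
        + p • Matrix.single u v 1 + q • Matrix.single v u 1 by abel, e1,
        show Q + x • Matrix.single u u 1 + y • Matrix.single v v 1
        + p • Matrix.single u v 1 + q • Matrix.single v u 1 - EE R e.1 e.2 = Q - EE R e.1 e.2 + x • Matrix.single u u 1 + y • Matrix.single v v 1
        + p • Matrix.single u v 1 + q • Matrix.single v u 1 by abel, e2]
    ring

theorem FS_pm (S : Finset V) (u v : V) (huv : u ≠ v) (hu : u ∉ S) (hv : v ∉ S) (L : List (V × V))
    (Q : Matrix V V R) : FS S L (Q + EE R u v) + FS S L (Q - EE R u v)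
      = 2 * FS S L Q - 2 * FS (insert u (insert v S)) L Q := by
  obtain ⟨d0, d1, d2, d3, d4, h⟩ := FS_upd S u v huv hu hv L Q
  have h0 := h 0 0 0 0
  have h1 := h 0 0 1 1
  have h2 := h 0 0 (-1) (-1)
  simp only [zero_smul, add_zero, one_smul, neg_smul] at h0 h1 h2
  rw [show Q + EE R u v = Q + single u v 1 + single v u 1 by rw [EE]; abel, h1,
    show Q - EE R u v = Q + -single u v 1 + -single v u 1 by rw [EE]; abel, h2, h0]
  ring

theorem FS_pm' (S : Finset V) (u v : V) (huv : u ≠ v) (h : u ∈ S ∨ v ∈ S) (L : List (V × V)) :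
    ∀ (Q : Matrix V V R), FS S L (Q + EE R u v) + FS S L (Q - EE R u v) = 2 * FS S L Q := by
  induction L with
  | nil =>
    have key : ∀ w t : V, ∀ Q : Matrix V V R, w ≠ t → w ∈ S →
        DS S (Q + EE R w t) + DS S (Q - EE R w t) = 2 * DS S Q := by
      intro w t Q hwt hw
      by_cases ht : t ∈ S
      · have e1 : BS S (Q + EE R w t) = BS S Q := by
          ext i j
          by_cases hi : i ∈ S
          · simp [BS, hi]
          · have h1 : w ≠ i := fun h => hi (h ▸ hw)
            have h2 : t ≠ i := fun h => hi (h ▸ ht)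
            simp [BS, hi, EE, Matrix.single_apply, h1, h2]
        have e2 : BS S (Q - EE R w t) = BS S Q := by
          ext i j
          by_cases hi : i ∈ S
          · simp [BS, hi]
          · have h1 : w ≠ i := fun h => hi (h ▸ hw)
            have h2 : t ≠ i := fun h => hi (h ▸ ht)
            simp [BS, hi, EE, Matrix.single_apply, h1, h2]
        simp only [DS, e1, e2]; ring
      · have e : ∀ p : R, BS S (Q + p • EE R w t) = updateRow (BS S Q) t (Q t + p • Pi.single w 1) := by
          intro p
          ext i j
          by_cases hi : i = t
          · subst hi
            simp [BS, ht, EE, Matrix.single_apply, hwt, Pi.single_apply, eq_comm]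
          · by_cases hi' : i ∈ S
            · simp [BS, hi', Matrix.updateRow_apply, hi]
            · have h1 : w ≠ i := fun h => hi' (h ▸ hw)
              simp [BS, hi', EE, Matrix.single_apply, h1, Ne.symm hi, Matrix.updateRow_apply, hi]
        have e1 := e 1
        have e2 := e (-1)
        have e0 := e 0
        simp only [one_smul, neg_smul, zero_smul, add_zero, ← sub_eq_add_neg] at e1 e2 e0
        simp only [DS, e1, e2]
        have e0' : (BS S Q).det = (updateRow (BS S Q) t (Q t)).det := by rw [← e0]
        rw [e0', Matrix.det_updateRow_add, sub_eq_add_neg, Matrix.det_updateRow_add]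
        have : -(Pi.single w (1:R) : V → R) = (-1 : R) • (Pi.single w (1:R) : V → R) := by simp
        rw [this, Matrix.det_updateRow_smul]
        ring
    intro Q
    simp only [FS]
    rcases h with h | h
    · exact key u v Q huv h
    · have := key v u Q huv.symm h
      rwa [show EE R v u = EE R u v by simp [EE, add_comm]] at this
  | cons e L ih =>
    intro Q
    simp only [FS]
    have h1 := ih (Q + EE R e.1 e.2)
    have h2 := ih (Q - EE R e.1 e.2)
    rw [show Q + EE R u v + EE R e.1 e.2 = Q + EE R e.1 e.2 + EE R u v by abel,
      show Q + EE R u v - EE R e.1 e.2 = Q - EE R e.1 e.2 + EE R u v by abel,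
      show Q - EE R u v - EE R e.1 e.2 = Q - EE R e.1 e.2 - EE R u v by abel,
      show Q - EE R u v + EE R e.1 e.2 = Q + EE R e.1 e.2 - EE R u v by abel]
    linear_combination h1 + h2

theorem FS_map {R' : Type*} [CommRing R'] (f : R →+* R') (S : Finset V) (L : List (V × V)) :
    ∀ Q : Matrix V V R, f (FS S L Q) = FS S L (Q.map f) := by
  induction L with
  | nil =>
    intro Q
    simp only [FS, DS, RingHom.map_det]
    congr 1
    ext i j
    by_cases hi : i ∈ S
    · simp [BS, hi, Pi.single_apply]
    · simp [BS, hi]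
  | cons e L ih =>
    intro Q
    have hE : (EE R e.1 e.2).map f = EE R' e.1 e.2 := by
      ext i j
      simp [EE, Matrix.single_apply]
    simp only [FS, map_add, ih]
    rw [Matrix.map_add f (map_add f), Matrix.map_sub f (map_sub f), hE]

end mss

end partP2

section partP2b

set_option linter.unusedSimpArgs false
set_option linter.unusedSectionVars false
open Finset Matrix

section start
variable {V : Type*} [Fintype V] [DecidableEq V]

noncomputable def gS (x : ℝ) : List (V × V) → Finset V → ℝ
  | [], S => x ^ (univ \ S).card
  | e :: L, S => gS x L S - if e.1 ∉ S ∧ e.2 ∉ S then gS x L (insert e.1 (insert e.2 S)) else 0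

theorem FS_gS (x : ℝ) (L : List (V × V)) (hL : ∀ e ∈ L, e.1 ≠ e.2) :
    ∀ S : Finset V, FS S L (x • (1 : Matrix V V ℝ)) = 2 ^ L.length * gS x L S := by
  induction L with
  | nil =>
    intro S
    simp only [FS, DS, gS, List.length_nil, pow_zero, one_mul]
    have : BS S (x • (1 : Matrix V V ℝ)) = diagonal (fun i => if i ∈ S then 1 else x) := by
      ext i j
      by_cases hi : i ∈ S
      · simp [BS, hi, Pi.single_apply, diagonal_apply, eq_comm]
      · simp [BS, hi, diagonal_apply, one_apply]
    rw [this, det_diagonal, Finset.prod_ite]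
    simp
    congr 2
    ext; simp
  | cons e L ih =>
    intro S
    have ih' := ih (fun e he => hL e (List.mem_cons_of_mem _ he))
    have hne := hL e (by simp)
    simp only [FS, gS, List.length_cons]
    by_cases h : e.1 ∉ S ∧ e.2 ∉ S
    · rw [FS_pm S e.1 e.2 hne h.1 h.2, if_pos h, ih', ih']; ring
    · rw [FS_pm' S e.1 e.2 hne (by tauto), if_neg h, ih']; ring

noncomputable def tau (x : ℝ) (S : Finset V) (w : V) (L : List (V × V)) (e : V × V) : ℝ :=
  if e.1 = w ∧ e.2 ∉ S then gS x L (insert e.2 (insert w S))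
  else if e.2 = w ∧ e.1 ∉ S then gS x L (insert e.1 (insert w S)) else 0

theorem gS_hit (x : ℝ) (L : List (V × V)) (e : V × V) (S : Finset V) (h : e.1 ∈ S ∨ e.2 ∈ S) :
    gS x (e :: L) S = gS x L S := by
  simp only [gS]; rw [if_neg (by tauto)]; simp

theorem gS_nohit (x : ℝ) (L : List (V × V)) (e : V × V) (S : Finset V) (h1 : e.1 ∉ S) (h2 : e.2 ∉ S) :
    gS x (e :: L) S = gS x L S - gS x L (insert e.1 (insert e.2 S)) := by
  simp only [gS]; rw [if_pos ⟨h1, h2⟩]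

theorem tau_hit (x : ℝ) (L : List (V × V)) (e e' : V × V) (S : Finset V) (w : V)
    (h : e.1 ∈ insert w S ∨ e.2 ∈ insert w S) :
    tau x S w (e :: L) e' = tau x S w L e' := by
  have : ∀ t, gS x (e :: L) (insert t (insert w S)) = gS x L (insert t (insert w S)) := by
    intro t; apply gS_hit
    rcases h with h | h
    · left; exact mem_insert_of_mem h
    · right; exact mem_insert_of_mem h
  simp only [tau, this]

theorem tau_nohit (x : ℝ) (L : List (V × V)) (e e' : V × V) (S : Finset V) (w : V)
    (hS1 : e.1 ∉ S) (hS2 : e.2 ∉ S) (hw1 : e.1 ≠ w) (hw2 : e.2 ≠ w) :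
    tau x S w (e :: L) e' = tau x S w L e' - tau x (insert e.1 (insert e.2 S)) w L e' := by
  have key : ∀ t, t ∉ S → gS x (e :: L) (insert t (insert w S)) = gS x L (insert t (insert w S)) -
      if t ∉ insert e.1 (insert e.2 S) then gS x L (insert t (insert w (insert e.1 (insert e.2 S)))) else 0 := by
    intro t htS
    by_cases ht : t ∈ insert e.1 (insert e.2 S)
    · rw [gS_hit, if_neg (not_not.2 ht)]
      · simp
      · simp only [mem_insert] at ht
        rcases ht with h | h | h
        · left; simp [h]
        · right; simp [h]
        · exact absurd h htS
    · rw [if_pos ht]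
      simp only [mem_insert, not_or] at ht
      rw [gS_nohit]
      · congr 2
        ext z; simp only [mem_insert]; tauto
      · simp only [mem_insert]; push Not; exact ⟨Ne.symm ht.1, hw1, hS1⟩
      · simp only [mem_insert]; push Not; exact ⟨Ne.symm ht.2.1, hw2, hS2⟩
  unfold tau
  by_cases h1 : e'.1 = w ∧ e'.2 ∉ S
  · rw [if_pos h1, if_pos h1, key _ h1.2]
    by_cases h2 : e'.2 ∉ insert e.1 (insert e.2 S)
    · rw [if_pos h2, if_pos ⟨h1.1, h2⟩]
    · rw [if_neg h2, if_neg (by tauto)]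
      have : ¬ (e'.2 = w ∧ e'.1 ∉ insert e.1 (insert e.2 S)) := by
        rintro ⟨h, -⟩
        simp only [mem_insert] at h2
        push Not at h2
        rcases Classical.em (e'.2 = e.1) with h3 | h3
        · exact hw1 (h3 ▸ h)
        · rcases Classical.em (e'.2 = e.2) with h4 | h4
          · exact hw2 (h4 ▸ h)
          · exact h1.2 (by tauto)
      rw [if_neg this]
  · rw [if_neg h1, if_neg h1]
    have h1' : ¬ (e'.1 = w ∧ e'.2 ∉ insert e.1 (insert e.2 S)) := by
      rintro ⟨ha, hb⟩; exact h1 ⟨ha, fun h => hb (mem_insert_of_mem (mem_insert_of_mem h))⟩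
    rw [if_neg h1']
    by_cases h3 : e'.2 = w ∧ e'.1 ∉ S
    · rw [if_pos h3, if_pos h3, key _ h3.2]
      by_cases h2 : e'.1 ∉ insert e.1 (insert e.2 S)
      · rw [if_pos h2, if_pos ⟨h3.1, h2⟩]
      · rw [if_neg h2, if_neg (by tauto)]
    · rw [if_neg h3, if_neg h3]
      have : ¬ (e'.2 = w ∧ e'.1 ∉ insert e.1 (insert e.2 S)) := by
        rintro ⟨ha, hb⟩; exact h3 ⟨ha, fun h => hb (mem_insert_of_mem (mem_insert_of_mem h))⟩
      rw [if_neg this]; simp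

theorem list_sum_map_sub {α : Type*} (L : List α) (f g : α → ℝ) :
    (L.map (fun e => f e - g e)).sum = (L.map f).sum - (L.map g).sum := by
  induction L with
  | nil => simp
  | cons a L ih => simp only [List.map_cons, List.sum_cons, ih]; ring

theorem gS_vertex (x : ℝ) (L : List (V × V)) (hL : ∀ e ∈ L, e.1 ≠ e.2) :
    ∀ (S : Finset V) (w : V), w ∉ S →
      gS x L S = x * gS x L (insert w S) - (L.map (tau x S w L)).sum := by
  induction L with
  | nil =>
    intro S w hw
    simp only [gS, List.map_nil, List.sum_nil, sub_zero]
    rw [← pow_succ']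
    congr 1
    have : univ \ S = insert w (univ \ insert w S) := by
      ext z; simp only [mem_sdiff, mem_univ, true_and, mem_insert]
      by_cases hz : z = w
      · subst hz; simp [hw]
      · simp [hz]
    rw [this, card_insert_of_notMem]; simp
  | cons e L ih =>
    intro S w hw
    have ih' := ih (fun e he => hL e (List.mem_cons_of_mem _ he))
    have hne := hL e (by simp)
    rw [List.map_cons, List.sum_cons]
    by_cases hew : e.1 = w ∨ e.2 = w
    · have hit : e.1 ∈ insert w S ∨ e.2 ∈ insert w S := by
        rcases hew with h | h <;> simp [h]
      rw [gS_hit x L e (insert w S) hit]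
      have : tau x S w (e :: L) = tau x S w L := by
        funext e'; exact tau_hit x L e e' S w hit
      rw [this]
      have h0 := ih' S w hw
      by_cases hS : e.1 ∉ S ∧ e.2 ∉ S
      · rw [gS_nohit x L e S hS.1 hS.2]
        have : tau x S w L e = gS x L (insert e.1 (insert e.2 S)) := by
          unfold tau
          rcases hew with h | h
          · rw [if_pos ⟨h, hS.2⟩]; subst h; rw [Finset.insert_comm]
          · rw [if_neg (by rintro ⟨h', -⟩; exact hne (h'.trans h.symm)), if_pos ⟨h, hS.1⟩]; subst h; rfl
        rw [this]; linarith
      · rw [gS_hit x L e S (by tauto)]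
        have : tau x S w L e = 0 := by
          unfold tau
          rw [if_neg, if_neg]
          · rintro ⟨h, h'⟩; subst h; tauto
          · rintro ⟨h, h'⟩; subst h; tauto
        rw [this]; linarith
    · push Not at hew
      have te : ∀ T l, tau x T w l e = 0 := by
        intro T l; unfold tau; rw [if_neg (by tauto), if_neg (by tauto)]
      rw [te]
      by_cases hS : e.1 ∉ S ∧ e.2 ∉ S
      · rw [gS_nohit x L e S hS.1 hS.2, gS_nohit x L e (insert w S) (by simp [hS.1, hew.1]) (by simp [hS.2, hew.2])]
        have h1 := ih' S w hw
        have h2 := ih' (insert e.1 (insert e.2 S)) w (by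
          simp only [mem_insert]; push Not; exact ⟨Ne.symm hew.1, Ne.symm hew.2, hw⟩)
        have : tau x S w (e :: L) = fun e' => tau x S w L e' - tau x (insert e.1 (insert e.2 S)) w L e' := by
          funext e'; exact tau_nohit x L e e' S w hS.1 hS.2 hew.1 hew.2
        rw [this, list_sum_map_sub]
        have hcomm : insert e.1 (insert e.2 (insert w S)) = insert w (insert e.1 (insert e.2 S)) := by
          ext z; simp only [mem_insert]; tauto
        rw [hcomm]
        linarith
      · have hit : e.1 ∈ S ∨ e.2 ∈ S := by tauto
        have hit' : e.1 ∈ insert w S ∨ e.2 ∈ insert w S := by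
          rcases hit with h | h <;> simp [h]
        rw [gS_hit x L e S hit, gS_hit x L e (insert w S) hit']
        have : tau x S w (e :: L) = tau x S w L := by
          funext e'; exact tau_hit x L e e' S w hit'
        rw [this]
        have := ih' S w hw
        linarith

theorem gS_univ (x : ℝ) (L : List (V × V)) : gS x L univ = 1 := by
  induction L with
  | nil => simp [gS]
  | cons e L ih => rw [gS_hit]; exact ih; simp

theorem gS_pos (x δ : ℝ) (hδ : 0 < δ) (hx : 2 * δ ≤ x) (L : List (V × V)) (hL : ∀ e ∈ L, e.1 ≠ e.2)
    (hdeg : ∀ w, (L.map (fun e => if e.1 = w ∨ e.2 = w then (1:ℝ) else 0)).sum ≤ δ ^ 2) :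
    ∀ (m : ℕ) (S : Finset V), (univ \ S).card = m →
      0 < gS x L S ∧ ∀ w, w ∉ S → δ * gS x L (insert w S) ≤ gS x L S := by
  intro m
  induction m with
  | zero =>
    intro S hS
    have : S = univ := by
      rw [card_eq_zero, sdiff_eq_empty_iff_subset] at hS
      exact univ_subset_iff.1 hS
    subst this
    rw [gS_univ]; simp
  | succ m ih =>
    intro S hS
    have hcard : ∀ w, w ∉ S → (univ \ insert w S).card = m := by
      intro w hw
      have : univ \ insert w S = (univ \ S).erase w := by
        ext z; simp only [mem_sdiff, mem_univ, true_and, mem_insert, mem_erase]; tauto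
      rw [this, card_erase_of_mem (by simp [hw]), hS]; simp
    have main : ∀ w, w ∉ S → δ * gS x L (insert w S) ≤ gS x L S ∧ 0 < gS x L (insert w S) := by
      intro w hw
      obtain ⟨hp, hi⟩ := ih (insert w S) (hcard w hw)
      refine ⟨?_, hp⟩
      have hv := gS_vertex x L hL S w hw
      have hsum : (L.map (tau x S w L)).sum ≤ (L.map (fun e => (if e.1 = w ∨ e.2 = w then (1:ℝ) else 0) * (gS x L (insert w S) / δ))).sum := by
        apply List.sum_le_sum
        intro e he
        have hne := hL e he
        have hb : ∀ t, t ∉ S → t ≠ w → gS x L (insert t (insert w S)) ≤ gS x L (insert w S) / δ := by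
          intro t ht htw
          rw [le_div_iff₀ hδ, mul_comm]
          exact hi t (by simp [ht, htw])
        have hpos : 0 ≤ gS x L (insert w S) / δ := by positivity
        unfold tau
        split_ifs with h1 h2 h3 h4 h5
        · rw [one_mul]; exact hb _ h1.2 (fun h => hne (h1.1.trans h.symm))
        · tauto
        · rw [one_mul]; exact hb _ h3.2 (fun h => hne (h.trans h3.1.symm))
        · tauto
        · rw [one_mul]; exact hpos
        · simp
      rw [List.sum_map_mul_right] at hsum
      have h3 : (L.map (fun e => if e.1 = w ∨ e.2 = w then (1:ℝ) else 0)).sum * (gS x L (insert w S) / δ) ≤ δ ^ 2 * (gS x L (insert w S) / δ) :=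
        mul_le_mul_of_nonneg_right (hdeg w) (by positivity)
      have h4 : δ ^ 2 * (gS x L (insert w S) / δ) = δ * gS x L (insert w S) := by field_simp
      nlinarith
    refine ⟨?_, fun w hw => (main w hw).1⟩
    have : (univ \ S).Nonempty := by rw [← card_pos]; omega
    obtain ⟨w, hw⟩ := this
    have hw' : w ∉ S := by simpa using hw
    obtain ⟨h1, h2⟩ := main w hw'
    have := mul_pos hδ h2
    linarith

theorem FS_start_pos (x δ : ℝ) (hδ : 0 < δ) (hx : 2 * δ ≤ x) (L : List (V × V)) (hL : ∀ e ∈ L, e.1 ≠ e.2)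
    (hdeg : ∀ w, (L.map (fun e => if e.1 = w ∨ e.2 = w then (1:ℝ) else 0)).sum ≤ δ ^ 2) :
    0 < FS ∅ L (x • (1 : Matrix V V ℝ)) := by
  rw [FS_gS x L hL]
  have := (gS_pos x δ hδ hx L hL hdeg _ ∅ rfl).1
  positivity

end start

end partP2b

section partP2c

set_option linter.unusedSimpArgs false
set_option linter.unusedSectionVars false
open Finset Matrix

theorem lieb_sokal (a b c e : ℂ) (κ : ℝ) (hκ : 0 ≤ κ)
    (h : ∀ ζ w : ℂ, 0 < ζ.im → 0 < w.im → a + b * ζ + c * w + e * ζ * w ≠ 0) :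
    ∀ ζ w : ℂ, 0 < ζ.im → 0 < w.im → a + b * ζ + c * w + e * ζ * w - κ * e ≠ 0 := by
  intro ζ w hζ hw h0
  by_cases he : e = 0
  · subst he; apply h ζ w hζ hw; simpa using h0
  have hce : ∀ ζ : ℂ, 0 < ζ.im → c + e * ζ ≠ 0 := by
    intro z hz hz0
    have hab : a + b * z ≠ 0 := by
      intro h1
      apply h z z hz hz
      linear_combination h1 + z * hz0
    set θ : ℂ := (a + b * z) / e * Complex.I with hθ
    have hθ0 : θ ≠ 0 := by
      rw [hθ]; exact mul_ne_zero (div_ne_zero hab he) Complex.I_ne_zero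
    -- w = I/t - b/e
    obtain ⟨t, ht, ht1, ht2⟩ : ∃ t : ℝ, 0 < t ∧ 0 < (z + t * θ).im ∧ 0 < (Complex.I / t - b / e).im := by
      have hM1 : 0 < |θ.im| + 1 := by positivity
      have hM2 : 0 < |(b/e).im| + 1 := by positivity
      refine ⟨min (z.im / (|θ.im| + 1)) (1 / (|(b/e).im| + 1)), by positivity, ?_, ?_⟩
      · set t := min (z.im / (|θ.im| + 1)) (1 / (|(b/e).im| + 1)) with htd
        have htp : 0 < t := by positivity
        have h1 : t ≤ z.im / (|θ.im| + 1) := min_le_left _ _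
        rw [le_div_iff₀ hM1] at h1
        simp only [Complex.add_im, Complex.mul_im, Complex.ofReal_re, Complex.ofReal_im, zero_mul, add_zero]
        nlinarith [neg_abs_le θ.im]
      · set t := min (z.im / (|θ.im| + 1)) (1 / (|(b/e).im| + 1)) with htd
        have htp : 0 < t := by positivity
        have h1 : t ≤ 1 / (|(b/e).im| + 1) := min_le_right _ _
        have h2 : |(b/e).im| + 1 ≤ 1 / t := by
          rw [le_div_iff₀ hM2] at h1
          rw [le_div_iff₀ htp]; linarith
        have h3 : (Complex.I / (t:ℂ)).im = 1 / t := by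
          rw [Complex.div_ofReal_im]; simp
        rw [Complex.sub_im, h3]
        linarith [le_abs_self (b/e).im]
    apply h (z + t * θ) (Complex.I / t - b / e) ht1 ht2
    have htc : (t : ℂ) ≠ 0 := by exact_mod_cast ht.ne'
    have hc : c = - e * z := by linear_combination hz0
    rw [hc, hθ]
    field_simp
    linear_combination (t:ℂ) * e * (a + b*z) * Complex.I_sq
  have hc0 : 0 ≤ (c / e).im := by
    by_contra hneg
    push Not at hneg
    apply hce (-(c/e)) (by simpa using hneg)
    field_simp; ring
  have hcz := hce ζ hζ
  set s := ζ + c / e with hs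
  have hsim : 0 < s.im := by rw [hs, Complex.add_im]; linarith
  have hs0 : s ≠ 0 := by intro h1; rw [h1] at hsim; simp at hsim
  have hes : c + e * ζ = e * s := by rw [hs]; field_simp; ring
  set w0 := w - κ / s with hw0
  have hw0im : 0 < w0.im := by
    have : ((κ:ℂ) / s).im = - κ * s.im / Complex.normSq s := by
      rw [Complex.div_im]; simp; ring
    rw [hw0, Complex.sub_im, this]
    have : 0 ≤ κ * s.im / Complex.normSq s := div_nonneg (by positivity) (Complex.normSq_nonneg _)
    have h2 : -κ * s.im / Complex.normSq s = -(κ * s.im / Complex.normSq s) := by ring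
    rw [h2]; linarith
  apply h ζ w0 hζ hw0im
  have hκs : (κ / s) * s = κ := by field_simp
  rw [hw0]
  linear_combination h0 - (κ / s) * hes - e * hκs

section stab
variable {V : Type*} [Fintype V] [DecidableEq V]

theorem det_stab (A : Matrix V V ℝ) (hA : A.IsSymm) (z : V → ℂ) (hz : ∀ i, 0 < (z i).im) :
    (diagonal z - A.map (algebraMap ℝ ℂ)).det ≠ 0 := by
  intro h0
  obtain ⟨x, hx, hx0⟩ := exists_mulVec_eq_zero_iff.2 h0
  have h1 : star x ⬝ᵥ ((diagonal z - A.map (algebraMap ℝ ℂ)) *ᵥ x) = 0 := by rw [hx0]; simp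
  rw [sub_mulVec, dotProduct_sub] at h1
  have hreal : (star x ⬝ᵥ (A.map (algebraMap ℝ ℂ) *ᵥ x)).im = 0 := by
    have hH : (A.map (algebraMap ℝ ℂ)).IsHermitian := by
      ext i j
      simp [Matrix.conjTranspose_apply, hA.apply i j]
    have := hH.im_star_dotProduct_mulVec_self x
    simpa using this
  have h2 := congrArg Complex.im h1
  rw [Complex.sub_im, hreal, sub_zero] at h2
  have h3 : (star x ⬝ᵥ (diagonal z *ᵥ x)).im = ∑ i, (z i).im * Complex.normSq (x i) := by
    simp only [dotProduct, mulVec_diagonal, Complex.im_sum, Pi.star_apply]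
    refine Finset.sum_congr rfl fun i _ => ?_
    simp [Complex.mul_im, Complex.normSq_apply]; ring
  rw [h3] at h2
  obtain ⟨i, hi⟩ := Function.ne_iff.1 hx
  have : 0 < ∑ i, (z i).im * Complex.normSq (x i) :=
    Finset.sum_pos' (fun i _ => mul_nonneg (hz i).le (Complex.normSq_nonneg _))
      ⟨i, mem_univ _, mul_pos (hz i) (Complex.normSq_pos.2 hi)⟩
  simp at h2
  linarith

theorem FS_biased (L : List (V × V)) (u v : V) (huv : u ≠ v)
    (ih : ∀ (A : Matrix V V ℝ), A.IsSymm → ∀ z : V → ℂ, (∀ i, 0 < (z i).im) →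
      FS ∅ L (diagonal z - A.map (algebraMap ℝ ℂ)) ≠ 0) (τ : ℝ) (hτ : |τ| ≤ 1)
    (A : Matrix V V ℝ) (hA : A.IsSymm) (z : V → ℂ) (hz : ∀ i, 0 < (z i).im) :
    (1 + τ) * FS ∅ L (diagonal z - A.map (algebraMap ℝ ℂ) + EE ℂ u v) +
    (1 - τ) * FS ∅ L (diagonal z - A.map (algebraMap ℝ ℂ) - EE ℂ u v) ≠ 0 := by
  set z0 : V → ℂ := Function.update (Function.update z u 0) v 0 with hz0
  obtain ⟨d0, d1, d2, d3, d4, hd⟩ := FS_upd ∅ u v huv (by simp) (by simp) L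
    (diagonal z0 - A.map (algebraMap ℝ ℂ))
  set m := FS (insert u (insert v ∅)) L (diagonal z0 - A.map (algebraMap ℝ ℂ))
  have hdiag : ∀ ζ w : ℂ, diagonal (Function.update (Function.update z u ζ) v w) =
      diagonal z0 + ζ • Matrix.single u u 1 + w • Matrix.single v v 1 := by
    intro ζ w
    ext i j
    by_cases hij : i = j
    · subst hij
      by_cases h1 : i = v
      · subst h1; simp [hz0, Matrix.single_apply, huv]
      · by_cases h2 : i = u
        · subst h2; simp [hz0, Matrix.single_apply, huv, Ne.symm h1]
        · simp [hz0, Matrix.single_apply, h1, h2, Ne.symm h1, Ne.symm h2]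
    · simp [Matrix.single_apply, diagonal_apply_ne _ hij]
      have : ∀ t, ¬ (t = i ∧ t = j) := by rintro t ⟨rfl, rfl⟩; exact hij rfl
      simp [this]
  have hval : ∀ ζ w s : ℂ, FS ∅ L (diagonal (Function.update (Function.update z u ζ) v w)
      - A.map (algebraMap ℝ ℂ) + s • EE ℂ u v) = d0 + ζ * d1 + w * d2 + s * d3 + s * d4 + (ζ * w - s * s) * m := by
    intro ζ w s
    rw [← hd ζ w s s, hdiag, EE, smul_add]
    congr 1; abel
  have hself : Function.update (Function.update z u (z u)) v (z v) = z := by simp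
  have v1 := hval (z u) (z v) 1
  have v2 := hval (z u) (z v) (-1)
  rw [hself] at v1 v2
  rw [one_smul] at v1
  rw [neg_smul, one_smul, ← sub_eq_add_neg] at v2
  rw [v1, v2]
  have hK : ∀ ζ w : ℂ, 0 < ζ.im → 0 < w.im →
      (d0 + τ * (d3 + d4) - τ ^ 2 * m) + d1 * ζ + d2 * w + m * ζ * w ≠ 0 := by
    intro ζ w hζ hw
    have := ih (A - τ • EE ℝ u v) (by
      unfold Matrix.IsSymm
      rw [transpose_sub, transpose_smul, hA.eq, EE, transpose_add, transpose_single, transpose_single, add_comm (single v u (1:ℝ))])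
      (Function.update (Function.update z u ζ) v w) (by
        intro i
        by_cases h1 : i = v
        · subst h1; simpa using hw
        · by_cases h2 : i = u
          · subst h2; simpa [h1] using hζ
          · simpa [h1, h2] using hz i)
    have hmap : (A - τ • EE ℝ u v).map (algebraMap ℝ ℂ) = A.map (algebraMap ℝ ℂ) - (τ:ℂ) • EE ℂ u v := by
      ext i j
      simp [EE, Matrix.single_apply]
      split_ifs <;> simp
    rw [hmap, ← sub_add, hval] at this
    intro h; apply this
    linear_combination h
  have := lieb_sokal _ _ _ _ (1 - τ ^ 2) (by nlinarith [abs_le.1 hτ]) hK (z u) (z v) (hz u) (hz v)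
  intro h; apply this
  push_cast
  linear_combination h / 2

theorem FS_stab (L : List (V × V)) (hL : ∀ e ∈ L, e.1 ≠ e.2) :
    ∀ (A : Matrix V V ℝ), A.IsSymm → ∀ z : V → ℂ, (∀ i, 0 < (z i).im) →
      FS ∅ L (diagonal z - A.map (algebraMap ℝ ℂ)) ≠ 0 := by
  induction L with
  | nil =>
    intro A hA z hz
    have : BS ∅ (diagonal z - A.map (algebraMap ℝ ℂ)) = diagonal z - A.map (algebraMap ℝ ℂ) := by
      ext i j; simp [BS]
    simp only [FS, DS, this]
    exact det_stab A hA z hz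
  | cons e L ih =>
    intro A hA z hz
    have := FS_biased L e.1 e.2 (hL e (by simp)) (ih (fun e he => hL e (List.mem_cons_of_mem _ he))) 0 (by simp) A hA z hz
    simpa [FS] using this

end stab

end partP2c

section partP2d

set_option linter.unusedSimpArgs false
set_option linter.unusedSectionVars false
open Finset Matrix

theorem poly_mono (f : Polynomial ℝ) (hf : ∀ z : ℂ, 0 < z.im → Polynomial.aeval z f ≠ 0) (ρ : ℝ)
    (hpos : ∀ x, ρ ≤ x → 0 < f.eval x) : ∀ y, ρ ≤ y → f.eval ρ ≤ f.eval y := by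
  intro y hy
  set g := f.map (algebraMap ℝ ℂ) with hg
  have hsp : g.Splits := IsAlgClosed.splits g
  have hev : ∀ x : ℝ, ((f.eval x : ℝ) : ℂ) = g.leadingCoeff * (g.roots.map fun a => (x : ℂ) - a).prod := by
    intro x
    rw [← hsp.eval_eq_prod_roots]
    rw [hg, Polynomial.eval_map_algebraMap]
    rw [← Complex.coe_algebraMap, Polynomial.aeval_algebraMap_apply]; simp
  have hroot : ∀ a ∈ g.roots, a.im = 0 ∧ a.re < ρ := by
    intro a ha
    have h0 : Polynomial.aeval a f = 0 := by
      have := Polynomial.isRoot_of_mem_roots ha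
      rw [Polynomial.IsRoot.def, hg, Polynomial.eval_map_algebraMap] at this
      exact this
    have him : a.im = 0 := by
      rcases lt_trichotomy a.im 0 with h | h | h
      · exfalso
        apply hf (starRingEnd ℂ a) (by simpa using h)
        rw [Polynomial.aeval_conj, h0, map_zero]
      · exact h
      · exact absurd h0 (hf a h)
    refine ⟨him, ?_⟩
    by_contra hle
    push Not at hle
    have h1 := hpos a.re hle
    have h2 : a = ((a.re : ℝ) : ℂ) := by apply Complex.ext <;> simp [him]
    rw [h2, ← Complex.coe_algebraMap, Polynomial.aeval_algebraMap_apply] at h0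
    simp at h0
    linarith
  have hn : ∀ x, ρ ≤ x → f.eval x = ‖g.leadingCoeff‖ * (g.roots.map fun a => ‖(x : ℂ) - a‖).prod := by
    intro x hx
    have h1 := congrArg norm (hev x)
    rw [norm_mul, Complex.norm_real, Real.norm_of_nonneg (hpos x hx).le] at h1
    rw [h1]
    congr 1
    have := map_multiset_prod (normHom : ℂ →*₀ ℝ) (g.roots.map fun a => (x : ℂ) - a)
    simp only [Multiset.map_map] at this
    exact this
  rw [hn ρ le_rfl, hn y hy]
  apply mul_le_mul_of_nonneg_left _ (norm_nonneg _)
  apply Multiset.prod_map_le_prod_map₀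
  · intro i _; exact norm_nonneg _
  · intro a ha
    obtain ⟨h1, h2⟩ := hroot a ha
    have h3 : a = ((a.re : ℝ) : ℂ) := by apply Complex.ext <;> simp [h1]
    rw [h3, ← Complex.ofReal_sub, ← Complex.ofReal_sub, Complex.norm_real, Complex.norm_real,
      Real.norm_of_nonneg (by linarith), Real.norm_of_nonneg (by linarith)]
    linarith

theorem poly_select (f h : Polynomial ℝ) (ρ Y : ℝ)
    (hst : ∀ τ : ℝ, 0 ≤ τ → τ ≤ 1 → ∀ z : ℂ, 0 < z.im → Polynomial.aeval z (f + Polynomial.C τ * h) ≠ 0)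
    (hf : ∀ x, ρ ≤ x → 0 < f.eval x) (hY : ∀ x, Y ≤ x → 0 < (f + h).eval x)
    (hh : 0 ≤ h.eval ρ) : ∀ x, ρ ≤ x → 0 < (f + h).eval x := by
  have hc := hf ρ le_rfl
  set c := f.eval ρ with hcd
  obtain ⟨K, hK⟩ := (isCompact_Icc (a := ρ) (b := Y)).exists_bound_of_continuousOn (f := fun x => h.eval x) (by fun_prop)
  obtain ⟨N, hN⟩ := exists_nat_gt ((|K| + 1) / c)
  have hNpos : 0 < (N : ℝ) := lt_of_le_of_lt (by positivity) hN
  have key : ∀ j : ℕ, j ≤ N → ∀ x, ρ ≤ x → 0 < f.eval x + (j / N : ℝ) * h.eval x := by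
    intro j
    induction j with
    | zero => intro _ x hx; simpa using hf x hx
    | succ j ih =>
      intro hj x hx
      have hj1 : ((j : ℝ) + 1) ≤ N := by exact_mod_cast hj
      have hprev := ih (by omega)
      have hτ1 : (j / N : ℝ) ≤ 1 := by rw [div_le_one hNpos]; linarith
      have hτ0 : (0:ℝ) ≤ j / N := by positivity
      have hm := poly_mono (f + Polynomial.C (j / N : ℝ) * h) (hst _ hτ0 hτ1) ρ (by
        intro x hx; simpa using hprev x hx) x hx
      simp only [Polynomial.eval_add, Polynomial.eval_mul, Polynomial.eval_C] at hm
      rw [← hcd] at hm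
      have hmc : c ≤ f.eval x + (j / N : ℝ) * h.eval x := by
        have := mul_nonneg hτ0 hh; linarith
      push_cast
      by_cases hxY : x ≤ Y
      · have hb := hK x ⟨hx, hxY⟩
        rw [Real.norm_eq_abs] at hb
        have h1 : -(|K| + 1) ≤ h.eval x := by
          have := neg_abs_le (h.eval x); have := le_abs_self K; linarith
        have h2 : (|K| + 1) / N < c := by
          rw [div_lt_iff₀ hc] at hN; rw [div_lt_iff₀ hNpos]; linarith
        have h3 : ((j:ℝ) + 1) / N * h.eval x = j / N * h.eval x + h.eval x / N := by ring
        rw [h3]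
        have h4 : -((|K| + 1) / N) ≤ h.eval x / N := by
          rw [← neg_div]; exact div_le_div_of_nonneg_right h1 hNpos.le
        linarith
      · push Not at hxY
        have h1 := hY x hxY.le
        rw [Polynomial.eval_add] at h1
        have h2 := hf x hx
        have ht : ((j:ℝ) + 1) / N ≤ 1 := by rw [div_le_one hNpos]; exact hj1
        have ht0 : 0 < ((j:ℝ) + 1) / N := by positivity
        nlinarith [mul_pos ht0 h1, mul_nonneg (sub_nonneg.2 ht) h2.le]
  intro x hx
  have := key N le_rfl x hx
  rw [div_self hNpos.ne'] at this
  simpa using this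

section sel
variable {V : Type*} [Fintype V] [DecidableEq V]

noncomputable def qp (L : List (V × V)) (A : Matrix V V ℝ) : Polynomial ℝ :=
  FS ∅ L (Matrix.charmatrix A)

theorem qp_eval (L : List (V × V)) (A : Matrix V V ℝ) (x : ℝ) :
    (qp L A).eval x = FS ∅ L (x • (1 : Matrix V V ℝ) - A) := by
  have := FS_map (Polynomial.evalRingHom x) ∅ L (Matrix.charmatrix A)
  rw [Polynomial.coe_evalRingHom] at this
  rw [qp, this]
  congr 1
  ext i j
  by_cases hij : i = j
  · subst hij; simp [charmatrix_apply]
  · simp [charmatrix_apply, hij]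

theorem qp_aeval (L : List (V × V)) (A : Matrix V V ℝ) (z : ℂ) :
    Polynomial.aeval z (qp L A) = FS ∅ L (diagonal (fun _ => z) - A.map (algebraMap ℝ ℂ)) := by
  have := FS_map (Polynomial.aeval z : Polynomial ℝ →ₐ[ℝ] ℂ).toRingHom ∅ L (Matrix.charmatrix A)
  rw [qp]
  refine Eq.trans this ?_
  congr 1
  ext i j
  by_cases hij : i = j
  · subst hij; simp [charmatrix_apply]
  · simp [charmatrix_apply, hij]

theorem EE_symm (u v : V) : (EE ℝ u v).IsSymm := by
  unfold Matrix.IsSymm EE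
  rw [transpose_add, transpose_single, transpose_single, add_comm]

theorem FS_tail (L : List (V × V)) : ∀ (A : Matrix V V ℝ), A.IsSymm →
    ∃ Y : ℝ, ∀ x, Y ≤ x → 0 < FS ∅ L (x • (1 : Matrix V V ℝ) - A) := by
  induction L with
  | nil =>
    intro A hA
    have hH : A.IsHermitian := by
      rw [Matrix.IsHermitian, Matrix.conjTranspose_eq_transpose_of_trivial]; exact hA
    refine ⟨∑ i, |hH.eigenvalues i| + 1, fun x hx => ?_⟩
    rw [← qp_eval]
    have : qp [] A = A.charpoly := by
      simp only [qp, FS, DS, Matrix.charpoly]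
      congr 1
    rw [this, hH.charpoly_eq, Polynomial.eval_prod]
    apply Finset.prod_pos
    intro i _
    simp
    have h1 := Finset.single_le_sum (f := fun i => |hH.eigenvalues i|) (fun i _ => abs_nonneg _) (mem_univ i)
    have := le_abs_self (hH.eigenvalues i)
    linarith
  | cons e L ih =>
    intro A hA
    obtain ⟨Y1, h1⟩ := ih (A - EE ℝ e.1 e.2) (hA.sub (EE_symm _ _))
    obtain ⟨Y2, h2⟩ := ih (A + EE ℝ e.1 e.2) (hA.add (EE_symm _ _))
    refine ⟨max Y1 Y2, fun x hx => ?_⟩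
    have a := h1 x (le_trans (le_max_left _ _) hx)
    have b := h2 x (le_trans (le_max_right _ _) hx)
    simp only [FS]
    rw [← sub_add] at a
    rw [← sub_sub] at b
    linarith

theorem FS_choose (L : List (V × V)) (hL : ∀ e ∈ L, e.1 ≠ e.2) (e : V × V) (he : e.1 ≠ e.2) (ρ : ℝ)
    (A : Matrix V V ℝ) (hA : A.IsSymm)
    (h : ∀ x, ρ ≤ x → 0 < FS ∅ (e :: L) (x • (1 : Matrix V V ℝ) - A)) :
    ∃ s : ℝ, (s = 1 ∨ s = -1) ∧ ∀ x, ρ ≤ x → 0 < FS ∅ L (x • (1 : Matrix V V ℝ) - (A + s • EE ℝ e.1 e.2)) := by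
  have hev : ∀ (s x : ℝ), FS ∅ L (x • (1 : Matrix V V ℝ) - (A + s • EE ℝ e.1 e.2)) = (qp L (A + s • EE ℝ e.1 e.2)).eval x := by
    intro s x; rw [qp_eval]
  have hsym : ∀ s : ℝ, (A + s • EE ℝ e.1 e.2).IsSymm := fun s => hA.add ((EE_symm _ _).smul s)
  have hbias : ∀ (s : ℝ), (s = 1 ∨ s = -1) → ∀ τ : ℝ, 0 ≤ τ → τ ≤ 1 → ∀ z : ℂ, 0 < z.im →
      (1 + τ : ℂ) * Polynomial.aeval z (qp L (A + s • EE ℝ e.1 e.2)) + (1 - τ) * Polynomial.aeval z (qp L (A + (-s) • EE ℝ e.1 e.2)) ≠ 0 := by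
    intro s hs τ h0 h1 z hz
    have hm : ∀ t : ℝ, (A + t • EE ℝ e.1 e.2).map (algebraMap ℝ ℂ) = A.map (algebraMap ℝ ℂ) + (t:ℂ) • EE ℂ e.1 e.2 := by
      intro t
      ext i j
      simp [EE, Matrix.single_apply]
      split_ifs <;> simp
    rw [qp_aeval, qp_aeval, hm, hm]
    rcases hs with rfl | rfl
    · have := FS_biased L e.1 e.2 he (FS_stab L hL) (-τ) (by rw [abs_neg, abs_of_nonneg h0]; exact h1) A hA (fun _ => z) (fun _ => hz)
      intro h; apply this
      push_cast at h ⊢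
      simp only [one_smul, neg_smul, ← sub_eq_add_neg, sub_neg_eq_add, ← sub_sub, sub_sub_eq_add_sub] at h ⊢
      rw [← sub_add_eq_add_sub] at h
      linear_combination h
    · have := FS_biased L e.1 e.2 he (FS_stab L hL) τ (by rw [abs_of_nonneg h0]; exact h1) A hA (fun _ => z) (fun _ => hz)
      intro h; apply this
      push_cast at h ⊢
      simp only [neg_neg, one_smul, neg_smul, ← sub_eq_add_neg, sub_neg_eq_add, ← sub_sub, sub_sub_eq_add_sub] at h ⊢
      rw [← sub_add_eq_add_sub] at h
      linear_combination h
  have hsum : ∀ (s : ℝ), (s = 1 ∨ s = -1) → ∀ x, ρ ≤ x →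
      0 < (qp L (A + s • EE ℝ e.1 e.2)).eval x + (qp L (A + (-s) • EE ℝ e.1 e.2)).eval x := by
    intro s hs x hx
    have := h x hx
    simp only [FS] at this
    rw [← hev, ← hev]
    rcases hs with rfl | rfl
    · simp only [one_smul, neg_smul, ← sub_eq_add_neg, ← sub_sub, ← sub_add]; linarith
    · simp only [neg_neg, one_smul, neg_smul, ← sub_eq_add_neg, ← sub_sub, ← sub_add]; linarith
  have main : ∀ s : ℝ, (s = 1 ∨ s = -1) →
      (qp L (A + (-s) • EE ℝ e.1 e.2)).eval ρ ≤ (qp L (A + s • EE ℝ e.1 e.2)).eval ρ →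
      ∀ x, ρ ≤ x → 0 < FS ∅ L (x • (1 : Matrix V V ℝ) - (A + s • EE ℝ e.1 e.2)) := by
    intro s hs hle x hx
    set p := qp L (A + s • EE ℝ e.1 e.2) with hp
    set q := qp L (A + (-s) • EE ℝ e.1 e.2) with hq
    obtain ⟨Y, hY⟩ := FS_tail L _ (hsym s)
    have := poly_select (p + q) (p - q) ρ Y (by
      intro τ h0 h1 z hz
      have := hbias s hs τ h0 h1 z hz
      intro h; apply this
      simp only [map_add, map_mul, map_sub, Polynomial.aeval_C, Complex.coe_algebraMap] at h
      linear_combination h) (by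
      intro x hx; rw [Polynomial.eval_add]; exact hsum s hs x hx) (by
      intro x hx
      have := hY x hx
      rw [hev, ← hp] at this
      simp only [Polynomial.eval_add, Polynomial.eval_sub]; linarith) (by
      rw [Polynomial.eval_sub]; linarith) x hx
    rw [hev, ← hp]
    simp only [Polynomial.eval_add, Polynomial.eval_sub] at this
    linarith
  by_cases hc : (qp L (A + (-1:ℝ) • EE ℝ e.1 e.2)).eval ρ ≤ (qp L (A + (1:ℝ) • EE ℝ e.1 e.2)).eval ρ
  · exact ⟨1, Or.inl rfl, main 1 (Or.inl rfl) hc⟩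
  · refine ⟨-1, Or.inr rfl, main (-1) (Or.inr rfl) ?_⟩
    push Not at hc
    rw [neg_neg]; exact hc.le

theorem FS_choose_all (L : List (V × V)) (hL : ∀ e ∈ L, e.1 ≠ e.2) (hnd : L.Nodup) (ρ : ℝ) :
    ∀ (A : Matrix V V ℝ), A.IsSymm →
    (∀ x, ρ ≤ x → 0 < FS ∅ L (x • (1 : Matrix V V ℝ) - A)) →
    ∃ s : V × V → ℝ, (∀ e, s e = 1 ∨ s e = -1) ∧ ∀ x, ρ ≤ x →
      0 < (x • (1 : Matrix V V ℝ) - (A + (L.map fun e => s e • EE ℝ e.1 e.2).sum)).det := by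
  induction L with
  | nil =>
    intro A hA h
    refine ⟨fun _ => 1, fun _ => Or.inl rfl, fun x hx => ?_⟩
    have := h x hx
    simp only [FS, DS] at this
    have e : BS ∅ (x • (1 : Matrix V V ℝ) - A) = x • (1 : Matrix V V ℝ) - A := by ext i j; simp [BS]
    rw [e] at this
    simpa using this
  | cons e L ih =>
    intro A hA h
    rw [List.nodup_cons] at hnd
    obtain ⟨t, ht, h1⟩ := FS_choose L (fun e he => hL e (List.mem_cons_of_mem _ he)) e (hL e (by simp)) ρ A hA h
    obtain ⟨s, hs, h2⟩ := ih (fun e he => hL e (List.mem_cons_of_mem _ he)) hnd.2 _ (hA.add ((EE_symm _ _).smul t)) h1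
    refine ⟨Function.update s e t, ?_, ?_⟩
    · intro e'
      by_cases h : e' = e
      · subst h; simpa using ht
      · simpa [h] using hs e'
    · intro x hx
      have := h2 x hx
      have hmap : (L.map fun e' => Function.update s e t e' • EE ℝ e'.1 e'.2) = L.map fun e => s e • EE ℝ e.1 e.2 := by
        apply List.map_congr_left
        intro e' he'
        have : e' ≠ e := fun h => hnd.1 (h ▸ he')
        simp [this]
      rw [List.map_cons, List.sum_cons, hmap, Function.update_self, ← add_assoc]
      exact this

end sel

end partP2d

section partP2e

open Finset Matrix

open Classical in
noncomputable def ad {V : Type*} (G : SimpleGraph V) (a b : V) : ℝ := if G.Adj a b then 1 else 0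

theorem ad_symm {V : Type*} (G : SimpleGraph V) (a b : V) : ad G a b = ad G b a := by
  unfold ad; by_cases h : G.Adj a b
  · simp [h, h.symm]
  · have h2 : ¬ G.Adj b a := fun h1 => h h1.symm
    simp [h, h2]

theorem ad_nonneg {V : Type*} (G : SimpleGraph V) (a b : V) : 0 ≤ ad G a b := by
  unfold ad; split_ifs <;> norm_num

theorem det_lam (V : Type*) [Fintype V] [DecidableEq V] (A : Matrix V V ℝ) (hA : A.IsSymm) (ρ : ℝ)
    (h : ∀ x, ρ ≤ x → 0 < (x • (1 : Matrix V V ℝ) - A).det) (f : V → ℝ) :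
    qf A f f ≤ ρ * ∑ a, f a ^ 2 := by
  rcases isEmpty_or_nonempty V with he | hne
  · simp [qf]
  refine (L1 A hA f).trans (mul_le_mul_of_nonneg_right ?_ (Finset.sum_nonneg fun _ _ => sq_nonneg _))
  by_contra hlt
  push Not at hlt
  obtain ⟨v, hv, hAv⟩ := L1_ex A hA
  have h0 := h _ hlt.le
  have : (lam A 1 • (1 : Matrix V V ℝ) - A).det = 0 := by
    rw [← exists_mulVec_eq_zero_iff]
    refine ⟨v, hv, ?_⟩
    rw [sub_mulVec, hAv, smul_mulVec, one_mulVec, sub_self]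
  linarith

theorem mss {V : Type*} [Fintype V] (G : SimpleGraph V) (δ : ℝ) (hδ : 0 ≤ δ)
    (hdeg : ∀ a, ∑ b, ad G a b ≤ δ ^ 2) : ∃ s : V → V → Bool, (∀ a b, s a b = s b a) ∧
      ∀ h : V → ℝ, qf (fun a b => ad G a b * (if s a b then -1 else 1)) h h ≤ 2 * δ * ∑ a, h a ^ 2 := by
  classical
  rcases hδ.eq_or_lt with h0 | hpos
  · subst h0
    have hz : ∀ a b, ad G a b = 0 := by
      intro a b
      have h1 := Finset.single_le_sum (f := fun b => ad G a b) (fun i _ => ad_nonneg G a i) (mem_univ b)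
      have h2 := hdeg a
      have h3 := ad_nonneg G a b
      linarith [hdeg a]
    refine ⟨fun _ _ => false, fun _ _ => rfl, fun h => ?_⟩
    simp [qf, hz]
  let rk := Fintype.equivFin V
  let F : Finset (V × V) := univ.filter fun e => G.Adj e.1 e.2 ∧ rk e.1 < rk e.2
  let L := F.toList
  have hL : ∀ e ∈ L, e.1 ≠ e.2 := by
    intro e he
    rw [Finset.mem_toList] at he
    have := (mem_filter.1 he).2.1
    exact this.ne
  have hsplit : ∀ w b, ad G w b = (if G.Adj w b ∧ rk w < rk b then 1 else 0) + (if G.Adj b w ∧ rk b < rk w then 1 else 0) := by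
    intro w b
    unfold ad
    by_cases hwb : G.Adj w b
    · have hne : rk w ≠ rk b := fun h => hwb.ne (rk.injective h)
      rcases lt_or_gt_of_ne hne with h | h
      · simp [hwb, hwb.symm, h, not_lt.2 h.le]
      · simp [hwb, hwb.symm, h, not_lt.2 h.le]
    · have : ¬ G.Adj b w := fun h => hwb h.symm
      simp [hwb, this]
  have hLdeg : ∀ w, (L.map (fun e => if e.1 = w ∨ e.2 = w then (1:ℝ) else 0)).sum ≤ δ ^ 2 := by
    intro w
    refine le_trans (le_of_eq ?_) (hdeg w)
    rw [Finset.sum_map_toList, Finset.sum_filter, Fintype.sum_prod_type]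
    have e1 : ∀ a b : V, (if G.Adj a b ∧ rk a < rk b then (if a = w ∨ b = w then (1:ℝ) else 0) else 0)
        = (if a = w then (if G.Adj w b ∧ rk w < rk b then (1:ℝ) else 0) else 0)
        + (if b = w then (if G.Adj a w ∧ rk a < rk w then (1:ℝ) else 0) else 0) := by
      intro a b
      by_cases ha : a = w
      · subst ha
        by_cases hb : b = a
        · subst hb; simp
        · simp [hb]
      · by_cases hb : b = w
        · subst hb; simp [ha]
        · simp [ha, hb]
    simp only [e1, Finset.sum_add_distrib]
    rw [Finset.sum_comm]
    simp only [Finset.sum_ite_eq', mem_univ, if_true]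
    simp only [hsplit w, Finset.sum_add_distrib]
  obtain ⟨s, hs, hdet⟩ := FS_choose_all L hL (Finset.nodup_toList _) (2 * δ) 0 (Matrix.isSymm_zero) (by
    intro x hx
    rw [sub_zero]
    exact FS_start_pos x δ hpos hx L hL hLdeg)
  set B := (0 : Matrix V V ℝ) + (L.map fun e => s e • EE ℝ e.1 e.2).sum with hB
  have hBval : ∀ a b, B a b = (if G.Adj a b ∧ rk a < rk b then s (a,b) else 0) + (if G.Adj b a ∧ rk b < rk a then s (b,a) else 0) := by
    intro a b
    rw [hB, zero_add, Finset.sum_map_toList, Matrix.sum_apply, Finset.sum_filter, Fintype.sum_prod_type]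
    have e1 : ∀ u v : V, (if G.Adj u v ∧ rk u < rk v then (s (u,v) • EE ℝ u v) a b else 0)
       = (if v = b then (if u = a then (if G.Adj u v ∧ rk u < rk v then s (u,v) else 0) else 0) else 0)
       + (if u = b then (if v = a then (if G.Adj u v ∧ rk u < rk v then s (u,v) else 0) else 0) else 0) := by
      intro u v
      simp only [EE, Matrix.smul_apply, Matrix.add_apply, Matrix.single_apply, smul_eq_mul]
      by_cases hc : G.Adj u v ∧ rk u < rk v
      · simp only [if_pos hc, mul_add]
        congr 1
        · by_cases h1 : u = a <;> by_cases h2 : v = b <;> simp [h1, h2]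
        · by_cases h1 : u = b <;> by_cases h2 : v = a <;> simp [h1, h2]
      · simp only [if_neg hc]; simp
    simp only [e1, Finset.sum_add_distrib]
    congr 1
    · simp
    · rw [Finset.sum_comm]; simp
  have hBs : B.IsSymm := by
    ext a b
    rw [transpose_apply, hBval, hBval, add_comm]
  let t : V → V → Bool := fun a b => if rk a < rk b then decide (s (a,b) = -1) else decide (s (b,a) = -1)
  have htB : ∀ a b, ad G a b * (if t a b then -1 else 1) = B a b := by
    intro a b
    rw [hBval]
    unfold ad
    by_cases hab : G.Adj a b
    · have hne : rk a ≠ rk b := fun h => hab.ne (rk.injective h)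
      have one : (1:ℝ) ≠ -1 := by norm_num
      rcases lt_or_gt_of_ne hne with h | h
      · rcases hs (a,b) with h2 | h2 <;> simp [t, hab, hab.symm, h, not_lt.2 h.le, h2, one]
      · rcases hs (b,a) with h2 | h2 <;> simp [t, hab, hab.symm, h, not_lt.2 h.le, h2, one]
    · have : ¬ G.Adj b a := fun h => hab h.symm
      simp [hab, this]
  refine ⟨t, ?_, ?_⟩
  · intro a b
    simp only [t]
    by_cases hab : a = b
    · subst hab; rfl
    · have hne : rk a ≠ rk b := fun h => hab (rk.injective h)
      rcases lt_or_gt_of_ne hne with h | h <;> simp [h, not_lt.2 h.le]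
  · intro h
    have := det_lam V B hBs (2 * δ) hdet h
    simpa only [htB] using this

end partP2e

section partP3

set_option linter.unusedSimpArgs false
set_option linter.unusedSectionVars false
open Finset

section lp
variable {ι E : Type*} [Fintype ι] [Fintype E]

theorem lp_extreme (a : ι → E → ℝ) (x₀ : E → ℝ) (hx₀ : ∀ e, 0 ≤ x₀ e ∧ x₀ e ≤ 1) :
    ∃ x : E → ℝ, (∀ e, 0 ≤ x e ∧ x e ≤ 1) ∧ (∀ i, ∑ e, a i e * x e = ∑ e, a i e * x₀ e) ∧
      ∀ z : E → ℝ, (∀ e, z e ≠ 0 → 0 < x e ∧ x e < 1) → (∀ i, ∑ e, a i e * z e = 0) → z = 0 := by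
  let P : Set (E → ℝ) := Set.Icc 0 1 ∩ {x | ∀ i, ∑ e, a i e * x e = ∑ e, a i e * x₀ e}
  have hmem : ∀ x : E → ℝ, x ∈ P ↔ (∀ e, 0 ≤ x e ∧ x e ≤ 1) ∧ ∀ i, ∑ e, a i e * x e = ∑ e, a i e * x₀ e := by
    intro x
    simp only [P, Set.mem_inter_iff, Set.mem_Icc, Pi.le_def, Set.mem_ofPred_eq, Pi.zero_apply, Pi.one_apply, forall_and]
  have hc : IsCompact P := by
    apply IsCompact.inter_right isCompact_Icc
    have : {x : E → ℝ | ∀ i, ∑ e, a i e * x e = ∑ e, a i e * x₀ e} = ⋂ i, {x | ∑ e, a i e * x e = ∑ e, a i e * x₀ e} := by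
      ext; simp
    rw [this]
    apply isClosed_iInter
    intro i
    exact isClosed_eq (by fun_prop) continuous_const
  have hne : P.Nonempty := ⟨x₀, (hmem _).2 ⟨hx₀, fun _ => rfl⟩⟩
  obtain ⟨x, hx⟩ := hc.extremePoints_nonempty hne
  rw [mem_extremePoints] at hx
  obtain ⟨hxP, hext⟩ := hx
  obtain ⟨h01, hsum⟩ := (hmem x).1 hxP
  refine ⟨x, h01, hsum, fun z hz hz0 => ?_⟩
  have hev : ∀ z : E → ℝ, (∀ e, z e ≠ 0 → 0 < x e ∧ x e < 1) → ∀ᶠ t : ℝ in nhdsWithin 0 (Set.Ioi 0), ∀ e, 0 ≤ x e + t * z e ∧ x e + t * z e ≤ 1 := by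
    intro z hz
    rw [Filter.eventually_all]
    intro e
    by_cases h : z e = 0
    · simp [h, h01 e]
    · have hcont : Filter.Tendsto (fun t : ℝ => x e + t * z e) (nhdsWithin 0 (Set.Ioi 0)) (nhds (x e)) := by
        have : Continuous (fun t : ℝ => x e + t * z e) := by fun_prop
        have h2 := this.tendsto 0
        simp at h2
        exact h2.mono_left nhdsWithin_le_nhds
      have := hcont.eventually (Ioo_mem_nhds (hz e h).1 (hz e h).2)
      filter_upwards [this] with t ht using ⟨ht.1.le, ht.2.le⟩
  have h1 := hev z hz
  have h2 := hev (fun e => - z e) (by intro e he; exact hz e (by simpa using he))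
  have h3 : ∀ᶠ t : ℝ in nhdsWithin 0 (Set.Ioi 0), 0 < t := eventually_mem_nhdsWithin
  obtain ⟨t, ht1, ht2, ht3⟩ := (h1.and (h2.and h3)).exists
  have p1 : (fun e => x e + t * z e) ∈ P := by
    rw [hmem]; refine ⟨ht1, fun i => ?_⟩
    rw [← hsum i]
    have : ∑ e, a i e * (x e + t * z e) = ∑ e, a i e * x e + t * ∑ e, a i e * z e := by
      rw [Finset.mul_sum, ← Finset.sum_add_distrib]; exact Finset.sum_congr rfl fun _ _ => by ring
    rw [this, hz0]; ring
  have p2 : (fun e => x e + t * (- z e)) ∈ P := by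
    rw [hmem]; refine ⟨ht2, fun i => ?_⟩
    rw [← hsum i]
    have : ∑ e, a i e * (x e + t * (-z e)) = ∑ e, a i e * x e - t * ∑ e, a i e * z e := by
      rw [Finset.mul_sum, ← Finset.sum_sub_distrib]; exact Finset.sum_congr rfl fun _ _ => by ring
    rw [this, hz0]; ring
  have := hext _ p1 _ p2 ⟨1/2, 1/2, by norm_num, by norm_num, by norm_num, by
    funext e; simp; ring⟩
  funext e
  have h4 := congrFun this.1 e
  simp at h4
  rcases h4 with h | h
  · exact absurd h ht3.ne'
  · exact h

theorem indep_card [DecidableEq E] (a : ι → E → ℝ) (A : Finset E) (N : Finset ι)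
    (hz : ∀ z : E → ℝ, (∀ e, e ∉ A → z e = 0) → (∀ i ∈ N, ∑ e, a i e * z e = 0) → z = 0) :
    #A ≤ #N := by
  let T : (A → ℝ) →ₗ[ℝ] (N → ℝ) := Matrix.mulVecLin (Matrix.of fun (i : N) (e : A) => a i e)
  have hinj : Function.Injective T := by
    rw [← LinearMap.ker_eq_bot, LinearMap.ker_eq_bot']
    intro w hw
    let z : E → ℝ := fun e => if h : e ∈ A then w ⟨e, h⟩ else 0
    have : z = 0 := by
      apply hz z
      · intro e he; simp [z, he]
      · intro i hi
        have := congrFun hw ⟨i, hi⟩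
        simp only [T, Matrix.mulVecLin_apply, Matrix.mulVec, dotProduct, Matrix.of_apply, Pi.zero_apply] at this
        rw [← this]
        rw [← Finset.sum_subset (Finset.subset_univ A)]
        · rw [← Finset.sum_coe_sort A]
          refine Finset.sum_congr rfl fun e _ => ?_
          simp [z]
        · intro e _ he; simp [z, he]
    funext e
    have := congrFun this e.1
    simpa [z] using this
  have := LinearMap.finrank_le_finrank_of_injective hinj
  simpa using this

theorem lp_hall [DecidableEq E] [DecidableEq ι] (a : ι → E → ℝ) (F : Finset E)
    (hz : ∀ z : E → ℝ, (∀ e, e ∉ F → z e = 0) → (∀ i, ∑ e, a i e * z e = 0) → z = 0) :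
    ∃ φ : F → ι, Function.Injective φ ∧ ∀ e, a (φ e) e ≠ 0 := by
  classical
  have := (Finset.all_card_le_biUnion_card_iff_exists_injective
    (fun e : F => univ.filter fun i => a i e ≠ 0)).1 (by
    intro s
    have := indep_card a (s.map (Function.Embedding.subtype _)) (s.biUnion (fun e : F => univ.filter fun i => a i e ≠ 0)) (by
      intro z hz1 hz2
      apply hz z
      · intro e he
        apply hz1
        simp only [mem_map, Function.Embedding.subtype_apply, not_exists, not_and]
        rintro ⟨x, hx⟩ _ rfl
        exact he hx
      · intro i
        by_cases hi : i ∈ s.biUnion (fun e : F => univ.filter fun i => a i e ≠ 0)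
        · exact hz2 i hi
        · apply Finset.sum_eq_zero
          intro e _
          by_cases he : e ∈ s.map (Function.Embedding.subtype _)
          · simp only [mem_map, Function.Embedding.subtype_apply] at he
            obtain ⟨e', he', rfl⟩ := he
            have : a i e' = 0 := by
              by_contra h
              apply hi
              rw [mem_biUnion]
              exact ⟨e', he', by simp [h]⟩
            rw [this, zero_mul]
          · rw [hz1 e he, mul_zero])
    simpa using this)
  obtain ⟨φ, h1, h2⟩ := this
  exact ⟨φ, h1, fun e => by simpa using h2 e⟩

end lp

section rnd
variable {E L R C : Type*} [Fintype E] [Fintype L] [Fintype R] [Fintype C]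
  [DecidableEq E] [DecidableEq L] [DecidableEq R] [DecidableEq C]

theorem ge_two (l : E → L) (y : E → ℝ) (A : Finset E) (hA : ∀ e, e ∈ A ↔ 0 < y e ∧ y e < 1)
    (h01 : ∀ e, 0 ≤ y e ∧ y e ≤ 1) (hint : ∀ j, ∃ n : ℤ, ∑ e, (if l e = j then y e else 0) = n) :
    2 * #(A.image l) ≤ #A := by
  have hI : ∀ e, e ∉ A → ∃ n : ℤ, y e = n := by
    intro e he
    rw [hA] at he
    rcases (h01 e).1.eq_or_lt with h | h
    · exact ⟨0, by simp [← h]⟩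
    · exact ⟨1, by push_cast; exact le_antisymm (h01 e).2 (by by_contra h2; exact he ⟨h, not_le.1 h2⟩)⟩
  apply Finset.mul_card_image_le_card A 2
  intro j hj
  obtain ⟨e0, he0, hl0⟩ := mem_image.1 hj
  by_contra hlt
  push Not at hlt
  have hone : #(A.filter fun e => l e = j) = 1 := by
    have : 0 < #(A.filter fun e => l e = j) := card_pos.2 ⟨e0, by simp [he0, hl0]⟩
    omega
  have huniq : ∀ e ∈ A, l e = j → e = e0 := by
    intro e he hl
    obtain ⟨w, hw⟩ := card_eq_one.1 hone
    have h1 : e ∈ A.filter fun e => l e = j := by simp [he, hl]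
    have h2 : e0 ∈ A.filter fun e => l e = j := by simp [he0, hl0]
    rw [hw, mem_singleton] at h1 h2
    rw [h1, h2]
  obtain ⟨n, hn⟩ := hint j
  rw [← Finset.add_sum_erase _ _ (mem_univ e0), if_pos hl0] at hn
  have hrest : ∃ m : ℤ, ∑ e ∈ univ.erase e0, (if l e = j then y e else 0) = m := by
    have : ∀ e ∈ univ.erase e0, ∃ m : ℤ, (if l e = j then y e else 0) = m := by
      intro e he
      by_cases h : l e = j
      · rw [if_pos h]
        apply hI
        intro heA
        exact (mem_erase.1 he).1 (huniq e heA h)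
      · exact ⟨0, by simp [h]⟩
    choose! m hm using this
    refine ⟨∑ e ∈ univ.erase e0, m e, ?_⟩
    push_cast
    exact Finset.sum_congr rfl hm
  obtain ⟨m, hm⟩ := hrest
  rw [hm] at hn
  have h1 := (hA e0).1 he0
  have h2 : y e0 = ((n - m : ℤ) : ℝ) := by push_cast; linarith
  rw [h2] at h1
  have h3 : (0:ℤ) < n - m := by exact_mod_cast h1.1
  have h4 : n - m < (1:ℤ) := by exact_mod_cast h1.2
  omega

theorem round_bip (l : E → L) (r : E → R) (x : E → ℝ) (h01 : ∀ e, 0 ≤ x e ∧ x e ≤ 1)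
    (hl : ∀ j, ∃ n : ℤ, ∑ e, (if l e = j then x e else 0) = n)
    (hr : ∀ j, ∃ n : ℤ, ∑ e, (if r e = j then x e else 0) = n) :
    ∃ y : E → ℝ, (∀ e, y e = 0 ∨ y e = 1) ∧
      (∀ j, ∑ e, (if l e = j then y e else 0) = ∑ e, (if l e = j then x e else 0)) ∧
      (∀ j, ∑ e, (if r e = j then y e else 0) = ∑ e, (if r e = j then x e else 0)) ∧
      (∀ e, ¬ (0 < x e ∧ x e < 1) → y e = x e) := by
  classical
  let a : L ⊕ R ⊕ E → E → ℝ := fun i e => match i with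
    | Sum.inl j => if l e = j then 1 else 0
    | Sum.inr (Sum.inl j) => if r e = j then 1 else 0
    | Sum.inr (Sum.inr e') => if e = e' ∧ ¬ (0 < x e ∧ x e < 1) then 1 else 0
  obtain ⟨y, hy01, hysum, hyz⟩ := lp_extreme a x h01
  have hyl : ∀ j, ∑ e, (if l e = j then y e else 0) = ∑ e, (if l e = j then x e else 0) := by
    intro j; have := hysum (Sum.inl j); simpa [a] using this
  have hyr : ∀ j, ∑ e, (if r e = j then y e else 0) = ∑ e, (if r e = j then x e else 0) := by
    intro j; have := hysum (Sum.inr (Sum.inl j)); simpa [a] using this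
  have hyo : ∀ e, ¬ (0 < x e ∧ x e < 1) → y e = x e := by
    intro e he
    have := hysum (Sum.inr (Sum.inr e))
    simp only [a] at this
    rw [Finset.sum_eq_single e, Finset.sum_eq_single e, if_pos ⟨rfl, he⟩] at this
    · simpa using this
    · intro b _ hb; simp [hb]
    · simp
    · intro b _ hb; simp [hb]
    · simp
  refine ⟨y, ?_, hyl, hyr, hyo⟩
  let A : Finset E := univ.filter fun e => 0 < y e ∧ y e < 1
  have hA : ∀ e, e ∈ A ↔ 0 < y e ∧ y e < 1 := by intro e; simp [A]
  rcases A.eq_empty_or_nonempty with hempty | ⟨e0, he0⟩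
  · intro e
    have : e ∉ A := by rw [hempty]; simp
    rw [hA] at this
    rcases (hy01 e).1.eq_or_lt with h | h
    · left; exact h.symm
    · right; exact le_antisymm (hy01 e).2 (by by_contra h2; exact this ⟨h, not_le.1 h2⟩)
  exfalso
  have g1 := ge_two l y A hA hy01 (by intro j; rw [hyl]; exact hl j)
  have g2 := ge_two r y A hA hy01 (by intro j; rw [hyr]; exact hr j)
  have hAF : ∀ e ∈ A, 0 < x e ∧ x e < 1 := by
    intro e he
    by_contra h
    have := hyo e h
    rw [hA, this] at he
    exact h he
  have hcard := indep_card (ι := L ⊕ R) (fun i e => match i with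
    | Sum.inl j => if l e = j then 1 else 0
    | Sum.inr j => if r e = j then 1 else 0) A (((A.image l).erase (l e0)).disjSum (A.image r)) (by
    intro z hz1 hz2
    have zr : ∀ j, ∑ e, (if r e = j then z e else 0) = 0 := by
      intro j
      by_cases hj : j ∈ A.image r
      · have := hz2 (Sum.inr j) (by simpa using hj)
        simpa using this
      · apply Finset.sum_eq_zero
        intro e _
        by_cases he : e ∈ A
        · rw [if_neg]; rintro rfl; exact hj (mem_image_of_mem _ he)
        · rw [hz1 e he]; simp
    have zl : ∀ j, j ≠ l e0 → ∑ e, (if l e = j then z e else 0) = 0 := by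
      intro j hne
      by_cases hj : j ∈ A.image l
      · have := hz2 (Sum.inl j) (by rw [Finset.inl_mem_disjSum]; exact mem_erase.2 ⟨hne, hj⟩)
        simpa using this
      · apply Finset.sum_eq_zero
        intro e _
        by_cases he : e ∈ A
        · rw [if_neg]; rintro rfl; exact hj (mem_image_of_mem _ he)
        · rw [hz1 e he]; simp
    have tot : ∑ e, z e = 0 := by
      have : ∑ j, ∑ e, (if r e = j then z e else 0) = ∑ e, z e := by
        rw [Finset.sum_comm]; simp
      rw [← this]; exact Finset.sum_eq_zero fun j _ => zr j
    have tot2 : ∑ j, ∑ e, (if l e = j then z e else 0) = ∑ e, z e := by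
      rw [Finset.sum_comm]; simp
    rw [Finset.sum_eq_single (l e0) (fun j _ hj => zl j hj) (by simp), tot] at tot2
    have zl' : ∀ j, ∑ e, (if l e = j then z e else 0) = 0 := by
      intro j
      by_cases h : j = l e0
      · rw [h]; exact tot2
      · exact zl j h
    apply hyz z
    · intro e he
      rw [← hA]
      by_contra h; exact he (hz1 e h)
    · intro i
      match i with
      | Sum.inl j => simpa [a] using zl' j
      | Sum.inr (Sum.inl j) => simpa [a] using zr j
      | Sum.inr (Sum.inr e') =>
        apply Finset.sum_eq_zero
        intro e _
        by_cases he : e ∈ A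
        · simp only [a]; rw [if_neg]; · simp
          rintro ⟨-, h⟩; exact h (hAF e he)
        · rw [hz1 e he]; simp)
  rw [Finset.card_disjSum, card_erase_of_mem (mem_image_of_mem _ he0)] at hcard
  have : 0 < #(A.image l) := card_pos.2 ⟨_, mem_image_of_mem _ he0⟩
  omega

theorem rounding (l : E → L) (r : E → R) (c : E → C) (x : E → ℝ) (h01 : ∀ e, 0 ≤ x e ∧ x e ≤ 1)
    (hl : ∀ j, ∃ n : ℤ, ∑ e, (if l e = j then x e else 0) = n)
    (hr : ∀ j, ∃ n : ℤ, ∑ e, (if r e = j then x e else 0) = n) :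
    ∃ (y : E → ℝ) (U W : Finset E), (∀ e, y e = 0 ∨ y e = 1) ∧
      (∀ j, ∑ e, (if l e = j then y e else 0) = ∑ e, (if l e = j then x e else 0)) ∧
      (∀ j, ∑ e, (if r e = j then y e else 0) = ∑ e, (if r e = j then x e else 0)) ∧
      (Set.InjOn l U) ∧ (Set.InjOn r W) ∧
      ∀ γ, |∑ e, (if c e = γ then y e - x e else 0)| ≤
        1 + #(U.filter fun e => c e = γ) + #(W.filter fun e => c e = γ) := by
  classical
  let a : L ⊕ R ⊕ C → E → ℝ := fun i e => match i with
    | Sum.inl j => if l e = j then 1 else 0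
    | Sum.inr (Sum.inl j) => if r e = j then 1 else 0
    | Sum.inr (Sum.inr e') => if c e = e' then 1 else 0
  obtain ⟨x', hx'01, hsum, hz⟩ := lp_extreme a x h01
  have hxl : ∀ j, ∑ e, (if l e = j then x' e else 0) = ∑ e, (if l e = j then x e else 0) := by
    intro j; have := hsum (Sum.inl j); simpa [a] using this
  have hxr : ∀ j, ∑ e, (if r e = j then x' e else 0) = ∑ e, (if r e = j then x e else 0) := by
    intro j; have := hsum (Sum.inr (Sum.inl j)); simpa [a] using this
  have hxc : ∀ j, ∑ e, (if c e = j then x' e else 0) = ∑ e, (if c e = j then x e else 0) := by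
    intro j; have := hsum (Sum.inr (Sum.inr j)); simpa [a] using this
  obtain ⟨y, hy, hyl, hyr, hyo⟩ := round_bip l r x' hx'01 (by intro j; rw [hxl]; exact hl j)
    (by intro j; rw [hxr]; exact hr j)
  let F : Finset E := univ.filter fun e => 0 < x' e ∧ x' e < 1
  have hF : ∀ e, e ∈ F ↔ 0 < x' e ∧ x' e < 1 := by intro e; simp [F]
  obtain ⟨φ, hφ, hφa⟩ := lp_hall a F (by
    intro z h1 h2
    apply hz z _ h2
    intro e he
    rw [← hF]
    by_contra h; exact he (h1 e h))
  let U : Finset E := univ.filter fun e => ∃ h : e ∈ F, φ ⟨e, h⟩ = Sum.inl (l e)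
  let W : Finset E := univ.filter fun e => ∃ h : e ∈ F, φ ⟨e, h⟩ = Sum.inr (Sum.inl (r e))
  let X : Finset E := univ.filter fun e => ∃ h : e ∈ F, φ ⟨e, h⟩ = Sum.inr (Sum.inr (c e))
  refine ⟨y, U, W, hy, fun j => by rw [hyl, hxl], fun j => by rw [hyr, hxr], ?_, ?_, ?_⟩
  · intro e he e' he' hee
    simp only [U, coe_filter, mem_univ, true_and, Set.mem_ofPred_eq] at he he'
    obtain ⟨h1, h2⟩ := he
    obtain ⟨h1', h2'⟩ := he'
    rw [hee, ← h2'] at h2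
    exact congrArg Subtype.val (hφ h2)
  · intro e he e' he' hee
    simp only [W, coe_filter, mem_univ, true_and, Set.mem_ofPred_eq] at he he'
    obtain ⟨h1, h2⟩ := he
    obtain ⟨h1', h2'⟩ := he'
    rw [hee, ← h2'] at h2
    exact congrArg Subtype.val (hφ h2)
  · intro γ
    have hX : #(X.filter fun e => c e = γ) ≤ 1 := by
      rw [card_le_one]
      intro e he e' he'
      simp only [X, mem_filter, mem_univ, true_and] at he he'
      obtain ⟨⟨h1, h2⟩, h3⟩ := he
      obtain ⟨⟨h1', h2'⟩, h3'⟩ := he'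
      rw [h3, ← h3', ← h2'] at h2
      exact congrArg Subtype.val (hφ h2)
    have hcover : F.filter (fun e => c e = γ) ⊆ (X.filter fun e => c e = γ) ∪ (U.filter fun e => c e = γ) ∪ (W.filter fun e => c e = γ) := by
      intro e he
      obtain ⟨heF, hec⟩ := mem_filter.1 he
      have h1 := hφa ⟨e, heF⟩
      rcases hφe : φ ⟨e, heF⟩ with j | j | j
      · rw [hφe] at h1
        simp only [a] at h1
        have : l e = j := by by_contra h; simp [h] at h1
        have : e ∈ U := by simp only [U, mem_filter, mem_univ, true_and]; exact ⟨heF, by rw [hφe, this]⟩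
        simp [this, hec]
      · rw [hφe] at h1
        simp only [a] at h1
        have : r e = j := by by_contra h; simp [h] at h1
        have : e ∈ W := by simp only [W, mem_filter, mem_univ, true_and]; exact ⟨heF, by rw [hφe, this]⟩
        simp [this, hec]
      · rw [hφe] at h1
        simp only [a] at h1
        have : c e = j := by by_contra h; simp [h] at h1
        have : e ∈ X := by simp only [X, mem_filter, mem_univ, true_and]; exact ⟨heF, by rw [hφe, this]⟩
        simp [this, hec]
    have hcount : #(F.filter fun e => c e = γ) ≤ 1 + #(U.filter fun e => c e = γ) + #(W.filter fun e => c e = γ) := by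
      refine (card_le_card hcover).trans ?_
      refine (card_union_le _ _).trans ?_
      have := card_union_le (X.filter fun e => c e = γ) (U.filter fun e => c e = γ)
      omega
    have e1 : ∑ e, (if c e = γ then y e - x e else 0) = ∑ e, (if c e = γ then y e - x' e else 0) := by
      have h2 : ∀ w : E → ℝ, ∑ e, (if c e = γ then y e - w e else 0) = ∑ e, (if c e = γ then y e else 0) - ∑ e, (if c e = γ then w e else 0) := by
        intro w
        rw [← Finset.sum_sub_distrib]
        refine Finset.sum_congr rfl fun e _ => ?_
        split_ifs <;> simp
      rw [h2, h2, hxc]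
    rw [e1]
    have e2 : |∑ e, (if c e = γ then y e - x' e else 0)| ≤ ∑ e, (if e ∈ F ∧ c e = γ then (1:ℝ) else 0) := by
      refine (Finset.abs_sum_le_sum_abs _ _).trans (Finset.sum_le_sum fun e _ => ?_)
      by_cases hc : c e = γ
      · by_cases he : e ∈ F
        · rw [if_pos hc, if_pos ⟨he, hc⟩, abs_le]
          have := hx'01 e
          rcases hy e with h | h <;> rw [h] <;> constructor <;> linarith
        · rw [if_pos hc, if_neg (by tauto), hyo e (by rwa [hF] at he)]; simp
      · simp [hc]
    refine e2.trans ?_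
    have e3 : ∑ e, (if e ∈ F ∧ c e = γ then (1:ℝ) else 0) = #(F.filter fun e => c e = γ) := by
      rw [Finset.sum_boole]
      congr 2
      ext e; simp
    rw [e3]
    exact_mod_cast hcount

end rnd

end partP3

section partP4a

set_option linter.unusedSimpArgs false
set_option linter.unusedSectionVars false
open Finset Matrix

def Equit {V W : Type} [Fintype V] [Fintype W] (K : V → V → ℝ) (p : V → W) (Q : W → W → ℝ) : Prop :=
  ∀ (a : V) (φ : W → ℝ), ∑ b, K a b * φ (p b) = ∑ v, Q (p a) v * φ v

def Orth {V W : Type} [Fintype V] (p : V → W) (f : V → ℝ) : Prop :=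
  ∀ φ : W → ℝ, ∑ a, f a * φ (p a) = 0

def Unif {V W : Type} [Fintype V] [Fintype W] (p : V → W) (N : ℝ) : Prop :=
  ∀ φ : W → ℝ, ∑ a, φ (p a) = N * ∑ v, φ v

section
variable {V W X : Type} [Fintype V] [Fintype W] [Fintype X]

theorem Equit.comp {K : V → V → ℝ} {p : V → W} {Q : W → W → ℝ} {q : W → X} {R : X → X → ℝ}
    (h1 : Equit K p Q) (h2 : Equit Q q R) : Equit K (q ∘ p) R := by
  intro a φ
  have := h1 a (fun v => φ (q v))
  simp only [Function.comp] at *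
  rw [this]
  exact h2 (p a) φ

theorem Unif.comp {p : V → W} {q : W → X} {N N' : ℝ}
    (h1 : Unif p N) (h2 : Unif q N') : Unif (q ∘ p) (N * N') := by
  intro φ
  have := h1 (fun v => φ (q v))
  simp only [Function.comp] at *
  rw [this, h2 φ, mul_assoc]

theorem fib_sum (p : V → W) (F : V → ℝ) (φ : W → ℝ) [DecidableEq W] :
    ∑ a, F a * φ (p a) = ∑ v, (∑ a, if p a = v then F a else 0) * φ v := by
  simp only [Finset.sum_mul]
  rw [Finset.sum_comm]
  refine Finset.sum_congr rfl fun a _ => ?_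
  simp [ite_mul]

theorem proj_ex (p : V → W) (f : V → ℝ) : ∃ g : W → ℝ, Orth p (fun a => f a - g (p a)) := by
  classical
  let c : W → ℝ := fun v => ∑ a, if p a = v then 1 else 0
  let s : W → ℝ := fun v => ∑ a, if p a = v then f a else 0
  refine ⟨fun v => s v / c v, fun φ => ?_⟩
  have h1 : ∑ a, f a * φ (p a) = ∑ v, s v * φ v := fib_sum p f φ
  have h2 : ∑ a, s (p a) / c (p a) * φ (p a) = ∑ v, c v * (s v / c v * φ v) := by
    have := fib_sum p (fun _ => (1:ℝ)) (fun v => s v / c v * φ v)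
    simp only [one_mul] at this
    exact this
  simp only [sub_mul, Finset.sum_sub_distrib]
  rw [h1, h2, ← Finset.sum_sub_distrib]
  refine Finset.sum_eq_zero fun v _ => ?_
  by_cases hc : c v = 0
  · have hs : s v = 0 := by
      have hall : ∀ a, p a ≠ v := by
        intro a ha
        have h3 := (Finset.sum_eq_zero_iff_of_nonneg (s := (univ : Finset V))
          (f := fun a => if p a = v then (1:ℝ) else 0) (fun i _ => by split_ifs <;> norm_num)).1 hc a (mem_univ a)
        simp [ha] at h3
      exact Finset.sum_eq_zero fun a _ => by simp [hall a]
    simp [hc, hs]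
  · field_simp
    ring

theorem pyth (p : V → W) (z : V → ℝ) (hz : Orth p z) (φ : W → ℝ) :
    ∑ a, (φ (p a) + z a) ^ 2 = ∑ a, φ (p a) ^ 2 + ∑ a, z a ^ 2 := by
  have h := hz φ
  have : ∑ a, (φ (p a) + z a) ^ 2 = ∑ a, φ (p a) ^ 2 + ∑ a, z a ^ 2 + 2 * ∑ a, z a * φ (p a) := by
    rw [Finset.mul_sum, ← Finset.sum_add_distrib, ← Finset.sum_add_distrib]
    exact Finset.sum_congr rfl fun a _ => by ring
  rw [this, h]; ring

theorem qf_equit {K : V → V → ℝ} {p : V → W} {Q : W → W → ℝ} (h : Equit K p Q) (f : V → ℝ) (φ : W → ℝ) :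
    qf K f (fun a => φ (p a)) = ∑ a, f a * ∑ v, Q (p a) v * φ v := by
  unfold qf
  refine Finset.sum_congr rfl fun a _ => ?_
  rw [← h a φ, Finset.mul_sum]
  exact Finset.sum_congr rfl fun b _ => by ring

theorem qf_symm {K : V → V → ℝ} (hK : ∀ a b, K a b = K b a) (f g : V → ℝ) : qf K f g = qf K g f := by
  unfold qf
  rw [Finset.sum_comm]
  exact Finset.sum_congr rfl fun a _ => Finset.sum_congr rfl fun b _ => by rw [hK]; ring

theorem qf_add {K : V → V → ℝ} (hK : ∀ a b, K a b = K b a) (f g : V → ℝ) :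
    qf K (fun a => f a + g a) (fun a => f a + g a) = qf K f f + 2 * qf K f g + qf K g g := by
  have h1 : qf K (fun a => f a + g a) (fun a => f a + g a) = qf K f f + qf K f g + (qf K g f + qf K g g) := by
    unfold qf
    simp only [← Finset.sum_add_distrib]
    exact Finset.sum_congr rfl fun a _ => Finset.sum_congr rfl fun b _ => by ring
  rw [h1, qf_symm hK g f]; ring

theorem qf_equit_orth {K : V → V → ℝ} {p : V → W} {Q : W → W → ℝ} (h : Equit K p Q) (f : V → ℝ)
    (hf : Orth p f) (φ : W → ℝ) : qf K f (fun a => φ (p a)) = 0 := by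
  rw [qf_equit h]
  exact hf (fun w => ∑ v, Q w v * φ v)

theorem qf_abs {K : V → V → ℝ} (hK : ∀ a b, 0 ≤ K a b) (f g : V → ℝ) :
    |qf K f g| ≤ qf K (fun a => |f a|) (fun a => |g a|) := by
  unfold qf
  refine (Finset.abs_sum_le_sum_abs _ _).trans (Finset.sum_le_sum fun a _ => ?_)
  refine (Finset.abs_sum_le_sum_abs _ _).trans (Finset.sum_le_sum fun b _ => ?_)
  rw [abs_mul, abs_mul, abs_of_nonneg (hK a b)]

/-- lift bound for nonnegative kernels -/
theorem liftBound [DecidableEq W] {K : V → V → ℝ} (hK0 : ∀ a b, 0 ≤ K a b) (hKs : ∀ a b, K a b = K b a)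
    {P : V → W} {Q : Matrix W W ℝ} (hQ : Q.IsSymm) (h : Equit K P Q) (f : V → ℝ) :
    qf K (fun a => |f a|) (fun a => |f a|) ≤ lam Q 1 * ∑ a, f a ^ 2 := by
  let R : W → ℝ := fun v => ∑ a, if P a = v then f a ^ 2 else 0
  let r : W → ℝ := fun v => Real.sqrt (R v)
  have hR0 : ∀ v, 0 ≤ R v := fun v => Finset.sum_nonneg fun a _ => by split_ifs <;> positivity
  have hr0 : ∀ v, 0 ≤ r v := fun v => Real.sqrt_nonneg _
  have hr2 : ∀ v, r v ^ 2 = R v := fun v => Real.sq_sqrt (hR0 v)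
  have hz : ∀ a, r (P a) = 0 → f a = 0 := by
    intro a ha
    have h1 : R (P a) = 0 := by rw [← hr2, ha]; simp
    have h3 := (Finset.sum_eq_zero_iff_of_nonneg (s := (univ : Finset V))
          (f := fun b => if P b = P a then f b ^ 2 else 0) (fun i _ => by split_ifs <;> positivity)).1 h1 a (mem_univ a)
    simpa using h3
  have hfib : ∀ φ : W → ℝ, ∑ a, f a ^ 2 * φ (P a) = ∑ v, r v ^ 2 * φ v := by
    intro φ
    rw [fib_sum P (fun a => f a ^ 2) φ]
    exact Finset.sum_congr rfl fun v _ => by rw [hr2]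
  have key : ∀ a b, K a b * |f a| * |f b| ≤ (K a b * r (P b)) * (f a ^ 2 / r (P a)) / 2 + (K b a * r (P a)) * (f b ^ 2 / r (P b)) / 2 := by
    intro a b
    rw [← hKs a b]
    by_cases ha : r (P a) = 0
    · simp [ha, hz a ha]
    by_cases hb : r (P b) = 0
    · simp [hb, hz b hb]
    have ha' : 0 < r (P a) := lt_of_le_of_ne (hr0 _) (Ne.symm ha)
    have hb' : 0 < r (P b) := lt_of_le_of_ne (hr0 _) (Ne.symm hb)
    have h1 : |f a| * |f b| ≤ r (P b) * (f a ^ 2 / r (P a)) / 2 + r (P a) * (f b ^ 2 / r (P b)) / 2 := by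
      have : r (P b) * (f a ^ 2 / r (P a)) / 2 + r (P a) * (f b ^ 2 / r (P b)) / 2 - |f a| * |f b|
          = (r (P b) * |f a| - r (P a) * |f b|) ^ 2 / (2 * (r (P a) * r (P b))) := by
        rw [← sq_abs (f a), ← sq_abs (f b)]
        field_simp
        ring
      have h2 : 0 ≤ (r (P b) * |f a| - r (P a) * |f b|) ^ 2 / (2 * (r (P a) * r (P b))) := by positivity
      linarith
    have := mul_le_mul_of_nonneg_left h1 (hK0 a b)
    linarith
  have hone : ∑ a, ∑ b, (K a b * r (P b)) * (f a ^ 2 / r (P a)) = qf Q r r := by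
    have : ∀ a, ∑ b, (K a b * r (P b)) * (f a ^ 2 / r (P a)) = f a ^ 2 * ((∑ v, Q (P a) v * r v) / r (P a)) := by
      intro a
      rw [← Finset.sum_mul, h a r]; ring
    rw [Finset.sum_congr rfl fun a _ => this a, hfib (fun i => (∑ v, Q i v * r v) / r i)]
    unfold qf
    refine Finset.sum_congr rfl fun i _ => ?_
    by_cases hi : r i = 0
    · simp [hi]
    · rw [pow_two, mul_assoc, mul_div_cancel₀ _ hi, Finset.mul_sum]
      exact Finset.sum_congr rfl fun b _ => by ring
  have htwo : ∑ a, ∑ b, (K b a * r (P a)) * (f b ^ 2 / r (P b)) = qf Q r r := by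
    rw [Finset.sum_comm]; exact hone
  have hle : qf K (fun a => |f a|) (fun a => |f a|) ≤ qf Q r r := by
    calc qf K (fun a => |f a|) (fun a => |f a|) ≤ ∑ a, ∑ b, ((K a b * r (P b)) * (f a ^ 2 / r (P a)) / 2 + (K b a * r (P a)) * (f b ^ 2 / r (P b)) / 2) :=
          Finset.sum_le_sum fun a _ => Finset.sum_le_sum fun b _ => key a b
      _ = qf Q r r / 2 + qf Q r r / 2 := by
          simp only [Finset.sum_add_distrib, ← Finset.sum_div]
          rw [hone, htwo]
      _ = _ := by ring
  refine hle.trans ((L1 Q hQ r).trans (le_of_eq ?_))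
  congr 1
  have := hfib (fun _ => 1)
  simp only [mul_one] at this
  exact this.symm

theorem liftBound' [DecidableEq W] {K : V → V → ℝ} (hK0 : ∀ a b, 0 ≤ K a b) (hKs : ∀ a b, K a b = K b a)
    {P : V → W} {Q : Matrix W W ℝ} (hQ : Q.IsSymm) (h : Equit K P Q) (f : V → ℝ) :
    |qf K f f| ≤ lam Q 1 * ∑ a, f a ^ 2 :=
  (qf_abs hK0 f f).trans (liftBound hK0 hKs hQ h f)

theorem constBound [DecidableEq W] {K : V → V → ℝ} (hKs : ∀ a b, K a b = K b a)
    {P : V → W} {Q : Matrix W W ℝ} (hQ : Q.IsSymm) (h : Equit K P Q) (w : W → ℝ) :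
    qf K (fun a => w (P a)) (fun a => w (P a)) ≤ lam Q 1 * ∑ a, w (P a) ^ 2 := by
  let c : W → ℝ := fun v => ∑ a, if P a = v then 1 else 0
  have hc0 : ∀ v, 0 ≤ c v := fun v => Finset.sum_nonneg fun a _ => by split_ifs <;> norm_num
  have hfib : ∀ φ : W → ℝ, ∑ a, φ (P a) = ∑ v, c v * φ v := by
    intro φ
    have := fib_sum P (fun _ => (1:ℝ)) φ
    simp only [one_mul] at this
    exact this
  have hcc : ∀ i j, c i * Q i j = c j * Q i j := by
    intro i j
    have h1 : ∀ i j, qf K (fun a => if P a = i then 1 else 0) (fun a => if P a = j then 1 else 0) = c i * Q i j := by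
      intro i j
      have := qf_equit h (fun a => if P a = i then 1 else 0) (fun v => if v = j then 1 else 0)
      rw [this]
      simp only [mul_ite, mul_one, mul_zero, Finset.sum_ite_eq', mem_univ, if_true, ite_mul, one_mul, zero_mul]
      change _ = (∑ a, if P a = i then (1:ℝ) else 0) * Q i j
      rw [Finset.sum_mul]
      refine Finset.sum_congr rfl fun a _ => ?_
      by_cases ha : P a = i
      · simp [ha]
      · simp [ha]
    rw [← h1 i j, qf_symm hKs, h1 j i, hQ.apply]
  have hs : ∀ i j, Real.sqrt (c i) * Real.sqrt (c j) * Q i j = c i * Q i j := by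
    intro i j
    by_cases hq : Q i j = 0
    · simp [hq]
    · have := mul_right_cancel₀ hq (hcc i j)
      rw [← this, Real.mul_self_sqrt (hc0 i)]
  have h2 : qf K (fun a => w (P a)) (fun a => w (P a)) = qf Q (fun i => Real.sqrt (c i) * w i) (fun i => Real.sqrt (c i) * w i) := by
    rw [qf_equit h, hfib (fun i => w i * ∑ v, Q i v * w v)]
    unfold qf
    refine Finset.sum_congr rfl fun i _ => ?_
    rw [Finset.mul_sum, Finset.mul_sum]
    refine Finset.sum_congr rfl fun j _ => ?_
    linear_combination (- w i * w j) * hs i j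
  rw [h2, hfib (fun i => w i ^ 2)]
  refine (L1 Q hQ _).trans (le_of_eq ?_)
  congr 1
  refine Finset.sum_congr rfl fun i _ => ?_
  rw [mul_pow, Real.sq_sqrt (hc0 i)]

/-- bilinear bound from quadratic -/
theorem bilin {K : V → V → ℝ} (hKs : ∀ a b, K a b = K b a) (θ : ℝ)
    (h : ∀ f, |qf K f f| ≤ θ * ∑ a, f a ^ 2) (f g : V → ℝ) (x y : ℝ) (hx : 0 ≤ x) (hy : 0 ≤ y)
    (hfx : ∑ a, f a ^ 2 = x ^ 2) (hgy : ∑ a, g a ^ 2 = y ^ 2) :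
    |qf K f g| ≤ θ * x * y := by
  have hsm : ∀ s t : ℝ, qf K (fun a => s * f a) (fun a => t * g a) = s * t * qf K f g := by
    intro s t
    unfold qf
    simp only [Finset.mul_sum]
    exact Finset.sum_congr rfl fun a _ => Finset.sum_congr rfl fun b _ => by ring
  have hsq : ∀ s t : ℝ, ∑ a, (s * f a + t * g a) ^ 2 + ∑ a, (s * f a + (-t) * g a) ^ 2 = 2 * (s ^ 2 * x ^ 2 + t ^ 2 * y ^ 2) := by
    intro s t
    rw [← hfx, ← hgy]
    simp only [Finset.mul_sum, ← Finset.sum_add_distrib]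
    exact Finset.sum_congr rfl fun a _ => by ring
  have hpol : ∀ s t : ℝ, 4 * |s * t * qf K f g| ≤ θ * (2 * (s ^ 2 * x ^ 2 + t ^ 2 * y ^ 2)) := by
    intro s t
    have e1 := qf_add hKs (fun a => s * f a) (fun a => t * g a)
    have e2 := qf_add hKs (fun a => s * f a) (fun a => (-t) * g a)
    have e3 : qf K (fun a => (-t) * g a) (fun a => (-t) * g a) = qf K (fun a => t * g a) (fun a => t * g a) := by
      unfold qf
      exact Finset.sum_congr rfl fun a _ => Finset.sum_congr rfl fun b _ => by ring
    rw [hsm] at e1 e2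
    have b1 := h (fun a => s * f a + t * g a)
    have b2 := h (fun a => s * f a + (-t) * g a)
    rw [← hsq s t, mul_add]
    rw [abs_le] at b1 b2
    have : |4 * (s * t * qf K f g)| ≤ θ * ∑ a, (s * f a + t * g a) ^ 2 + θ * ∑ a, (s * f a + (-t) * g a) ^ 2 := by
      rw [abs_le]
      constructor <;> nlinarith
    rwa [abs_mul, abs_of_pos (by norm_num : (0:ℝ) < 4)] at this
  by_cases hx0 : x = 0
  · have : ∀ a, f a = 0 := by
      intro a
      rw [hx0] at hfx
      have := (Finset.sum_eq_zero_iff_of_nonneg (fun i _ => sq_nonneg (f i))).1 (by simpa using hfx) a (mem_univ a)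
      simpa using this
    simp [qf, this, hx0]
  by_cases hy0 : y = 0
  · have : ∀ a, g a = 0 := by
      intro a
      rw [hy0] at hgy
      have := (Finset.sum_eq_zero_iff_of_nonneg (fun i _ => sq_nonneg (g i))).1 (by simpa using hgy) a (mem_univ a)
      simpa using this
    simp [qf, this, hy0]
  have hx' : 0 < x := lt_of_le_of_ne hx (Ne.symm hx0)
  have hy' : 0 < y := lt_of_le_of_ne hy (Ne.symm hy0)
  have := hpol y x
  rw [abs_mul, abs_of_pos (mul_pos hy' hx')] at this
  have h3 : (y * x) * (4 * |qf K f g|) ≤ (y * x) * (4 * (θ * x * y)) := by nlinarith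
  have := le_of_mul_le_mul_left h3 (mul_pos hy' hx')
  linarith
end

end partP4a

section partP4b

set_option linter.unusedSimpArgs false
set_option linter.unusedSectionVars false
open Finset Matrix

def sg (x : Bool) : ℝ := if x then -1 else 1

def twoLift {V : Type} (G : SimpleGraph V) (s : V → V → Bool) (hs : ∀ a b, s a b = s b a) :
    SimpleGraph (V × Bool) where
  Adj a b := G.Adj a.1 b.1 ∧ b.2 = xor a.2 (s a.1 b.1)
  symm := ⟨by
    rintro ⟨a, x⟩ ⟨b, y⟩ ⟨h1, h2⟩
    refine ⟨h1.symm, ?_⟩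
    simp only at *
    rw [hs b a, h2]
    cases x <;> cases s a b <;> rfl⟩
  loopless := ⟨by
    rintro ⟨a, x⟩ ⟨h1, h2⟩
    exact h1.ne rfl⟩

section
variable {V W : Type} [Fintype V] [Fintype W]

theorem ad_twoLift (G : SimpleGraph V) (s : V → V → Bool) (hs : ∀ a b, s a b = s b a) (a b : V) (x y : Bool) :
    ad (twoLift G s hs) (a, x) (b, y) = ad G a b * (if y = xor x (s a b) then 1 else 0) := by
  unfold ad twoLift
  by_cases h : G.Adj a b <;> by_cases h2 : y = xor x (s a b) <;> simp [h, h2]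

theorem sum_bool (f : V × Bool → ℝ) : ∑ c, f c = ∑ a, (f (a, false) + f (a, true)) := by
  rw [Fintype.sum_prod_type]
  exact Finset.sum_congr rfl fun a _ => by rw [Fintype.sum_bool]; ring

theorem sum_ad_twoLift (G : SimpleGraph V) (s : V → V → Bool) (hs : ∀ a b, s a b = s b a) (a : V) (x : Bool)
    (g h : V → ℝ) : ∑ c, ad (twoLift G s hs) (a, x) c * (g c.1 + sg c.2 * h c.1)
      = ∑ b, ad G a b * g b + sg x * ∑ b, (ad G a b * sg (s a b)) * h b := by
  rw [sum_bool, Finset.mul_sum, ← Finset.sum_add_distrib]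
  refine Finset.sum_congr rfl fun b _ => ?_
  simp only [ad_twoLift]
  cases x <;> cases s a b <;> simp [sg]
  all_goals ring

theorem equit_twoLift (G : SimpleGraph V) (s : V → V → Bool) (hs : ∀ a b, s a b = s b a) :
    Equit (ad (twoLift G s hs)) Prod.fst (ad G) := by
  rintro ⟨a, x⟩ φ
  have := sum_ad_twoLift G s hs a x φ (fun _ => 0)
  simpa using this

theorem unif_fst : Unif (Prod.fst : V × Bool → V) 2 := by
  intro φ
  rw [sum_bool, Finset.mul_sum]
  exact Finset.sum_congr rfl fun a _ => by simp; ring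

theorem split_bool (f : V × Bool → ℝ) : ∃ g h : V → ℝ, f = fun c => g c.1 + sg c.2 * h c.1 := by
  refine ⟨fun a => (f (a, false) + f (a, true)) / 2, fun a => (f (a, false) - f (a, true)) / 2, ?_⟩
  funext ⟨a, x⟩
  cases x <;> simp [sg] <;> ring

theorem sq_bool (g h : V → ℝ) : ∑ c : V × Bool, (g c.1 + sg c.2 * h c.1) ^ 2 = 2 * ∑ a, g a ^ 2 + 2 * ∑ a, h a ^ 2 := by
  rw [sum_bool, Finset.mul_sum, Finset.mul_sum, ← Finset.sum_add_distrib]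
  exact Finset.sum_congr rfl fun a _ => by simp [sg]; ring

theorem qf_twoLift (G : SimpleGraph V) (s : V → V → Bool) (hs : ∀ a b, s a b = s b a) (g h : V → ℝ) :
    qf (ad (twoLift G s hs)) (fun c => g c.1 + sg c.2 * h c.1) (fun c => g c.1 + sg c.2 * h c.1)
      = 2 * qf (ad G) g g + 2 * qf (fun a b => ad G a b * sg (s a b)) h h := by
  have : ∀ c : V × Bool, ∑ d, ad (twoLift G s hs) c d * (g c.1 + sg c.2 * h c.1) * (g d.1 + sg d.2 * h d.1)
     = (g c.1 + sg c.2 * h c.1) * (∑ b, ad G c.1 b * g b + sg c.2 * ∑ b, (ad G c.1 b * sg (s c.1 b)) * h b) := by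
    rintro ⟨a, x⟩
    rw [← sum_ad_twoLift G s hs a x g h, Finset.mul_sum]
    exact Finset.sum_congr rfl fun b _ => by ring
  have e : ∀ (A : V → V → ℝ) (k : V → ℝ) a, ∑ b, A a b * k a * k b = k a * ∑ b, A a b * k b := by
    intro A k a
    rw [Finset.mul_sum]
    exact Finset.sum_congr rfl fun b _ => by ring
  unfold qf
  rw [Finset.sum_congr rfl fun c _ => this c, sum_bool, Finset.mul_sum, Finset.mul_sum, ← Finset.sum_add_distrib]
  refine Finset.sum_congr rfl fun a _ => ?_
  rw [e (ad G), e (fun a b => ad G a b * sg (s a b))]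
  simp only [sg]
  simp
  ring

theorem orth_bool {p : V → W} (g h : V → ℝ) (ho : Orth (p ∘ Prod.fst) (fun c : V × Bool => g c.1 + sg c.2 * h c.1)) :
    Orth p g := by
  intro φ
  have := ho φ
  rw [sum_bool] at this
  have e : ∑ a, g a * φ (p a) = (∑ a : V, ((g a + sg false * h a) * φ (p a) + (g a + sg true * h a) * φ (p a))) / 2 := by
    rw [Finset.sum_div]
    exact Finset.sum_congr rfl fun a _ => by simp [sg]; ring
  rw [e]
  simp only [Function.comp] at this
  rw [this]; simp

theorem cover_ex (G : SimpleGraph V) (δ : ℝ) (hδ : 0 ≤ δ) (hdeg : ∀ a, ∑ b, ad G a b ≤ δ ^ 2) (T : ℕ) :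
    ∃ (V' : Type) (_ : Fintype V') (G' : SimpleGraph V') (p : V' → V), Equit (ad G') p (ad G) ∧
      Unif p (2 ^ T) ∧ Fintype.card V' = 2 ^ T * Fintype.card V ∧
      ∀ f, Orth p f → qf (ad G') f f ≤ 2 * δ * ∑ a, f a ^ 2 := by
  induction T with
  | zero =>
    refine ⟨V, inferInstance, G, id, fun a φ => rfl, fun φ => by simp, by simp, fun f hf => ?_⟩
    have h0 : ∀ a, f a = 0 := by
      have := hf f
      simp only [id] at this
      intro a
      have := (Finset.sum_eq_zero_iff_of_nonneg (fun i _ => mul_self_nonneg (f i))).1 this a (mem_univ a)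
      simpa using this
    simp [qf, h0]
  | succ T ih =>
    obtain ⟨V', _, G', p, h1, h2, h3, h4⟩ := ih
    have hd : ∀ a, ∑ b, ad G' a b ≤ δ ^ 2 := by
      intro a
      have := h1 a (fun _ => 1)
      simp only [mul_one] at this
      rw [this]; exact hdeg _
    obtain ⟨s, hs, hq⟩ := mss G' δ hδ hd
    refine ⟨V' × Bool, inferInstance, twoLift G' s hs, p ∘ Prod.fst, (equit_twoLift G' s hs).comp h1, ?_, ?_, ?_⟩
    · have := (unif_fst (V := V')).comp h2
      rw [pow_succ, mul_comm]; exact this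
    · rw [Fintype.card_prod, h3, Fintype.card_bool]; ring
    · intro f hf
      obtain ⟨g, h, rfl⟩ := split_bool f
      rw [qf_twoLift, sq_bool]
      have e1 := h4 g (orth_bool g h hf)
      have e2 := hq h
      change qf (fun a b => ad G' a b * sg (s a b)) h h ≤ _ at e2
      linarith
end

end partP4b

section partP4c

set_option linter.unusedSimpArgs false
set_option linter.unusedSectionVars false
open Finset Matrix

theorem rounding_supp {E L R C : Type} [Fintype E] [DecidableEq E] [Fintype L] [DecidableEq L] [Fintype R] [DecidableEq R]
    [Fintype C] [DecidableEq C] (S : E → Prop) [DecidablePred S]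
    (l : E → L) (r : E → R) (c : E → C) (x : E → ℝ) (h01 : ∀ e, 0 ≤ x e ∧ x e ≤ 1) (hS : ∀ e, ¬ S e → x e = 0)
    (hl : ∀ j, ∃ n : ℤ, ∑ e, (if l e = j then x e else 0) = n)
    (hr : ∀ j, ∃ n : ℤ, ∑ e, (if r e = j then x e else 0) = n) :
    ∃ (y : E → ℝ) (U W : Finset E), (∀ e, y e = 0 ∨ y e = 1) ∧ (∀ e, ¬ S e → y e = 0) ∧
      (∀ j, ∑ e, (if l e = j then y e else 0) = ∑ e, (if l e = j then x e else 0)) ∧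
      (∀ j, ∑ e, (if r e = j then y e else 0) = ∑ e, (if r e = j then x e else 0)) ∧
      Set.InjOn l U ∧ Set.InjOn r W ∧
      ∀ γ, |∑ e, (if c e = γ then y e - x e else 0)| ≤ 1 + #(U.filter fun e => c e = γ) + #(W.filter fun e => c e = γ) := by
  let l' : E → L ⊕ E := fun e => if S e then Sum.inl (l e) else Sum.inr e
  let r' : E → R ⊕ E := fun e => if S e then Sum.inl (r e) else Sum.inr e
  let c' : E → Option C := fun e => if S e then some (c e) else none
  have hlz : ∀ (z : E → ℝ), (∀ e, ¬ S e → z e = 0) → ∀ j, ∑ e, (if l' e = Sum.inl j then z e else 0) = ∑ e, (if l e = j then z e else 0) := by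
    intro z hz j
    refine Finset.sum_congr rfl fun e _ => ?_
    by_cases he : S e <;> simp [l', he, hz]
  have hrz : ∀ (z : E → ℝ), (∀ e, ¬ S e → z e = 0) → ∀ j, ∑ e, (if r' e = Sum.inl j then z e else 0) = ∑ e, (if r e = j then z e else 0) := by
    intro z hz j
    refine Finset.sum_congr rfl fun e _ => ?_
    by_cases he : S e <;> simp [r', he, hz]
  have hlr : ∀ (z : E → ℝ) e₀, ¬ S e₀ → ∑ e, (if l' e = Sum.inr e₀ then z e else 0) = z e₀ := by
    intro z e₀ h0
    rw [Finset.sum_eq_single e₀]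
    · simp [l', h0]
    · intro b _ hb
      by_cases hbS : S b <;> simp [l', hbS, hb]
    · simp
  have hlr1 : ∀ (z : E → ℝ) e₀, S e₀ → ∑ e, (if l' e = Sum.inr e₀ then z e else 0) = 0 := by
    intro z e₀ h0
    refine Finset.sum_eq_zero fun b _ => ?_
    by_cases hbS : S b
    · simp [l', hbS]
    · have : b ≠ e₀ := by rintro rfl; exact hbS h0
      simp [l', hbS, this]
  have hrr : ∀ (z : E → ℝ) e₀, (∀ e, ¬ S e → z e = 0) → ∑ e, (if r' e = Sum.inr e₀ then z e else 0) = 0 := by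
    intro z e₀ hz
    refine Finset.sum_eq_zero fun b _ => ?_
    by_cases hbS : S b
    · simp [r', hbS]
    · simp [hz b hbS]
  obtain ⟨y, U, W, h1, h2, h3, h4, h5, h6⟩ := rounding l' r' c' x h01 (by
    rintro (j | e)
    · obtain ⟨n, hn⟩ := hl j
      exact ⟨n, by rw [hlz x hS]; exact hn⟩
    · by_cases he : S e
      · exact ⟨0, by rw [hlr1 x e he]; simp⟩
      · exact ⟨0, by rw [hlr x e he, hS e he]; simp⟩) (by
    rintro (j | e)
    · obtain ⟨n, hn⟩ := hr j
      exact ⟨n, by rw [hrz x hS]; exact hn⟩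
    · exact ⟨0, by rw [hrr x e hS]; simp⟩)
  have hy : ∀ e, ¬ S e → y e = 0 := by
    intro e he
    have := h2 (Sum.inr e)
    rw [hlr y e he, hlr x e he, hS e he] at this
    exact this
  refine ⟨y, U.filter S, W.filter S, h1, hy, fun j => ?_, fun j => ?_, ?_, ?_, fun γ => ?_⟩
  · rw [← hlz y hy, ← hlz x hS]; exact h2 _
  · rw [← hrz y hy, ← hrz x hS]; exact h3 _
  · intro a ha b hb hab
    simp only [coe_filter, Set.mem_ofPred_eq] at ha hb
    exact h4 ha.1 hb.1 (by simp [l', ha.2, hb.2, hab])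
  · intro a ha b hb hab
    simp only [coe_filter, Set.mem_ofPred_eq] at ha hb
    exact h5 ha.1 hb.1 (by simp [r', ha.2, hb.2, hab])
  · have := h6 (some γ)
    have e1 : ∑ e, (if c' e = some γ then y e - x e else 0) = ∑ e, (if c e = γ then y e - x e else 0) := by
      refine Finset.sum_congr rfl fun e _ => ?_
      by_cases he : S e <;> simp [c', he, hy, hS]
    have e2 : ∀ U : Finset E, (U.filter fun e => c' e = some γ) = ((U.filter S).filter fun e => c e = γ) := by
      intro U
      ext e
      by_cases he : S e <;> simp [c', he]
    rw [e1, e2, e2] at this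
    exact this

section
variable {V' V K : Type} [Fintype V'] [Fintype V] [Fintype K]

theorem inj_count (T : Finset (V' × V')) [DecidableEq V'] [DecidableEq V] [DecidableEq K] (p : V' → V) (P : V → K) (N : ℝ) (hp : Unif p N)
    (hT : Set.InjOn (fun e : V' × V' => (e.1, P (p e.2))) T) (u : V) (φ : K → ℝ) (hφ : ∀ i, 0 ≤ φ i) :
    ∑ v, (#(T.filter fun e => (p e.1, p e.2) = (u, v)) : ℝ) * φ (P v) ≤ N * ∑ i, φ i := by
  let F : V' × K → ℝ := fun t => if p t.1 = u then φ t.2 else 0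
  have h1 : ∑ v, (#(T.filter fun e => (p e.1, p e.2) = (u, v)) : ℝ) * φ (P v) = ∑ e ∈ T, F (e.1, P (p e.2)) := by
    simp only [Finset.card_filter, Nat.cast_sum, Finset.sum_mul]
    rw [Finset.sum_comm]
    refine Finset.sum_congr rfl fun e _ => ?_
    simp only [F]
    rw [Finset.sum_eq_single (p e.2)]
    · by_cases h : p e.1 = u <;> simp [h]
    · intro b _ hb
      have : ¬ ((p e.1, p e.2) = (u, b)) := by
        intro h; exact hb (Prod.ext_iff.1 h).2.symm
      simp [this]
    · simp
  rw [h1, ← Finset.sum_image (f := F) (s := T) (g := fun e : V' × V' => (e.1, P (p e.2))) hT]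
  refine (Finset.sum_le_sum_of_subset_of_nonneg (Finset.subset_univ _) (fun t _ _ => ?_)).trans (le_of_eq ?_)
  · simp only [F]; split_ifs
    · exact hφ _
    · exact le_rfl
  · rw [Fintype.sum_prod_type]
    have := hp (fun v => if v = u then ∑ i, φ i else 0)
    simp only [Finset.sum_ite_eq', mem_univ, if_true] at this
    rw [← this]
    refine Finset.sum_congr rfl fun a _ => ?_
    simp only [F]
    by_cases h : p a = u <;> simp [h]

theorem inj_count2 (T : Finset (V' × V')) [DecidableEq V'] [DecidableEq V] [DecidableEq K] (p : V' → V) (P : V → K) (N : ℝ) (hp : Unif p N)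
    (hT : Set.InjOn (fun e : V' × V' => (e.2, P (p e.1))) T) (v : V) (φ : K → ℝ) (hφ : ∀ i, 0 ≤ φ i) :
    ∑ u, (#(T.filter fun e => (p e.1, p e.2) = (u, v)) : ℝ) * φ (P u) ≤ N * ∑ i, φ i := by
  have h := inj_count (T.map (Equiv.prodComm V' V').toEmbedding) p P N hp (by
    intro a ha b hb hab
    simp only [coe_map, Set.mem_image, mem_coe] at ha hb
    obtain ⟨a', ha', rfl⟩ := ha
    obtain ⟨b', hb', rfl⟩ := hb
    have := hT ha' hb' hab
    rw [this]) v φ hφ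
  refine (le_of_eq ?_).trans h
  refine Finset.sum_congr rfl fun u _ => ?_
  congr 2
  rw [Finset.filter_map, Finset.card_map]
  congr 1
  ext e
  simp [and_comm]
end

set_option maxHeartbeats 300000 in
theorem H_ex {V' V : Type} [Fintype V'] [Fintype V] {k : ℕ} (G' : SimpleGraph V') (G : SimpleGraph V)
    (p : V' → V) (P : V → Fin k) (M Dr : Fin k → Fin k → ℝ) (N : ℝ)
    (hcov : Equit (ad G') p (ad G)) (hlift : Equit (ad G) P M) (hp : Unif p N)
    (hDs : ∀ i j, Dr i j = Dr j i) (hMs : ∀ i j, M i j = M j i) (hD0 : ∀ i j, 0 ≤ Dr i j) (hDM : ∀ i j, Dr i j ≤ M i j)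
    (hM0 : ∀ i, M i i = 0) (hDint : ∀ i j, ∃ n : ℤ, Dr i j = n) :
    ∃ (H : V' → V' → ℝ) (OL OR : V → V → ℝ), (∀ a b, H a b = H b a) ∧ (∀ a b, H a b = 0 ∨ (H a b = 1 ∧ G'.Adj a b)) ∧
      Equit H (P ∘ p) Dr ∧ (∀ u v, 0 ≤ OL u v) ∧ (∀ u v, 0 ≤ OR u v) ∧
      (∀ u (φ : Fin k → ℝ), (∀ i, 0 ≤ φ i) → ∑ v, OL u v * φ (P v) ≤ N * ∑ i, φ i) ∧
      (∀ v (φ : Fin k → ℝ), (∀ i, 0 ≤ φ i) → ∑ u, OR u v * φ (P u) ≤ N * ∑ i, φ i) ∧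
      ∀ g : V → ℝ, |qf (fun a b => H a b - Dr (P (p a)) (P (p b)) / M (P (p a)) (P (p b)) * ad G' a b) (fun a => g (p a)) (fun a => g (p a))|
        ≤ 2 * ∑ u, ∑ v, ad G u v * (1 + OL u v + OR u v) * (|g u| * |g v|) := by
  classical
  let P' : V' → Fin k := P ∘ p
  have hP' : Equit (ad G') P' M := hcov.comp hlift
  have hM00 : ∀ i j, 0 ≤ M i j := fun i j => (hD0 i j).trans (hDM i j)
  let X : Fin k → Fin k → ℝ := fun i j => Dr i j / M i j
  have hX0 : ∀ i j, 0 ≤ X i j := fun i j => div_nonneg (hD0 i j) (hM00 i j)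
  have hX1 : ∀ i j, X i j ≤ 1 := fun i j => div_le_one_of_le₀ (hDM i j) (hM00 i j)
  have hXM : ∀ i j, M i j * X i j = Dr i j := by
    intro i j
    by_cases h : M i j = 0
    · have h1 := hD0 i j
      have h2 := hDM i j
      rw [h] at h2 ⊢
      linarith
    · exact mul_div_cancel₀ _ h
  have hD00 : ∀ i, Dr i i = 0 := fun i => le_antisymm ((hDM i i).trans (hM0 i).le) (hD0 i i)
  have hXs : ∀ i j, X i j = X j i := fun i j => by simp only [X]; rw [hDs, hMs]
  let x : V' × V' → ℝ := fun e => if P' e.1 < P' e.2 then ad G' e.1 e.2 * X (P' e.1) (P' e.2) else 0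
  let S : V' × V' → Prop := fun e => G'.Adj e.1 e.2 ∧ P' e.1 < P' e.2
  have had1 : ∀ a b, ad G' a b ≤ 1 := fun a b => by unfold ad; split_ifs <;> norm_num
  have hxl : ∀ a (φ : Fin k → ℝ), ∑ b, x (a, b) * φ (P' b) = ∑ j, (if P' a < j then Dr (P' a) j else 0) * φ j := by
    intro a φ
    have := hP' a (fun j => (if P' a < j then X (P' a) j else 0) * φ j)
    calc _ = ∑ b, ad G' a b * ((if P' a < P' b then X (P' a) (P' b) else 0) * φ (P' b)) := by
          refine Finset.sum_congr rfl fun b _ => ?_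
          simp only [x]; split_ifs <;> ring
      _ = _ := by
          rw [this]
          refine Finset.sum_congr rfl fun j _ => ?_
          rw [← hXM]
          split_ifs <;> ring
  have hxr : ∀ b (φ : Fin k → ℝ), ∑ a, x (a, b) * φ (P' a) = ∑ i, (if i < P' b then Dr i (P' b) else 0) * φ i := by
    intro b φ
    have := hP' b (fun i => (if i < P' b then X i (P' b) else 0) * φ i)
    calc _ = ∑ a, ad G' b a * ((if P' a < P' b then X (P' a) (P' b) else 0) * φ (P' a)) := by
          refine Finset.sum_congr rfl fun a _ => ?_
          simp only [x]; rw [ad_symm G' b a]; split_ifs <;> ring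
      _ = _ := by
          rw [this]
          refine Finset.sum_congr rfl fun j _ => ?_
          rw [← hXM, hMs j (P' b)]
          split_ifs <;> ring
  have hsl : ∀ (z : V' × V' → ℝ) a j, ∑ e : V' × V', (if (e.1, P' e.2) = (a, j) then z e else 0) = ∑ b, z (a, b) * (if P' b = j then 1 else 0) := by
    intro z a j
    rw [Fintype.sum_prod_type, Finset.sum_eq_single a]
    · refine Finset.sum_congr rfl fun b _ => ?_
      by_cases h : P' b = j <;> simp [h]
    · intro a' _ ha'
      refine Finset.sum_eq_zero fun b _ => ?_
      simp [ha']
    · simp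
  have hsr : ∀ (z : V' × V' → ℝ) b i, ∑ e : V' × V', (if (e.2, P' e.1) = (b, i) then z e else 0) = ∑ a, z (a, b) * (if P' a = i then 1 else 0) := by
    intro z b i
    rw [Fintype.sum_prod_type_right, Finset.sum_eq_single b]
    · refine Finset.sum_congr rfl fun a _ => ?_
      by_cases h : P' a = i <;> simp [h]
    · intro a' _ ha'
      refine Finset.sum_eq_zero fun b _ => ?_
      simp [ha']
    · simp
  obtain ⟨y, U, W, hy01, hyS, hyl, hyr, hU, hW, herr⟩ := rounding_supp S (fun e => (e.1, P' e.2)) (fun e => (e.2, P' e.1))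
    (fun e => (p e.1, p e.2)) x (by
      rintro ⟨a, b⟩
      simp only [x]
      split_ifs
      · have h1 := ad_nonneg G' a b
        exact ⟨mul_nonneg h1 (hX0 _ _), mul_le_one₀ (had1 a b) (hX0 _ _) (hX1 _ _)⟩
      · exact ⟨le_rfl, zero_le_one⟩) (by
      rintro ⟨a, b⟩ he
      simp only [S, not_and] at he
      simp only [x]
      split_ifs with h
      · have : ¬ G'.Adj a b := fun h1 => he h1 h
        simp [ad, this]
      · rfl) (by
      rintro ⟨a, j⟩
      rw [hsl, hxl a (fun i => if i = j then 1 else 0)]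
      simp only [mul_ite, mul_one, mul_zero, Finset.sum_ite_eq', mem_univ, if_true]
      split_ifs
      · exact hDint _ _
      · exact ⟨0, by simp⟩) (by
      rintro ⟨b, i⟩
      rw [hsr, hxr b (fun j => if j = i then 1 else 0)]
      simp only [mul_ite, mul_one, mul_zero, Finset.sum_ite_eq', mem_univ, if_true]
      split_ifs
      · exact hDint _ _
      · exact ⟨0, by simp⟩)
  have hyl' : ∀ a (φ : Fin k → ℝ), ∑ b, y (a, b) * φ (P' b) = ∑ j, (if P' a < j then Dr (P' a) j else 0) * φ j := by
    intro a φ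
    rw [← hxl a φ, fib_sum P' (fun b => y (a, b)) φ, fib_sum P' (fun b => x (a, b)) φ]
    refine Finset.sum_congr rfl fun j _ => ?_
    have := hyl (a, j)
    rw [hsl, hsl] at this
    simp only [mul_ite, mul_one, mul_zero] at this
    rw [this]
  have hyr' : ∀ b (φ : Fin k → ℝ), ∑ a, y (a, b) * φ (P' a) = ∑ i, (if i < P' b then Dr i (P' b) else 0) * φ i := by
    intro b φ
    rw [← hxr b φ, fib_sum P' (fun a => y (a, b)) φ, fib_sum P' (fun a => x (a, b)) φ]
    refine Finset.sum_congr rfl fun j _ => ?_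
    have := hyr (b, j)
    rw [hsr, hsr] at this
    simp only [mul_ite, mul_one, mul_zero] at this
    rw [this]
  obtain ⟨OL, hOL⟩ : ∃ OL : V → V → ℝ, OL = fun u v => (#(U.filter fun e => (p e.1, p e.2) = (u, v)) : ℝ) := ⟨_, rfl⟩
  obtain ⟨OR, hOR⟩ : ∃ OR : V → V → ℝ, OR = fun u v => (#(W.filter fun e => (p e.1, p e.2) = (u, v)) : ℝ) := ⟨_, rfl⟩
  have herr' : ∀ u v, |∑ e : V' × V', (if (p e.1, p e.2) = (u, v) then y e - x e else 0)| ≤ 1 + OL u v + OR u v := by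
    intro u v
    rw [hOL, hOR]
    exact herr (u, v)
  have hOL0 : ∀ u v, 0 ≤ OL u v := fun u v => by rw [hOL]; positivity
  have hOR0 : ∀ u v, 0 ≤ OR u v := fun u v => by rw [hOR]; positivity
  have hOL1 : ∀ u (φ : Fin k → ℝ), (∀ i, 0 ≤ φ i) → ∑ v, OL u v * φ (P v) ≤ N * ∑ i, φ i := by
    intro u φ hφ
    rw [hOL]
    exact inj_count U p P N hp hU u φ hφ
  have hOR1 : ∀ v (φ : Fin k → ℝ), (∀ i, 0 ≤ φ i) → ∑ u, OR u v * φ (P u) ≤ N * ∑ i, φ i := by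
    intro u φ hφ
    rw [hOR]
    exact inj_count2 W p P N hp hW u φ hφ
  clear hOL hOR herr hU hW
  refine ⟨fun a b => y (a, b) + y (b, a), OL, OR, fun a b => add_comm _ _, ?_, ?_, hOL0, hOR0, hOL1, hOR1, ?_⟩
  · intro a b
    by_cases h1 : S (a, b)
    · have h2 : ¬ S (b, a) := fun h => lt_asymm h1.2 h.2
      simp only [hyS _ h2, add_zero]
      rcases hy01 (a, b) with h | h
      · exact Or.inl h
      · exact Or.inr ⟨h, h1.1⟩
    · simp only [hyS _ h1, zero_add]
      by_cases h2 : S (b, a)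
      · rcases hy01 (b, a) with h | h
        · exact Or.inl h
        · exact Or.inr ⟨h, h2.1.symm⟩
      · exact Or.inl (hyS _ h2)
  · intro a φ
    change ∑ b, (y (a, b) + y (b, a)) * φ (P' b) = ∑ j, Dr (P' a) j * φ j
    simp only [add_mul, Finset.sum_add_distrib]
    rw [hyl' a φ, hyr' a φ, ← Finset.sum_add_distrib]
    refine Finset.sum_congr rfl fun j _ => ?_
    rcases lt_trichotomy (P' a) j with h | h | h
    · simp [h, not_lt.2 h.le]
    · simp [← h, hD00]
    · simp [h, not_lt.2 h.le, hDs j]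
  · intro g
    have hxx : ∀ a b, X (P' a) (P' b) * ad G' a b = x (a, b) + x (b, a) := by
      intro a b
      simp only [x]
      rcases lt_trichotomy (P' a) (P' b) with h | h | h
      · simp [h, not_lt.2 h.le]; ring
      · have : X (P' b) (P' b) = 0 := by simp [X, hD00]
        simp [h, this]
      · simp [h, not_lt.2 h.le, hXs (P' b), ad_symm G' b a]; ring
    have e1 : qf (fun a b => y (a, b) + y (b, a) - Dr (P (p a)) (P (p b)) / M (P (p a)) (P (p b)) * ad G' a b) (fun a => g (p a)) (fun a => g (p a))
        = 2 * ∑ e : V' × V', (y e - x e) * (g (p e.1) * g (p e.2)) := by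
      have e2 : qf (fun a b => y (a, b) + y (b, a) - Dr (P (p a)) (P (p b)) / M (P (p a)) (P (p b)) * ad G' a b) (fun a => g (p a)) (fun a => g (p a))
        = ∑ a, ∑ b, (y (a, b) - x (a, b)) * (g (p a) * g (p b)) + ∑ a, ∑ b, (y (b, a) - x (b, a)) * (g (p b) * g (p a)) := by
        unfold qf
        simp only [← Finset.sum_add_distrib]
        refine Finset.sum_congr rfl fun a _ => Finset.sum_congr rfl fun b _ => ?_
        have := hxx a b
        change (y (a, b) + y (b, a) - X (P' a) (P' b) * ad G' a b) * _ * _ = _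
        rw [this]; ring
      have e3 : ∑ a, ∑ b, (y (b, a) - x (b, a)) * (g (p b) * g (p a)) = ∑ a, ∑ b, (y (a, b) - x (a, b)) * (g (p a) * g (p b)) := Finset.sum_comm
      rw [e2, e3, Fintype.sum_prod_type]; ring
    have e4 : ∑ e : V' × V', (y e - x e) * (g (p e.1) * g (p e.2))
        = ∑ γ : V × V, (∑ e : V' × V', if (p e.1, p e.2) = γ then y e - x e else 0) * (g γ.1 * g γ.2) :=
      fib_sum (fun e : V' × V' => (p e.1, p e.2)) (fun e => y e - x e) (fun γ => g γ.1 * g γ.2)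
    rw [e1, e4, abs_mul, abs_of_pos (by norm_num : (0:ℝ) < 2)]
    refine mul_le_mul_of_nonneg_left ?_ (by norm_num)
    rw [← Fintype.sum_prod_type']
    refine (Finset.abs_sum_le_sum_abs _ _).trans (Finset.sum_le_sum fun γ _ => ?_)
    rw [abs_mul, abs_mul]
    refine mul_le_mul_of_nonneg_right ?_ (by positivity)
    obtain ⟨u, v⟩ := γ
    by_cases huv : G.Adj u v
    · have : ad G u v = 1 := by simp [ad, huv]
      simp only [this, one_mul]
      exact herr' u v
    · have h0 : ad G u v = 0 := by simp [ad, huv]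
      simp only [h0, zero_mul]
      have : ∑ e : V' × V', (if (p e.1, p e.2) = (u, v) then y e - x e else 0) = 0 := by
        refine Finset.sum_eq_zero fun e _ => ?_
        split_ifs with h
        · have hS : ¬ G'.Adj e.1 e.2 := by
            intro hadj
            have h1 := hcov e.1 (fun w => if w = v then 1 else 0)
            simp only [mul_ite, mul_one, mul_zero, Finset.sum_ite_eq', mem_univ, if_true] at h1
            rw [Prod.mk.injEq] at h
            rw [h.1, h0] at h1
            have h2 := (Finset.sum_eq_zero_iff_of_nonneg (fun b _ => by
              split_ifs
              · exact ad_nonneg _ _ _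
              · exact le_rfl)).1 h1 e.2 (mem_univ _)
            simp [h.2, ad, hadj] at h2
          have hSS : ¬ S e := fun h => hS h.1
          have : x e = 0 := by simp [x, ad, hS]
          rw [hyS e hSS, this]; simp
        · rfl
      rw [this]; simp

end partP4c

section partP4d

set_option linter.unusedSimpArgs false
set_option linter.unusedSectionVars false
open Finset Matrix

section
variable {k : ℕ} {M : Matrix (Fin k) (Fin k) ℕ} {M' : Matrix (Fin k) (Fin k) ℤ} {β : ℝ}

theorem natToReal_symm (hM : MemM M M' β) : (natToReal M).IsSymm := by
  ext i j
  simp [natToReal, hM.symm.apply i j]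

theorem intToReal_symm (hM : MemM M M' β) : (intToReal M').IsSymm := by
  ext i j
  simp [intToReal, hM.signMatrix.1.apply i j]

theorem DMat_apply (i j : Fin k) : DMat M M' i j = ((M i j : ℝ) - (M' i j : ℝ)) / 2 := by
  simp [DMat, natToReal, intToReal]; ring

theorem DMat_symm (hM : MemM M M' β) : (DMat M M').IsSymm := by
  ext i j
  simp only [transpose_apply, DMat_apply]
  rw [hM.symm.apply i j, hM.signMatrix.1.apply i j]

theorem DMat_nonneg (hM : MemM M M' β) (i j : Fin k) : 0 ≤ DMat M M' i j := by
  rw [DMat_apply]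
  have h := (abs_le.1 (hM.signMatrix.2 i j).2).2
  have : (M' i j : ℝ) ≤ (M i j : ℝ) := by exact_mod_cast h
  linarith

theorem DMat_le (hM : MemM M M' β) (i j : Fin k) : DMat M M' i j ≤ natToReal M i j := by
  rw [DMat_apply]
  have h := (abs_le.1 (hM.signMatrix.2 i j).2).1
  have : (-(M i j : ℝ)) ≤ (M' i j : ℝ) := by exact_mod_cast h
  simp only [natToReal, of_apply]
  linarith

theorem DMat_int (hM : MemM M M' β) (i j : Fin k) : ∃ n : ℤ, DMat M M' i j = n := by
  rw [DMat_apply]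
  obtain ⟨n, hn⟩ := (hM.signMatrix.2 i j).1
  refine ⟨-n, ?_⟩
  have : (M' i j : ℝ) - (M i j : ℝ) = 2 * n := by exact_mod_cast hn
  push_cast
  linarith

theorem row_sqrt (hM : MemM M M' β) (i : Fin k) : ∑ j, Real.sqrt (natToReal M i j) ≤ sigmaM M / 2 := by
  have h : ∀ i', (if i' = i then ∑ j, Real.sqrt (M i j : ℝ) else 0) + Real.sqrt (M i' i : ℝ) ≤ ∑ j, Real.sqrt (M i' j : ℝ) := by
    intro i'
    split_ifs with hi
    · subst hi
      simp [hM.diag]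
    · rw [zero_add]
      exact Finset.single_le_sum (f := fun j => Real.sqrt (M i' j : ℝ)) (fun _ _ => Real.sqrt_nonneg _) (mem_univ i)
  have h2 := Finset.sum_le_sum (s := (univ : Finset (Fin k))) fun i' _ => h i'
  rw [Finset.sum_add_distrib] at h2
  simp only [Finset.sum_ite_eq', mem_univ, if_true] at h2
  have h3 : ∑ i', Real.sqrt (M i' i : ℝ) = ∑ j, Real.sqrt (M i j : ℝ) :=
    Finset.sum_congr rfl fun j _ => by rw [hM.symm.apply i j]
  rw [h3] at h2
  simp only [natToReal, of_apply]
  unfold sigmaM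
  linarith

theorem sigma_nonneg : 0 ≤ sigmaM M := Finset.sum_nonneg fun _ _ => Finset.sum_nonneg fun _ _ => Real.sqrt_nonneg _

theorem natToReal_nonneg (i j : Fin k) : 0 ≤ natToReal M i j := by simp [natToReal]

theorem deg_bound (hM : MemM M M' β) (i : Fin k) : ∑ j, natToReal M i j ≤ (sigmaM M / 2) ^ 2 := by
  calc ∑ j, natToReal M i j = ∑ j, Real.sqrt (natToReal M i j) ^ 2 :=
        Finset.sum_congr rfl fun j _ => (Real.sq_sqrt (natToReal_nonneg i j)).symm
    _ ≤ (∑ j, Real.sqrt (natToReal M i j)) ^ 2 := Finset.sum_sq_le_sq_sum_of_nonneg fun _ _ => Real.sqrt_nonneg _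
    _ ≤ _ := by
        have := row_sqrt hM i
        have h0 : 0 ≤ ∑ j, Real.sqrt (natToReal M i j) := Finset.sum_nonneg fun _ _ => Real.sqrt_nonneg _
        gcongr

theorem eig2 (hM : MemM M M' β) (x y : ℝ) :
    ((1 - 2 * β) * lam (intToReal M') 1 +
             2 * lam (absMat (DMat M M' - β • natToReal M)) 1 + 7 * sigmaM M) * x ^ 2 + 2 * (2 * lam (DMat M M') 1) * (x * y)
      + (2 * lam (DMat M M') 1 + sigmaM M) * y ^ 2 ≤ lam (intToReal M') 1 * (x ^ 2 + y ^ 2) := by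
  have h := L1 !![(1 - 2 * β) * lam (intToReal M') 1 +
             2 * lam (absMat (DMat M M' - β • natToReal M)) 1 + 7 * sigmaM M,
           2 * lam (DMat M M') 1;
           2 * lam (DMat M M') 1,
           2 * lam (DMat M M') 1 + sigmaM M] (by ext i j; fin_cases i <;> fin_cases j <;> rfl) ![x, y]
  have h2 := hM.eig_cond
  have h3 := h.trans (mul_le_mul_of_nonneg_right h2 (Finset.sum_nonneg fun _ _ => sq_nonneg _))
  simp [qf, Fin.sum_univ_two] at h3
  linarith

variable {V : Type} [Fintype V] {G : SimpleGraph V} {P : V → Fin k}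

theorem err_one (hM : MemM M M' β) (hP : Equit (ad G) P (natToReal M)) (N : ℝ) (O : V → V → ℝ) (hO0 : ∀ u v, 0 ≤ O u v)
    (hO : ∀ u (φ : Fin k → ℝ), (∀ i, 0 ≤ φ i) → ∑ v, O u v * φ (P v) ≤ N * ∑ i, φ i) (hN : 0 ≤ N) (g : V → ℝ) :
    ∑ u, ∑ v, ad G u v * O u v * (|g u| * |g v|) ≤ N * sigmaM M / 2 * ∑ u, g u ^ 2 := by
  have hON : ∀ u v, O u v ≤ N := by
    intro u v
    have h := hO u (fun i => if i = P v then 1 else 0) (fun i => by split_ifs <;> norm_num)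
    simp only [Finset.sum_ite_eq', mem_univ, if_true, mul_one] at h
    refine le_trans ?_ h
    have := Finset.single_le_sum (f := fun b => O u b * if P b = P v then 1 else 0) (fun b _ => mul_nonneg (hO0 u b) (by split_ifs <;> norm_num)) (mem_univ v)
    simpa using this
  have hadM : ∀ u v, ad G u v ≤ natToReal M (P u) (P v) := by
    intro u v
    have h := hP u (fun i => if i = P v then 1 else 0)
    simp only [mul_ite, mul_one, mul_zero, Finset.sum_ite_eq', mem_univ, if_true] at h
    rw [← h]
    have := Finset.single_le_sum (f := fun b => if P b = P v then ad G u b else 0) (fun b _ => by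
      split_ifs
      · exact ad_nonneg _ _ _
      · exact le_rfl) (mem_univ v)
    simpa using this
  let q : Fin k → Fin k → ℝ := fun i j => Real.sqrt (natToReal M i j)
  have hq0 : ∀ i j, 0 ≤ q i j := fun i j => Real.sqrt_nonneg _
  have hqs : ∀ i j, q i j = q j i := fun i j => by simp only [q]; rw [(natToReal_symm hM).apply]
  have key : ∀ u v, ad G u v * O u v * (|g u| * |g v|) ≤ (O u v * q (P u) (P v)) * (g u ^ 2 / 2) + (ad G v u * (1 / q (P v) (P u))) * (N * g v ^ 2 / 2) := by
    intro u v
    rw [ad_symm G v u, hqs (P v) (P u)]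
    by_cases hadj : G.Adj u v
    · have h1 : ad G u v = 1 := by simp [ad, hadj]
      have h2 := hadM u v
      rw [h1] at h2
      have hq : 0 < q (P u) (P v) := Real.sqrt_pos.2 (by linarith)
      rw [h1]
      set s := q (P u) (P v)
      have h3 : |g u| * |g v| ≤ s * (g u ^ 2 / 2) + 1 / s * (g v ^ 2 / 2) := by
        have : s * (g u ^ 2 / 2) + 1 / s * (g v ^ 2 / 2) - |g u| * |g v| = (s * |g u| - |g v|) ^ 2 / (2 * s) := by
          rw [← sq_abs (g u), ← sq_abs (g v)]; field_simp; ring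
        have h4 : 0 ≤ (s * |g u| - |g v|) ^ 2 / (2 * s) := by positivity
        linarith
      have h5 := mul_le_mul_of_nonneg_left h3 (hO0 u v)
      have h6 : O u v * (1 / s * (g v ^ 2 / 2)) ≤ N * (1 / s * (g v ^ 2 / 2)) :=
        mul_le_mul_of_nonneg_right (hON u v) (by positivity)
      linarith
    · have h1 : ad G u v = 0 := by simp [ad, hadj]
      rw [h1]
      have := mul_nonneg (mul_nonneg (hO0 u v) (hq0 (P u) (P v))) (by positivity : 0 ≤ g u ^ 2 / 2)
      linarith
  have s1 : ∑ u, ∑ v, (O u v * q (P u) (P v)) * (g u ^ 2 / 2) ≤ ∑ u, (N * (sigmaM M / 2)) * (g u ^ 2 / 2) := by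
    refine Finset.sum_le_sum fun u _ => ?_
    rw [← Finset.sum_mul]
    refine mul_le_mul_of_nonneg_right ?_ (by positivity)
    exact (hO u (q (P u)) (hq0 _)).trans (mul_le_mul_of_nonneg_left (row_sqrt hM _) hN)
  have s2 : ∑ u, ∑ v, (ad G v u * (1 / q (P v) (P u))) * (N * g v ^ 2 / 2) ≤ ∑ v, (sigmaM M / 2) * (N * g v ^ 2 / 2) := by
    rw [Finset.sum_comm]
    refine Finset.sum_le_sum fun v _ => ?_
    rw [← Finset.sum_mul]
    refine mul_le_mul_of_nonneg_right ?_ (by positivity)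
    have := hP v (fun i => 1 / q (P v) i)
    rw [this]
    refine le_trans (le_of_eq (Finset.sum_congr rfl fun j _ => ?_)) (row_sqrt hM (P v))
    rw [mul_one_div]
    exact Real.div_sqrt
  calc _ ≤ ∑ u, ∑ v, ((O u v * q (P u) (P v)) * (g u ^ 2 / 2) + (ad G v u * (1 / q (P v) (P u))) * (N * g v ^ 2 / 2)) :=
        Finset.sum_le_sum fun u _ => Finset.sum_le_sum fun v _ => key u v
    _ ≤ ∑ u, (N * (sigmaM M / 2)) * (g u ^ 2 / 2) + ∑ v, (sigmaM M / 2) * (N * g v ^ 2 / 2) := by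
        simp only [Finset.sum_add_distrib]
        exact add_le_add s1 s2
    _ = _ := by
        rw [← Finset.sum_add_distrib, Finset.mul_sum]
        exact Finset.sum_congr rfl fun _ _ => by ring

theorem err_all (hM : MemM M M' β) (hP : Equit (ad G) P (natToReal M)) (N : ℝ) (hN : (Fintype.card V : ℝ) ≤ N)
    (OL OR : V → V → ℝ) (hL0 : ∀ u v, 0 ≤ OL u v) (hR0 : ∀ u v, 0 ≤ OR u v)
    (hL : ∀ u (φ : Fin k → ℝ), (∀ i, 0 ≤ φ i) → ∑ v, OL u v * φ (P v) ≤ N * ∑ i, φ i)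
    (hR : ∀ v (φ : Fin k → ℝ), (∀ i, 0 ≤ φ i) → ∑ u, OR u v * φ (P u) ≤ N * ∑ i, φ i) (g : V → ℝ) :
    2 * ∑ u, ∑ v, ad G u v * (1 + OL u v + OR u v) * (|g u| * |g v|) ≤ 3 * (N * sigmaM M * ∑ u, g u ^ 2) := by
  have hN0 : 0 ≤ N := le_trans (Nat.cast_nonneg _) hN
  have a1 := err_one hM hP N (fun _ _ => 1) (fun _ _ => zero_le_one) (fun u φ hφ => by
    have : ∑ v : V, 1 * φ (P v) ≤ ∑ v : V, ∑ i, φ i := Finset.sum_le_sum fun v _ => by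
      rw [one_mul]; exact Finset.single_le_sum (fun i _ => hφ i) (mem_univ _)
    refine this.trans ?_
    rw [Finset.sum_const, nsmul_eq_mul, Finset.card_univ]
    exact mul_le_mul_of_nonneg_right hN (Finset.sum_nonneg fun i _ => hφ i)) hN0 g
  have a2 := err_one hM hP N OL hL0 hL hN0 g
  have a3 := err_one hM hP N (fun u v => OR v u) (fun u v => hR0 v u) hR hN0 g
  have e3 : ∑ u, ∑ v, ad G u v * OR v u * (|g u| * |g v|) = ∑ u, ∑ v, ad G u v * OR u v * (|g u| * |g v|) := by
    rw [Finset.sum_comm]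
    exact Finset.sum_congr rfl fun u _ => Finset.sum_congr rfl fun v _ => by rw [ad_symm]; ring
  rw [e3] at a3
  have e : ∑ u, ∑ v, ad G u v * (1 + OL u v + OR u v) * (|g u| * |g v|) = ∑ u, ∑ v, ad G u v * 1 * (|g u| * |g v|)
     + ∑ u, ∑ v, ad G u v * OL u v * (|g u| * |g v|) + ∑ u, ∑ v, ad G u v * OR u v * (|g u| * |g v|) := by
    simp only [← Finset.sum_add_distrib]
    exact Finset.sum_congr rfl fun u _ => Finset.sum_congr rfl fun v _ => by ring
  rw [e]
  linarith

theorem lamD_nonneg [Nonempty (Fin k)] (hM : MemM M M' β) : 0 ≤ lam (DMat M M') 1 := by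
  have := L1 (DMat M M') (DMat_symm hM) (fun _ => 1)
  have h2 : 0 ≤ qf (DMat M M') (fun _ => 1) (fun _ => 1) := Finset.sum_nonneg fun i _ => Finset.sum_nonneg fun j _ => by
    have := DMat_nonneg hM i j
    simpa
  have h3 := h2.trans this
  simp only [one_pow, Finset.sum_const, nsmul_eq_mul, mul_one] at h3
  have : (0:ℝ) < (#(univ : Finset (Fin k)) : ℝ) := by
    rw [Nat.cast_pos, Finset.card_pos]; exact Finset.univ_nonempty
  by_contra hlt
  push Not at hlt
  nlinarith

theorem sigma_le (hM : MemM M M' β) [Nonempty (Fin k)] : 2 * lam (DMat M M') 1 + sigmaM M ≤ lam (intToReal M') 1 := by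
  have := eig2 hM 0 1
  simpa using this

theorem sigma_le' (hM : MemM M M' β) [Nonempty (Fin k)] : sigmaM M ≤ lam (intToReal M') 1 := by
  have := sigma_le hM
  have := lamD_nonneg hM
  linarith

theorem signing (hM : MemM M M' β) [Nonempty (Fin k)] (hP : Equit (ad G) P (natToReal M))
    (hgood : ∀ f, Orth P f → qf (ad G) f f ≤ lam (intToReal M') 1 * ∑ a, f a ^ 2)
    {V' : Type} [Fintype V'] (G' : SimpleGraph V') (p : V' → V) (hcov : Equit (ad G') p (ad G)) (N : ℝ)
    (hp : Unif p N) (hN : (Fintype.card V : ℝ) ≤ N)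
    (hnew : ∀ f, Orth p f → qf (ad G') f f ≤ sigmaM M * ∑ a, f a ^ 2) :
    ∃ s : V' → V' → Bool, (∀ a b, s a b = s b a) ∧ Equit (fun a b => ad G' a b * sg (s a b)) (P ∘ p) (intToReal M') ∧
      ∀ h, qf (fun a b => ad G' a b * sg (s a b)) h h ≤ lam (intToReal M') 1 * ∑ a, h a ^ 2 := by
  classical
  set lm := lam (intToReal M') 1 with hlm
  set ld := lam (DMat M M') 1 with hld
  set gm := lam (absMat (DMat M M' - β • natToReal M)) 1 with hgm
  set σ := sigmaM M with hσ
  obtain ⟨H, OL, OR, hHs, hH01, hHD, hL0, hR0, hL, hR, herr⟩ := H_ex G' G p P (natToReal M) (DMat M M') N hcov hP hp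
    (fun i j => (DMat_symm hM).apply j i) (fun i j => (natToReal_symm hM).apply j i) (DMat_nonneg hM) (DMat_le hM)
    (fun i => by simp [natToReal, hM.diag]) (DMat_int hM)
  have hP' : Equit (ad G') (P ∘ p) (natToReal M) := hcov.comp hP
  refine ⟨fun a b => decide (H a b = 1), fun a b => by simp only [hHs a b], ?_⟩
  have hS : (fun a b => ad G' a b * sg (decide (H a b = 1))) = fun a b => ad G' a b - 2 * H a b := by
    funext a b
    rcases hH01 a b with h | ⟨h, h2⟩
    · simp [h, sg]
    · simp [h, sg, ad, h2]; norm_num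
  rw [hS]
  set S : V' → V' → ℝ := fun a b => ad G' a b - 2 * H a b with hSdef
  have hSs : ∀ a b, S a b = S b a := fun a b => by simp only [S]; rw [ad_symm, hHs]
  have hSE : Equit S (P ∘ p) (intToReal M') := by
    intro a φ
    have h1 := hP' a φ
    have h2 := hHD a φ
    have : ∑ b, S a b * φ ((P ∘ p) b) = ∑ b, ad G' a b * φ ((P ∘ p) b) - 2 * ∑ b, H a b * φ ((P ∘ p) b) := by
      rw [Finset.mul_sum, ← Finset.sum_sub_distrib]
      exact Finset.sum_congr rfl fun b _ => by simp only [S]; ring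
    rw [this, h1, h2, Finset.mul_sum, ← Finset.sum_sub_distrib]
    refine Finset.sum_congr rfl fun j _ => ?_
    rw [DMat_apply]; simp only [natToReal, intToReal, of_apply]; ring
  refine ⟨hSE, fun h => ?_⟩
  have hqS : ∀ f g, qf S f g = qf (ad G') f g - 2 * qf H f g := by
    intro f g
    unfold qf
    simp only [Finset.mul_sum, ← Finset.sum_sub_distrib]
    exact Finset.sum_congr rfl fun a _ => Finset.sum_congr rfl fun b _ => by simp only [S]; ring
  have hH0 : ∀ a b, 0 ≤ H a b := fun a b => by rcases hH01 a b with h | ⟨h, _⟩ <;> simp [h]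
  have hHb : ∀ f, |qf H f f| ≤ ld * ∑ a, f a ^ 2 := liftBound' hH0 hHs (DMat_symm hM) hHD
  obtain ⟨g₀, hz⟩ := proj_ex p h
  set z : V' → ℝ := fun a => h a - g₀ (p a) with hzdef
  obtain ⟨w, hg⟩ := proj_ex P g₀
  set g : V → ℝ := fun v => g₀ v - w (P v) with hgdef
  have hN0 : 0 ≤ N := le_trans (Nat.cast_nonneg _) hN
  have hzP : Orth (P ∘ p) z := fun φ => hz (fun v => φ (P v))
  have hgP : Orth (P ∘ p) (fun a => g (p a)) := by
    intro φ
    have := hp (fun v => g v * φ (P v))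
    simp only [Function.comp]
    rw [this, hg φ, mul_zero]
  have hhs : h = fun a => (w ((P ∘ p) a)) + (g (p a) + z a) := by
    funext a; simp only [z, g, Function.comp]; ring
  have hgzP : Orth (P ∘ p) (fun a => g (p a) + z a) := by
    intro φ
    have h1 := hgP φ
    have h2 := hzP φ
    simp only [add_mul, Finset.sum_add_distrib]
    rw [h1, h2, add_zero]
  have hsq : ∑ a, h a ^ 2 = ∑ a, w ((P ∘ p) a) ^ 2 + (∑ a, g (p a) ^ 2 + ∑ a, z a ^ 2) := by
    rw [hhs, pyth (P ∘ p) _ hgzP w, pyth p z hz g]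
  have hqw : qf S h h = qf S (fun a => w ((P ∘ p) a)) (fun a => w ((P ∘ p) a)) + (qf S (fun a => g (p a)) (fun a => g (p a)) + 2 * qf S (fun a => g (p a)) z + qf S z z) := by
    rw [hhs, qf_add hSs, qf_symm hSs (fun a => w ((P ∘ p) a)) (fun a => g (p a) + z a), qf_equit_orth hSE _ hgzP, qf_add hSs]
    ring
  have b1 := constBound hSs (intToReal_symm hM) hSE w
  -- g part
  have hgN : ∑ a, g (p a) ^ 2 = N * ∑ v, g v ^ 2 := hp (fun v => g v ^ 2)
  have b2 : qf S (fun a => g (p a)) (fun a => g (p a)) ≤ ((1 - 2 * β) * lm + 2 * gm + 7 * σ) * ∑ a, g (p a) ^ 2 := by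
    let X : V' → V' → ℝ := fun a b => DMat M M' (P (p a)) (P (p b)) / natToReal M (P (p a)) (P (p b))
    have e1 : qf S (fun a => g (p a)) (fun a => g (p a)) = (1 - 2 * β) * qf (ad G') (fun a => g (p a)) (fun a => g (p a))
        + 2 * qf (fun a b => (β - X a b) * ad G' a b) (fun a => g (p a)) (fun a => g (p a))
        - 2 * qf (fun a b => H a b - X a b * ad G' a b) (fun a => g (p a)) (fun a => g (p a)) := by
      unfold qf
      simp only [Finset.mul_sum, ← Finset.sum_sub_distrib, ← Finset.sum_add_distrib]
      exact Finset.sum_congr rfl fun a _ => Finset.sum_congr rfl fun b _ => by simp only [S]; ring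
    have e2 : qf (ad G') (fun a => g (p a)) (fun a => g (p a)) ≤ lm * (N * ∑ v, g v ^ 2) := by
      rw [qf_equit hcov, hp (fun u => g u * ∑ v, ad G u v * g v)]
      have : ∑ u, g u * ∑ v, ad G u v * g v = qf (ad G) g g := by
        unfold qf
        simp only [Finset.mul_sum]
        exact Finset.sum_congr rfl fun a _ => Finset.sum_congr rfl fun b _ => by ring
      rw [this]
      have := mul_le_mul_of_nonneg_left (hgood g hg) hN0
      linarith
    have e3 : qf (fun a b => (β - X a b) * ad G' a b) (fun a => g (p a)) (fun a => g (p a)) ≤ gm * (N * ∑ v, g v ^ 2) := by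
      rw [← hgN]
      have hb := liftBound (K := fun a b => |β - X a b| * ad G' a b) (P := P ∘ p) (Q := absMat (DMat M M' - β • natToReal M))
        (fun a b => mul_nonneg (abs_nonneg _) (ad_nonneg _ _ _)) (fun a b => by
          simp only [X]
          rw [ad_symm, (DMat_symm hM).apply, (natToReal_symm hM).apply]) (by
          ext i j
          simp only [absMat, transpose_apply, of_apply, Matrix.sub_apply, Matrix.smul_apply]
          rw [(DMat_symm hM).apply, (natToReal_symm hM).apply]) (by
          intro a φ
          have := hP' a (fun j => |β - DMat M M' (P (p a)) j / natToReal M (P (p a)) j| * φ j)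
          calc _ = ∑ b, ad G' a b * (|β - DMat M M' (P (p a)) ((P ∘ p) b) / natToReal M (P (p a)) ((P ∘ p) b)| * φ ((P ∘ p) b)) :=
                Finset.sum_congr rfl fun b _ => by simp only [X, Function.comp]; ring
            _ = _ := by
                rw [this]
                refine Finset.sum_congr rfl fun j _ => ?_
                rw [← mul_assoc]
                congr 1
                simp only [absMat, of_apply, Matrix.sub_apply, Matrix.smul_apply, smul_eq_mul, Function.comp]
                have hm := natToReal_nonneg (M := M) (P (p a)) j
                by_cases h0 : natToReal M (P (p a)) j = 0
                · have d1 := DMat_nonneg hM (P (p a)) j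
                  have d2 := DMat_le hM (P (p a)) j
                  have d3 : DMat M M' (P (p a)) j = 0 := by linarith
                  simp [h0, d3]
                · nth_rewrite 1 [← abs_of_nonneg hm]
                  rw [← abs_mul, mul_sub, mul_div_cancel₀ _ h0, abs_sub_comm, mul_comm]) (fun a => g (p a))
      refine le_trans ?_ hb
      unfold qf
      refine Finset.sum_le_sum fun a _ => Finset.sum_le_sum fun b _ => ?_
      refine (le_abs_self _).trans (le_of_eq ?_)
      rw [abs_mul, abs_mul, abs_mul, abs_of_nonneg (ad_nonneg G' a b)]
    have e4 := (herr g).trans (err_all hM hP N hN OL OR hL0 hR0 hL hR g)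
    have e5 := (abs_le.1 e4).1
    change -(3 * (N * σ * ∑ u, g u ^ 2)) ≤ qf (fun a b => H a b - X a b * ad G' a b) (fun a => g (p a)) (fun a => g (p a)) at e5
    rw [e1, hgN]
    have hb1 : 0 ≤ 1 - 2 * β := by have := hM.beta_mem.2; linarith
    have := mul_le_mul_of_nonneg_left e2 hb1
    have hpos : 0 ≤ N * σ * ∑ u, g u ^ 2 := mul_nonneg (mul_nonneg hN0 sigma_nonneg) (Finset.sum_nonneg fun _ _ => sq_nonneg _)
    nlinarith
  have hsg0 : 0 ≤ ∑ a, g (p a) ^ 2 := Finset.sum_nonneg fun _ _ => sq_nonneg _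
  have hsz0 : 0 ≤ ∑ a, z a ^ 2 := Finset.sum_nonneg fun _ _ => sq_nonneg _
  set x := Real.sqrt (∑ a, g (p a) ^ 2) with hx
  set y := Real.sqrt (∑ a, z a ^ 2) with hy
  have hx2 : ∑ a, g (p a) ^ 2 = x ^ 2 := (Real.sq_sqrt hsg0).symm
  have hy2 : ∑ a, z a ^ 2 = y ^ 2 := (Real.sq_sqrt hsz0).symm
  have b3 : qf S (fun a => g (p a)) z ≤ 2 * ld * (x * y) := by
    rw [hqS, qf_symm (ad_symm G'), qf_equit_orth hcov z hz g]
    have := bilin hHs ld hHb (fun a => g (p a)) z x y (Real.sqrt_nonneg _) (Real.sqrt_nonneg _) hx2 hy2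
    have := (abs_le.1 this).1
    linarith
  have b4 : qf S z z ≤ (2 * ld + σ) * ∑ a, z a ^ 2 := by
    rw [hqS]
    have h1 := hnew z hz
    have h2 := (abs_le.1 (hHb z)).1
    linarith
  have h5 := eig2 hM x y
  rw [hqw, hsq]
  rw [hx2] at b2 ⊢
  rw [hy2] at b4 ⊢
  rw [← hlm, ← hld, ← hgm, ← hσ] at h5
  rw [← hlm] at b1
  linarith
end

end partP4d

section partP5

set_option linter.unusedSimpArgs false
set_option linter.unusedSectionVars false
open Finset Matrix

structure StV {V : Type} [Fintype V] {k : ℕ} (M : Matrix (Fin k) (Fin k) ℕ) (μ : ℝ) (v : Fin k → ℝ)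
    (G : SimpleGraph V) (P : V → Fin k) (i : ℕ) : Prop where
  lift : Equit (ad G) P (natToReal M)
  surj : Function.Surjective P
  good : ∀ f, Orth P f → qf (ad G) f f ≤ μ * ∑ a, f a ^ 2
  goodW : ∀ w : Fin k → ℝ, ∑ a, v (P a) * w (P a) = 0 →
    qf (ad G) (fun a => w (P a)) (fun a => w (P a)) ≤ μ * ∑ a, w (P a) ^ 2
  eig : ∃ e : Fin i → V → ℝ, LinearIndependent ℝ e ∧ ∀ t, Orth P (e t) ∧ ∀ a, ∑ b, ad G a b * e t b = μ * e t a

section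
variable {k : ℕ} {M : Matrix (Fin k) (Fin k) ℕ} {M' : Matrix (Fin k) (Fin k) ℤ} {β : ℝ}
variable {V : Type} [Fintype V] {G : SimpleGraph V} {P : V → Fin k}

theorem StV.transport {μ : ℝ} {v : Fin k → ℝ} {i : ℕ} (h : StV M μ v G P i) {U : Type} [Fintype U] (φ : U ≃ V) :
    StV M μ v (G.comap φ) (P ∘ φ) i := by
  have had : ∀ a b, ad (G.comap φ) a b = ad G (φ a) (φ b) := fun a b => rfl
  have hsum : ∀ F : V → ℝ, ∑ a : U, F (φ a) = ∑ b, F b := fun F => Equiv.sum_comp φ F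
  have hqf : ∀ f g : V → ℝ, qf (ad (G.comap φ)) (fun a => f (φ a)) (fun a => g (φ a)) = qf (ad G) f g := by
    intro f g
    unfold qf
    rw [← hsum]
    refine Finset.sum_congr rfl fun a _ => ?_
    rw [← hsum]
    rfl
  refine ⟨?_, h.surj.comp φ.surjective, ?_, ?_, ?_⟩
  · intro a ψ
    have := h.lift (φ a) ψ
    rw [← hsum] at this
    exact this
  · intro f hf
    have h1 := h.good (fun b => f (φ.symm b)) (by
      intro ψ
      have := hf ψ
      rw [← hsum]
      simpa using this)
    rw [← hqf, ← hsum] at h1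
    simpa using h1
  · intro w hw
    have h1 := h.goodW w (by rw [← hsum]; exact hw)
    rw [← hqf, ← hsum] at h1
    exact h1
  · obtain ⟨e, he, h2⟩ := h.eig
    refine ⟨fun t => e t ∘ φ, ?_, fun t => ⟨?_, ?_⟩⟩
    · exact he.map' (LinearMap.funLeft ℝ ℝ φ) (LinearMap.ker_eq_bot.2 (LinearMap.funLeft_injective_of_surjective ℝ ℝ φ φ.surjective))
    · intro ψ
      have := (h2 t).1 ψ
      rw [← hsum] at this
      exact this
    · intro a
      have := (h2 t).2 (φ a)
      rw [← hsum] at this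
      exact this

theorem good_cover {μ σ : ℝ} (hσμ : σ ≤ μ)
    (hgood : ∀ f, Orth P f → qf (ad G) f f ≤ μ * ∑ a, f a ^ 2)
    {V' : Type} [Fintype V'] (G' : SimpleGraph V') (p : V' → V) (hcov : Equit (ad G') p (ad G)) (N : ℝ) (hN : 0 < N)
    (hp : Unif p N)
    (hnew : ∀ f, Orth p f → qf (ad G') f f ≤ σ * ∑ a, f a ^ 2) (f : V' → ℝ) (hf : Orth (P ∘ p) f) :
    qf (ad G') f f ≤ μ * ∑ a, f a ^ 2 := by
  obtain ⟨g, hz⟩ := proj_ex p f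
  set z : V' → ℝ := fun a => f a - g (p a) with hzdef
  have hfs : f = fun a => g (p a) + z a := by funext a; simp [z]
  have hg : Orth P g := by
    intro φ
    have h1 := hf φ
    have h2 := hz (fun v => φ (P v))
    have h3 := hp (fun v => g v * φ (P v))
    have h4 : ∑ a, f a * φ ((P ∘ p) a) = ∑ a, g (p a) * φ (P (p a)) + ∑ a, z a * φ (P (p a)) := by
      rw [← Finset.sum_add_distrib]
      exact Finset.sum_congr rfl fun a _ => by simp only [z, Function.comp]; ring
    rw [h1, h2, h3, add_zero] at h4
    rcases mul_eq_zero.1 h4.symm with h | h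
    · exact absurd h hN.ne'
    · exact h
  have hqg : qf (ad G') (fun a => g (p a)) (fun a => g (p a)) = N * qf (ad G) g g := by
    rw [qf_equit hcov, hp (fun u => g u * ∑ v, ad G u v * g v)]
    congr 1
    unfold qf
    simp only [Finset.mul_sum]
    exact Finset.sum_congr rfl fun a _ => Finset.sum_congr rfl fun b _ => by ring
  rw [hfs, pyth p z hz g, qf_add (ad_symm G'), qf_symm (ad_symm G') (fun a => g (p a)) z, qf_equit_orth hcov z hz g, hqg,
    hp (fun v => g v ^ 2)]
  have h1 := mul_le_mul_of_nonneg_left (hgood g hg) hN.le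
  have h2 := hnew z hz
  have h3 := mul_le_mul_of_nonneg_right hσμ (Finset.sum_nonneg fun a (_ : a ∈ (univ : Finset V')) => sq_nonneg (z a))
  linarith

theorem unif_surj {V' : Type} [Fintype V'] {p : V' → V} {N : ℝ} (hN : 0 < N) (hp : Unif p N) : Function.Surjective p := by
  classical
  intro u
  by_contra hno
  push Not at hno
  have := hp (fun v => if v = u then 1 else 0)
  simp [hno] at this
  exact hN.ne this

theorem step (hM : MemM M M' β) [Nonempty (Fin k)] (v : Fin k → ℝ) (i n : ℕ) (hn : 1 ≤ n) (hcard : Fintype.card V = n)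
    (h : StV M (lam (intToReal M') 1) v G P i) :
    ∃ (U : Type) (_ : Fintype U) (G₂ : SimpleGraph U) (P₂ : U → Fin k),
      StV M (lam (intToReal M') 1) v G₂ P₂ (i + 1) ∧ n < Fintype.card U ∧ Fintype.card U ≤ 4 * n ^ 9 := by
  set μ := lam (intToReal M') 1 with hμ
  obtain ⟨T, hT1, hT2⟩ : ∃ T : ℕ, n ≤ 2 ^ T ∧ 2 ^ T ≤ 2 * n := by
    refine ⟨Nat.log 2 n + 1, (Nat.lt_pow_succ_log_self (by norm_num) n).le, ?_⟩
    have := Nat.pow_log_le_self 2 (by omega : n ≠ 0)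
    rw [pow_succ]; omega
  have hσ0 : 0 ≤ sigmaM M / 2 := by have := sigma_nonneg (M := M); linarith
  obtain ⟨V', _, G', p, hcov, hp, hc', hnew⟩ := cover_ex G (sigmaM M / 2) hσ0 (by
    intro a
    have := h.lift a (fun _ => 1)
    simp only [mul_one] at this
    rw [this]; exact deg_bound hM _) T
  have hnew' : ∀ f, Orth p f → qf (ad G') f f ≤ sigmaM M * ∑ a, f a ^ 2 := by
    intro f hf
    have := hnew f hf
    rwa [mul_div_cancel₀ _ (by norm_num : (2:ℝ) ≠ 0)] at this
  have hNn : (Fintype.card V : ℝ) ≤ (2:ℝ) ^ T := by rw [hcard]; exact_mod_cast hT1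
  have hN0 : (0:ℝ) < 2 ^ T := by positivity
  obtain ⟨s, hs, hSE, hSq⟩ := signing hM h.lift h.good G' p hcov _ hp hNn hnew'
  have hgood' := good_cover (sigma_le' hM) h.good G' p hcov _ hN0 hp hnew'
  have hps := unif_surj hN0 hp
  have hfs : Function.Surjective (Prod.fst : V' × Bool → V') := fun a => ⟨(a, true), rfl⟩
  have hall : Unif (p ∘ (Prod.fst : V' × Bool → V')) (2 * 2 ^ T) := unif_fst.comp hp
  have hcov2 : Equit (ad (twoLift G' s hs)) (p ∘ Prod.fst) (ad G) := (equit_twoLift G' s hs).comp hcov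
  refine ⟨V' × Bool, inferInstance, twoLift G' s hs, P ∘ (p ∘ Prod.fst), ⟨hcov2.comp h.lift, h.surj.comp (hps.comp hfs), ?_, ?_, ?_⟩, ?_, ?_⟩
  · intro f hf
    obtain ⟨g, o, rfl⟩ := split_bool f
    rw [qf_twoLift, sq_bool]
    have e1 := hgood' g (orth_bool g o hf)
    have e2 := hSq o
    linarith
  · intro w hw
    have h1 := hall (fun u => v (P u) * w (P u))
    have h2 : ∑ u, v (P u) * w (P u) = 0 := by
      have h3 : (0:ℝ) = 2 * 2 ^ T * ∑ u, v (P u) * w (P u) := by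
        rw [← h1]; exact hw.symm
      rcases mul_eq_zero.1 h3.symm with h | h
      · exfalso; linarith
      · exact h
    have h4 := h.goodW w h2
    have h5 := hall (fun u => w (P u) ^ 2)
    have h6 := hall (fun u => w (P u) * ∑ j, natToReal M (P u) j * w j)
    have e1 : qf (ad (twoLift G' s hs)) (fun a => w ((P ∘ p ∘ Prod.fst) a)) (fun a => w ((P ∘ p ∘ Prod.fst) a)) = 2 * 2 ^ T * qf (ad G) (fun a => w (P a)) (fun a => w (P a)) := by
      rw [qf_equit (hcov2.comp h.lift), qf_equit h.lift]
      exact h6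
    have e2 : ∑ a, w ((P ∘ p ∘ (Prod.fst : V' × Bool → V')) a) ^ 2 = 2 * 2 ^ T * ∑ u, w (P u) ^ 2 := h5
    rw [e1, e2]
    have := mul_le_mul_of_nonneg_left h4 (by positivity : (0:ℝ) ≤ 2 * 2 ^ T)
    linarith
  · obtain ⟨e, he, h2⟩ := h.eig
    obtain ⟨x, hx0, hx⟩ := L1_ex (intToReal M') (intToReal_symm hM)
    refine ⟨Fin.cons (fun c => sg c.2 * x (P (p c.1))) (fun t => e t ∘ (p ∘ Prod.fst)), ?_, ?_⟩
    · rw [linearIndependent_finCons]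
      refine ⟨he.map' (LinearMap.funLeft ℝ ℝ (p ∘ Prod.fst)) (LinearMap.ker_eq_bot.2 (LinearMap.funLeft_injective_of_surjective ℝ ℝ _ (hps.comp hfs))), ?_⟩
      intro hmem
      have hle : Submodule.span ℝ (Set.range fun t => e t ∘ (p ∘ (Prod.fst : V' × Bool → V'))) ≤ LinearMap.range (LinearMap.funLeft ℝ ℝ (p ∘ (Prod.fst : V' × Bool → V'))) := by
        rw [Submodule.span_le]
        rintro _ ⟨t, rfl⟩
        exact ⟨e t, rfl⟩
      obtain ⟨f, hf⟩ := hle hmem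
      apply hx0
      funext j
      obtain ⟨u, rfl⟩ := h.surj j
      obtain ⟨a, rfl⟩ := hps u
      have f1 := congrFun hf (a, true)
      have f2 := congrFun hf (a, false)
      simp [LinearMap.funLeft, sg] at f1 f2
      simp only [Pi.zero_apply]
      linarith
    · intro t
      refine Fin.cases ?_ (fun t => ?_) t
      · simp only [Fin.cons_zero]
        constructor
        · intro φ
          rw [sum_bool]
          refine Finset.sum_eq_zero fun a _ => ?_
          simp [sg]
        · rintro ⟨a, y⟩
          have h3 := sum_ad_twoLift G' s hs a y (fun _ => 0) (fun a => x (P (p a)))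
          simp only [zero_add, mul_zero, Finset.sum_const_zero] at h3
          rw [h3]
          have h4 := hSE a x
          simp only [Function.comp] at h4
          rw [h4]
          have h5 := congrFun hx (P (p a))
          simp only [mulVec, dotProduct, Pi.smul_apply, smul_eq_mul] at h5
          rw [h5]
          ring
      · simp only [Fin.cons_succ]
        constructor
        · intro φ
          have h3 := hall (fun u => e t u * φ (P u))
          rw [(h2 t).1 φ, mul_zero] at h3
          exact h3
        · intro c
          have h3 := hcov2 c (e t)
          simp only [Function.comp] at h3 ⊢
          rw [h3]
          exact (h2 t).2 _
  · rw [Fintype.card_prod, hc', Fintype.card_bool, hcard]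
    nlinarith
  · rw [Fintype.card_prod, hc', Fintype.card_bool, hcard]
    have h1 : 2 ^ T * n * 2 ≤ 4 * n ^ 2 := by nlinarith
    have h2 : n ^ 2 ≤ n ^ 9 := Nat.pow_le_pow_right hn (by norm_num)
    omega

theorem adjMat_eq (G : SimpleGraph V) : adjMat G = Matrix.of (ad G) := by
  ext a b
  simp [adjMat, ad, SimpleGraph.adjMatrix_apply]

theorem adjMat_symm (G : SimpleGraph V) : (adjMat G).IsSymm := by
  rw [adjMat_eq]
  ext a b
  exact ad_symm G b a

theorem lift_eig (hP : Equit (ad G) P (natToReal M)) (v : Fin k → ℝ) (Λ : ℝ) (hv : natToReal M *ᵥ v = Λ • v) :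
    adjMat G *ᵥ (fun a => v (P a)) = Λ • (fun a => v (P a)) := by
  funext a
  rw [adjMat_eq]
  have h1 := hP a v
  have h2 := congrFun hv (P a)
  simp only [mulVec, dotProduct, Pi.smul_apply, smul_eq_mul, of_apply] at h2 ⊢
  rw [h1, h2]

theorem lam1_eq [DecidableEq V] [Nonempty V] (hM : MemM M M' β) (hP : Equit (ad G) P (natToReal M)) (hs : Function.Surjective P)
    (v : Fin k → ℝ) (hv0 : v ≠ 0) (hv : natToReal M *ᵥ v = lam (natToReal M) 1 • v) :
    lam (adjMat G) 1 = lam (natToReal M) 1 := by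
  have hpos : ∀ w : V → ℝ, w ≠ 0 → 0 < ∑ a, w a ^ 2 := by
    intro w hw
    obtain ⟨a, ha⟩ := Function.ne_iff.1 hw
    exact Finset.sum_pos' (fun _ _ => sq_nonneg _) ⟨a, mem_univ _, by have : w a ≠ 0 := ha
                                                                      positivity⟩
  have hev : ∀ (w : V → ℝ) (c : ℝ), adjMat G *ᵥ w = c • w → qf (adjMat G) w w = c * ∑ a, w a ^ 2 := by
    intro w c hw
    rw [qf_eq, hw, dotProduct_smul, smul_eq_mul]
    congr 1
    exact Finset.sum_congr rfl fun a _ => by ring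
  have hu0 : (fun a => v (P a)) ≠ 0 := by
    intro h0
    apply hv0
    funext j
    obtain ⟨a, rfl⟩ := hs j
    exact congrFun h0 a
  apply le_antisymm
  · obtain ⟨w, hw0, hw⟩ := L1_ex (adjMat G) (adjMat_symm G)
    have h1 := hev w _ hw
    have h2 := liftBound' (ad_nonneg G) (ad_symm G) (natToReal_symm hM) hP w
    have h3 := (le_abs_self _).trans h2
    have h4 : qf (ad G) w w = qf (adjMat G) w w := by rw [adjMat_eq]; rfl
    rw [h4, h1] at h3
    exact le_of_mul_le_mul_right h3 (hpos w hw0)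
  · have h1 := hev _ _ (lift_eig hP v _ hv)
    have h2 := L1 (adjMat G) (adjMat_symm G) (fun a => v (P a))
    rw [h1] at h2
    exact le_of_mul_le_mul_right h2 (hpos _ hu0)

theorem finish [DecidableEq V] [Nonempty V] (hM : MemM M M' β) (v : Fin k → ℝ) (hv0 : v ≠ 0)
    (hv : natToReal M *ᵥ v = lam (natToReal M) 1 • v) (i : ℕ) (hi : 1 ≤ i) (h : StV M (lam (intToReal M') 1) v G P i) :
    lam (adjMat G) 1 = lam (natToReal M) 1 ∧
        lam (adjMat G) 2 = lam (intToReal M') 1 ∧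
        i ≤ eigMult (adjMat G) (lam (intToReal M') 1) ∧
        ((∃ c : ℝ, (natToReal M).mulVec (fun _ => 1) = c • (fun _ => (1 : ℝ))) →
          ∃ dr : ℕ, IsRegularGraph G dr) := by
  set μ := lam (intToReal M') 1 with hμ
  have hl1 := lam1_eq hM h.lift h.surj v hv0 hv
  have hu0 : (fun a => v (P a)) ≠ 0 := by
    intro h0
    apply hv0
    funext j
    obtain ⟨a, rfl⟩ := h.surj j
    exact congrFun h0 a
  obtain ⟨e, he, h2⟩ := h.eig
  have hea : ∀ t, adjMat G *ᵥ (e t) = μ • e t := by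
    intro t
    funext a
    rw [adjMat_eq]
    exact (h2 t).2 a
  refine ⟨hl1, ?_, ?_, ?_⟩
  · let t : Fin i := ⟨0, hi⟩
    refine L3 (adjMat G) (adjMat_symm G) (fun a => v (P a)) (e t) μ hu0 (by rw [hl1]; exact lift_eig h.lift v _ hv) ?_ (he.ne_zero t) (hea t) ?_
    · have := (h2 t).1 v
      rw [← this]
      exact Finset.sum_congr rfl fun a _ => by ring
    · intro g hg
      have h4 : qf (adjMat G) g g = qf (ad G) g g := by rw [adjMat_eq]; rfl
      rw [h4]
      obtain ⟨w, hz⟩ := proj_ex P g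
      set z : V → ℝ := fun a => g a - w (P a) with hzdef
      have hgs : g = fun a => w (P a) + z a := by funext a; simp [z]
      have hw : ∑ a, v (P a) * w (P a) = 0 := by
        have h5 := hz v
        have h6 : ∑ a, v (P a) * g a = ∑ a, v (P a) * w (P a) + ∑ a, z a * v (P a) := by
          rw [← Finset.sum_add_distrib]
          exact Finset.sum_congr rfl fun a _ => by simp only [z]; ring
        rw [h5, add_zero] at h6
        rw [← h6]; exact hg
      rw [hgs, pyth P z hz w, qf_add (ad_symm G), qf_symm (ad_symm G) (fun a => w (P a)) z, qf_equit_orth h.lift z hz w]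
      have h7 := h.goodW w hw
      have h8 := h.good z hz
      linarith
  · unfold eigMult
    let e' : Fin i → Module.End.eigenspace (Matrix.mulVecLin (adjMat G)) μ := fun t =>
      ⟨e t, by rw [Module.End.mem_eigenspace_iff]; exact hea t⟩
    have he' : LinearIndependent ℝ e' := LinearIndependent.of_comp (Submodule.subtype _) he
    have := he'.fintype_card_le_finrank
    simpa using this
  · rintro ⟨c, hc⟩
    refine ⟨⌊c⌋₊, fun a => ?_⟩
    have h5 := h.lift a (fun _ => 1)
    have h6 := congrFun hc (P a)
    simp only [mulVec, dotProduct, Pi.smul_apply, smul_eq_mul, mul_one] at h6 h5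
    rw [h6] at h5
    have h7 : (deg G a : ℝ) = c := by
      rw [← h5]
      unfold deg ad
      rw [← SimpleGraph.card_neighborFinset_eq_degree, SimpleGraph.neighborFinset_eq_filter]
      simp
    rw [← h7, Nat.floor_natCast]

theorem start {n : ℕ} (hM : MemM M M' β) (G₀ : SimpleGraph (Fin n)) (P₀ : Fin n → Fin k) (hne : Nonempty (Fin n))
    (hlift₀ : IsGraphLift M G₀ P₀) (hlam₀ : lam (adjMat G₀) 2 ≤ lam (intToReal M') 1)
    (v : Fin k → ℝ) (hv0 : v ≠ 0) (hv : natToReal M *ᵥ v = lam (natToReal M) 1 • v) :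
    StV M (lam (intToReal M') 1) v G₀ P₀ 0 := by
  classical
  have hP : Equit (ad G₀) P₀ (natToReal M) := by
    intro a φ
    rw [fib_sum P₀ (fun b => ad G₀ a b) φ]
    refine Finset.sum_congr rfl fun j _ => ?_
    congr 1
    by_cases hj : j = P₀ a
    · subst hj
      simp only [natToReal, of_apply, hM.diag, Nat.cast_zero]
      refine Finset.sum_eq_zero fun b _ => ?_
      split_ifs with hb
      · have : ¬ G₀.Adj a b := fun hadj => hlift₀.not_adj_within a b hadj hb.symm
        simp [ad, this]
      · rfl
    · have := hlift₀.between_regular a j hj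
      simp only [natToReal, of_apply]
      rw [← this, Set.ncard_eq_toFinset_card']
      have : ∀ b, (if P₀ b = j then ad G₀ a b else 0) = if (G₀.Adj a b ∧ P₀ b = j) then 1 else 0 := by
        intro b
        by_cases h1 : P₀ b = j <;> by_cases h2 : G₀.Adj a b <;> simp [ad, h1, h2]
      simp only [this, Finset.sum_boole]
      congr 2
      ext b
      simp
  have hl1 := lam1_eq hM hP hlift₀.parts_cover v hv0 hv
  have hu0 : (fun a => v (P₀ a)) ≠ 0 := by
    intro h0
    apply hv0
    funext j
    obtain ⟨a, rfl⟩ := hlift₀.parts_cover j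
    exact congrFun h0 a
  have hmain : ∀ f, (fun a => v (P₀ a)) ⬝ᵥ f = 0 → qf (ad G₀) f f ≤ lam (intToReal M') 1 * ∑ a, f a ^ 2 := by
    intro f hf
    have h1 := L2 (adjMat G₀) (adjMat_symm G₀) _ f hu0 (by rw [hl1]; exact lift_eig hP v _ hv) hf
    have h4 : qf (adjMat G₀) f f = qf (ad G₀) f f := by rw [adjMat_eq]; rfl
    rw [h4] at h1
    exact h1.trans (mul_le_mul_of_nonneg_right hlam₀ (Finset.sum_nonneg fun _ _ => sq_nonneg _))
  refine ⟨hP, hlift₀.parts_cover, fun f hf => hmain f ?_, fun w hw => hmain _ hw, ⟨fun t => t.elim0, linearIndependent_empty_type, fun t => t.elim0⟩⟩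
  rw [← hf v]
  exact Finset.sum_congr rfl fun a _ => by ring
end

end partP5

theorem stmt_14 {k r : ℕ} (M : Matrix (Fin k) (Fin k) ℕ) (M' : Matrix (Fin k) (Fin k) ℤ)
    (β : ℝ) (hM : MemM M M' β)
    (n₀' : ℕ) (hn₀' : n₀' ≤ r)
    (G₀ : SimpleGraph (Fin n₀')) (P₀ : Fin n₀' → Fin k)
    (hconn₀ : G₀.Connected) (hlift₀ : IsGraphLift M G₀ P₀)
    (hlam₀ : lam (adjMat G₀) 2 ≤ lam (intToReal M') 1) :
    ∃ nseq : ℕ → ℕ, nseq 0 = r ∧ 0 < nseq 0 ∧ StrictMono nseq ∧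
      (∀ i, nseq (i + 1) ≤ 4 * nseq i ^ 9) ∧
      ∀ i : ℕ, 1 ≤ i → ∃ G : SimpleGraph (Fin (nseq i)),
        lam (adjMat G) 1 = lam (natToReal M) 1 ∧
        lam (adjMat G) 2 = lam (intToReal M') 1 ∧
        i ≤ eigMult (adjMat G) (lam (intToReal M') 1) ∧
        ((∃ c : ℝ, (natToReal M).mulVec (fun _ => 1) = c • (fun _ => (1 : ℝ))) →
          ∃ dr : ℕ, IsRegularGraph G dr) := by
  have hne : Nonempty (Fin n₀') := hconn₀.nonempty
  have hnek : Nonempty (Fin k) := hne.map P₀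
  have hn1 : 1 ≤ n₀' := Fin.pos_iff_nonempty.2 hne
  obtain ⟨v, hv0, hv⟩ := L1_ex (natToReal M) (natToReal_symm hM)
  let St : ℕ → ℕ → Prop := fun i n => 1 ≤ n ∧ ∃ (G : SimpleGraph (Fin n)) (P : Fin n → Fin k),
    StV M (lam (intToReal M') 1) v G P i
  have hstep : ∀ i n, St i n → ∃ n', n < n' ∧ n' ≤ 4 * n ^ 9 ∧ St (i + 1) n' := by
    rintro i n ⟨hn, G, P, h⟩
    obtain ⟨U, _, G₂, P₂, h2, h3, h4⟩ := step hM v i n hn (Fintype.card_fin n) h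
    exact ⟨Fintype.card U, h3, h4, by omega, _, _, h2.transport (Fintype.equivFin U).symm⟩
  choose! nx hx1 hx2 hx3 using hstep
  let m : ℕ → ℕ := fun j => Nat.rec n₀' (fun j mj => nx j mj) j
  have hm0 : m 0 = n₀' := rfl
  have hms : ∀ j, m (j + 1) = nx j (m j) := fun j => rfl
  have hSt : ∀ j, St j (m j) := by
    intro j
    induction j with
    | zero => exact ⟨hn1, G₀, P₀, start hM G₀ P₀ hne hlift₀ hlam₀ v hv0 hv⟩
    | succ j ih => rw [hms]; exact hx3 j _ ih
  have hlt : ∀ j, m j < m (j + 1) := fun j => by rw [hms]; exact hx1 j _ (hSt j)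
  have hle : ∀ j, m (j + 1) ≤ 4 * m j ^ 9 := fun j => by rw [hms]; exact hx2 j _ (hSt j)
  have hmono : StrictMono m := strictMono_nat_of_lt_succ hlt
  obtain ⟨j, hj1, hj2⟩ : ∃ j, m j ≤ r ∧ r < m (j + 1) := by
    by_contra hno
    push Not at hno
    have hall : ∀ j, m j ≤ r := by
      intro j
      induction j with
      | zero => exact hn₀'
      | succ j ih => exact hno j ih
    have h1 := hmono.le_apply (x := r + 1)
    have h2 := hall (r + 1)
    omega
  have hr : 0 < r := by omega
  refine ⟨fun i => if i = 0 then r else m (j + i), by simp, by simpa using hr, ?_, ?_, ?_⟩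
  · refine strictMono_nat_of_lt_succ fun i => ?_
    rcases Nat.eq_zero_or_pos i with rfl | hi
    · simpa using hj2
    · simp only [hi.ne', if_false, Nat.succ_ne_zero]
      exact hlt (j + i)
  · intro i
    rcases Nat.eq_zero_or_pos i with rfl | hi
    · simp only [zero_add, one_ne_zero, if_false, if_true]
      exact (hle j).trans (by gcongr)
    · simp only [hi.ne', if_false, Nat.succ_ne_zero]
      exact hle (j + i)
  · intro i hi
    have hi0 : i ≠ 0 := by omega
    have hkey : ∀ n, n = m (j + i) → ∃ G : SimpleGraph (Fin n),
        lam (adjMat G) 1 = lam (natToReal M) 1 ∧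
        lam (adjMat G) 2 = lam (intToReal M') 1 ∧
        i ≤ eigMult (adjMat G) (lam (intToReal M') 1) ∧
        ((∃ c : ℝ, (natToReal M).mulVec (fun _ => 1) = c • (fun _ => (1 : ℝ))) →
          ∃ dr : ℕ, IsRegularGraph G dr) := by
      intro n hnm
      have hst : St (j + i) n := by rw [hnm]; exact hSt (j + i)
      obtain ⟨hn, G, P, h⟩ := hst
      have : Nonempty (Fin n) := Fin.pos_iff_nonempty.1 hn
      obtain ⟨a1, a2, a3, a4⟩ := finish hM v hv0 hv (j + i) (by omega) h
      exact ⟨G, a1, a2, by omega, a4⟩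
    exact hkey _ (by simp [hi0])
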